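/- Corollary of Halász's Theorem for arithmetic progressions: For every κ > 0 there is a constant C = C(κ) > 0 such that for all f in the class C(κ), all natural numbers q ≥ 1 and a with gcd(a,q) = 1, and all real x ≥ max(q^4, C), the following holds. For each Dirichlet character χ mod q let M_χ = M_χ(x) be defined by max_{|t| ≤ (log x)^κ} |F_χ(1+1/log x+it)/(1+1/log x+it)| = e^{−M_χ}·(log x)^κ, and let M_q = min over all χ mod q of M_χ(x). Then |∑_{n ≤ x, n ≡ a (mod q)} f(n)| ≤ C · (1/φ(q)) · (x/log x) · ( (1+M_q)·e^{−M_q}·(log x)^κ + (log(q·log x))^κ ). -/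

import Mathlib

open Complex MeasureTheory
open scoped Classical

noncomputable section

/-- Membership of `f` in the class `C(κ)`, witnessed by `Λf`. -/
structure IsHalaszClass (κ : ℝ) (f : ℕ → ℂ) (Λf : ℕ → ℂ) : Prop where
  map_one : f 1 = 1
  mult : ∀ m n : ℕ, Nat.Coprime m n → f (m * n) = f m * f n
  supp : ∀ n : ℕ, ¬ IsPrimePow n → Λf n = 0
  bound : ∀ n : ℕ, 1 ≤ n → ‖Λf n‖ ≤ κ * ArithmeticFunction.vonMangoldt n
  conv : ∀ n : ℕ, 1 ≤ n →
    f n * (Real.log n : ℂ) = ∑ d ∈ n.divisors, Λf d * f (n / d)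
  abs_conv : ∀ σ : ℝ, 1 < σ → Summable (fun n : ℕ => ‖f n‖ / (n : ℝ) ^ σ)

/-- The Dirichlet series `F(s) = ∑ f(n) n^{-s}`. -/
def Fser (f : ℕ → ℂ) (s : ℂ) : ℂ := ∑' n : ℕ, f n / (n : ℂ) ^ s

/-- The twisted Dirichlet series `F_χ(s) = ∑ f(n) χ(n) n^{-s}`. -/
def FserChi {q : ℕ} (f : ℕ → ℂ) (χ : DirichletCharacter ℂ q) (s : ℂ) : ℂ :=
  ∑' n : ℕ, f n * χ (n : ZMod q) / (n : ℂ) ^ s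

theorem card_Ioc_filter_modEq_sub_le (A B m v : ℕ) (hAB : A ≤ B) (hm : 0 < m) :
    |(((Finset.Ioc A B).filter (fun n => n ≡ v [MOD m])).card : ℝ) - ((B : ℝ) - A) / m| ≤ 1 := by
  have h := Nat.Ioc_filter_modEq_card A B hm v
  have hcast : ((((Finset.Ioc A B).filter (fun n => n ≡ v [MOD m])).card : ℤ) : ℝ)
      = ((max (⌊((B : ℚ) - v) / m⌋ - ⌊((A : ℚ) - v) / m⌋) 0 : ℤ) : ℝ) := by
    rw [← h]
  have h1 := Int.floor_le (((B : ℚ) - v) / m)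
  have h2 := Int.lt_floor_add_one (((B : ℚ) - v) / m)
  have h3 := Int.floor_le (((A : ℚ) - v) / m)
  have h4 := Int.lt_floor_add_one (((A : ℚ) - v) / m)
  have hle : ⌊((A : ℚ) - v) / m⌋ ≤ ⌊((B : ℚ) - v) / m⌋ := by
    apply Int.floor_le_floor
    have : (A : ℚ) ≤ B := by exact_mod_cast hAB
    gcongr
  rw [max_eq_left (by linarith)] at hcast
  have e : (((Finset.Ioc A B).filter (fun n => n ≡ v [MOD m])).card : ℝ)
    = ((⌊((B : ℚ) - v) / m⌋ : ℤ) : ℝ) - ((⌊((A : ℚ) - v) / m⌋ : ℤ) : ℝ) := by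
    push_cast at hcast; exact hcast
  rw [e]
  have h1' : ((⌊((B : ℚ) - v) / m⌋ : ℤ) : ℝ) ≤ ((B : ℝ) - v) / m := by exact_mod_cast h1
  have h2' : ((B : ℝ) - v) / m < ((⌊((B : ℚ) - v) / m⌋ : ℤ) : ℝ) + 1 := by exact_mod_cast h2
  have h3' : ((⌊((A : ℚ) - v) / m⌋ : ℤ) : ℝ) ≤ ((A : ℝ) - v) / m := by exact_mod_cast h3
  have h4' : ((A : ℝ) - v) / m < ((⌊((A : ℚ) - v) / m⌋ : ℤ) : ℝ) + 1 := by exact_mod_cast h4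
  have e2 : ((B : ℝ) - A) / m = ((B : ℝ) - v) / m - ((A : ℝ) - v) / m := by ring
  rw [e2, abs_le]
  constructor <;> linarith

theorem card_Ioc_filter_dvd_modEq_sub_le (A B q a d : ℕ) (hAB : A ≤ B) (hq : 0 < q) (hd : 0 < d)
    (hdq : Nat.Coprime d q) :
    |(((Finset.Ioc A B).filter (fun n => d ∣ n ∧ n ≡ a [MOD q])).card : ℝ)
      - ((B : ℝ) - A) / (d * q)| ≤ 1 := by
  obtain ⟨v, hv0, hva⟩ := Nat.chineseRemainder hdq 0 a
  have h := card_Ioc_filter_modEq_sub_le A B (d * q) v hAB (Nat.mul_pos hd hq)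
  push_cast at h
  convert h using 5
  apply Finset.filter_congr
  intro n _
  rw [← Nat.modEq_and_modEq_iff_modEq_mul hdq]
  constructor
  · rintro ⟨h1, h2⟩
    exact ⟨((Nat.modEq_zero_iff_dvd.2 h1).trans hv0.symm), h2.trans hva.symm⟩
  · rintro ⟨h1, h2⟩
    exact ⟨Nat.modEq_zero_iff_dvd.1 (h1.trans hv0), h2.trans hva⟩

/-- Squarefree integers up to `z` coprime to `q`. -/
def sieveSet (q z : ℕ) : Finset ℕ :=
  (Finset.Icc 1 z).filter (fun d => Squarefree d ∧ Nat.Coprime d q)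

/-- The Selberg sieve denominator. -/
def sieveDenom (q z : ℕ) : ℝ := ∑ d ∈ sieveSet q z, 1 / (d.totient : ℝ)

theorem mem_sieveSet {q z d : ℕ} :
    d ∈ sieveSet q z ↔ (1 ≤ d ∧ d ≤ z) ∧ Squarefree d ∧ Nat.Coprime d q := by
  simp [sieveSet]

theorem sieveSet_of_dvd {q z d e : ℕ} (hd : d ∈ sieveSet q z) (h : e ∣ d) : e ∈ sieveSet q z := by
  rw [mem_sieveSet] at *
  refine ⟨⟨Nat.pos_of_dvd_of_pos h hd.1.1, (Nat.le_of_dvd hd.1.1 h).trans hd.1.2⟩,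
    hd.2.1.squarefree_of_dvd h, Nat.Coprime.coprime_dvd_left h hd.2.2⟩

theorem sieveDenom_pos {q z : ℕ} (hz : 1 ≤ z) : 0 < sieveDenom q z := by
  apply Finset.sum_pos
  · intro d hd
    rw [mem_sieveSet] at hd
    have : 0 < d.totient := Nat.totient_pos.2 hd.1.1
    positivity
  · exact ⟨1, by rw [mem_sieveSet]; simp [hz]⟩

/-- Möbius inversion on an interval of the divisor lattice. -/
theorem sum_moebius_between {k j : ℕ} (hj : 0 < j) (S : Finset ℕ) (hS : ∀ d, d ∣ j → d ∈ S) :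
    ∑ d ∈ S, (if k ∣ d ∧ d ∣ j then (ArithmeticFunction.moebius (j / d) : ℝ) else 0)
      = if k = j then 1 else 0 := by
  by_cases hkj : k ∣ j
  · obtain ⟨m, rfl⟩ := hkj
    have hk : 0 < k := Nat.pos_of_mul_pos_right hj
    have hm : 0 < m := Nat.pos_of_mul_pos_left hj
    have h1 : ∑ d ∈ S, (if k ∣ d ∧ d ∣ k * m then (ArithmeticFunction.moebius (k * m / d) : ℝ) else 0)
        = ∑ e ∈ m.divisors, (ArithmeticFunction.moebius (m / e) : ℝ) := by
      rw [← Finset.sum_filter]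
      symm
      apply Finset.sum_bij (fun e _ => k * e)
      · intro e he
        rw [Nat.mem_divisors] at he
        have : k * e ∣ k * m := Nat.mul_dvd_mul_left k he.1
        simp [hS _ this, this]
      · intro e _ e' _ h
        exact Nat.eq_of_mul_eq_mul_left hk h
      · intro d hd
        rw [Finset.mem_filter] at hd
        obtain ⟨-, ⟨e, rfl⟩, h2⟩ := hd
        exact ⟨e, by rw [Nat.mem_divisors]; exact ⟨Nat.dvd_of_mul_dvd_mul_left hk h2, hm.ne'⟩, rfl⟩
      · intro e _
        rw [Nat.mul_div_mul_left _ _ hk]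
    rw [h1, Nat.sum_div_divisors m (fun e => (ArithmeticFunction.moebius e : ℝ))]
    have h2 : ((ArithmeticFunction.zeta * ArithmeticFunction.moebius : ArithmeticFunction ℤ)) m
        = if m = 1 then 1 else 0 := by
      rw [ArithmeticFunction.coe_zeta_mul_moebius, ArithmeticFunction.one_apply]
    rw [ArithmeticFunction.coe_zeta_mul_apply] at h2
    have h3 : ∑ e ∈ m.divisors, (ArithmeticFunction.moebius e : ℝ) = if m = 1 then 1 else 0 := by
      exact_mod_cast h2
    rw [h3]
    by_cases h : m = 1
    · simp [h]
    · have : k ≠ k * m := by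
        intro h4
        apply h
        exact Nat.eq_of_mul_eq_mul_left hk (by omega)
      simp [h, this]
  · have : k ≠ j := by rintro rfl; exact hkj dvd_rfl
    rw [if_neg this]
    apply Finset.sum_eq_zero
    intro d _
    rw [if_neg]
    rintro ⟨h1, h2⟩
    exact hkj (h1.trans h2)

/-- Selberg's weights. -/
def sieveWeight (q z d : ℕ) : ℝ :=
  d * ∑ j ∈ sieveSet q z, if d ∣ j then
    (ArithmeticFunction.moebius (j / d) : ℝ) *
      ((ArithmeticFunction.moebius j : ℝ) / (j.totient * sieveDenom q z)) else 0

theorem sieveWeight_one {q z : ℕ} (hz : 1 ≤ z) : sieveWeight q z 1 = 1 := by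
  have hG := sieveDenom_pos (q := q) hz
  unfold sieveWeight
  simp only [Nat.cast_one, one_mul, one_dvd, if_true, Nat.div_one]
  have : ∀ j ∈ sieveSet q z, (ArithmeticFunction.moebius j : ℝ) *
      ((ArithmeticFunction.moebius j : ℝ) / (j.totient * sieveDenom q z))
      = (1 / (j.totient : ℝ)) * (1 / sieveDenom q z) := by
    intro j hj
    rw [mem_sieveSet] at hj
    have h2 : (ArithmeticFunction.moebius j : ℝ) ^ 2 = 1 := by
      exact_mod_cast ArithmeticFunction.moebius_sq_eq_one_of_squarefree hj.2.1
    rw [← mul_div_assoc, ← sq, h2]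
    field_simp
  rw [Finset.sum_congr rfl this, ← Finset.sum_mul]
  change sieveDenom q z * _ = 1
  field_simp

theorem abs_sieveWeight_le {q z : ℕ} (hz : 1 ≤ z) (d : ℕ) : |sieveWeight q z d| ≤ d := by
  have hG := sieveDenom_pos (q := q) hz
  unfold sieveWeight
  rw [abs_mul, Nat.abs_cast]
  refine mul_le_of_le_one_right (Nat.cast_nonneg d) ?_
  refine (Finset.abs_sum_le_sum_abs _ _).trans ?_
  have : ∀ j ∈ sieveSet q z, |(if d ∣ j then
    (ArithmeticFunction.moebius (j / d) : ℝ) *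
      ((ArithmeticFunction.moebius j : ℝ) / (j.totient * sieveDenom q z)) else 0)|
      ≤ (1 / (j.totient : ℝ)) * (1 / sieveDenom q z) := by
    intro j hj
    have hb : ∀ n, |(ArithmeticFunction.moebius n : ℝ)| ≤ 1 := by
      intro n
      exact_mod_cast ArithmeticFunction.abs_moebius_le_one (n := n)
    split_ifs
    · rw [abs_mul, abs_div, abs_mul, Nat.abs_cast, abs_of_pos hG]
      calc _ ≤ 1 * (1 / ((j.totient : ℝ) * sieveDenom q z)) := by
            gcongr
            · exact hb _
            · exact hb _
        _ = _ := by rw [one_mul, one_div_mul_one_div]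
    · rw [abs_zero]; positivity
  refine (Finset.sum_le_sum this).trans ?_
  rw [← Finset.sum_mul]
  change sieveDenom q z * _ ≤ 1
  field_simp
  exact le_rfl

theorem sum_sieveWeight_div {q z k : ℕ} (hk : k ∈ sieveSet q z) :
    ∑ d ∈ sieveSet q z, (if k ∣ d then sieveWeight q z d / d else 0)
      = (ArithmeticFunction.moebius k : ℝ) / (k.totient * sieveDenom q z) := by
  have h1 : ∀ d ∈ sieveSet q z, (if k ∣ d then sieveWeight q z d / d else 0)
      = ∑ j ∈ sieveSet q z, (if k ∣ d ∧ d ∣ j then (ArithmeticFunction.moebius (j / d) : ℝ) else 0) *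
        ((ArithmeticFunction.moebius j : ℝ) / (j.totient * sieveDenom q z)) := by
    intro d hd
    have hd0 : (d : ℝ) ≠ 0 := by
      have := (mem_sieveSet.1 hd).1.1
      positivity
    split_ifs with h
    · unfold sieveWeight
      rw [mul_div_cancel_left₀ _ hd0]
      apply Finset.sum_congr rfl
      intro j _
      simp [h]
    · simp [h]
  rw [Finset.sum_congr rfl h1, Finset.sum_comm]
  have h2 : ∀ j ∈ sieveSet q z, ∑ d ∈ sieveSet q z,
      (if k ∣ d ∧ d ∣ j then (ArithmeticFunction.moebius (j / d) : ℝ) else 0) *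
        ((ArithmeticFunction.moebius j : ℝ) / (j.totient * sieveDenom q z))
      = if k = j then (ArithmeticFunction.moebius j : ℝ) / (j.totient * sieveDenom q z) else 0 := by
    intro j hj
    rw [← Finset.sum_mul, sum_moebius_between (mem_sieveSet.1 hj).1.1 _
      (fun d hd => sieveSet_of_dvd hj hd)]
    split_ifs <;> simp
  rw [Finset.sum_congr rfl h2, Finset.sum_ite_eq]
  simp [hk]

theorem one_div_lcm_eq {q z d e : ℕ} (hd : d ∈ sieveSet q z) (he : e ∈ sieveSet q z) :
    1 / (Nat.lcm d e : ℝ) = ∑ k ∈ sieveSet q z, (k.totient : ℝ) *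
      ((if k ∣ d then 1 / (d : ℝ) else 0) * (if k ∣ e then 1 / (e : ℝ) else 0)) := by
  have hd1 := (mem_sieveSet.1 hd).1.1
  have he1 := (mem_sieveSet.1 he).1.1
  have h1 : ∑ k ∈ sieveSet q z, (k.totient : ℝ) *
      ((if k ∣ d then 1 / (d : ℝ) else 0) * (if k ∣ e then 1 / (e : ℝ) else 0))
      = (∑ k ∈ (Nat.gcd d e).divisors, (k.totient : ℝ)) * (1 / (d : ℝ) * (1 / e)) := by
    rw [Finset.sum_mul]
    have : (Nat.gcd d e).divisors = (sieveSet q z).filter (fun k => k ∣ d ∧ k ∣ e) := by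
      ext k
      rw [Nat.mem_divisors, Finset.mem_filter, Nat.dvd_gcd_iff]
      have : Nat.gcd d e ≠ 0 := Nat.gcd_ne_zero_left (by omega)
      constructor
      · rintro ⟨h, -⟩
        exact ⟨sieveSet_of_dvd hd h.1, h⟩
      · rintro ⟨-, h⟩
        exact ⟨h, this⟩
    rw [this, Finset.sum_filter]
    apply Finset.sum_congr rfl
    intro k _
    by_cases h1 : k ∣ d <;> by_cases h2 : k ∣ e <;> simp [h1, h2]
  rw [h1]
  have h2 : ∑ k ∈ (Nat.gcd d e).divisors, (k.totient : ℝ) = Nat.gcd d e := by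
    exact_mod_cast Nat.sum_totient (Nat.gcd d e)
  rw [h2]
  have h3 : (Nat.gcd d e : ℝ) * Nat.lcm d e = d * e := by exact_mod_cast Nat.gcd_mul_lcm d e
  have h4 : (Nat.lcm d e : ℝ) ≠ 0 := by
    have := Nat.lcm_pos hd1 he1
    positivity
  have h5 : (d : ℝ) ≠ 0 := by positivity
  have h6 : (e : ℝ) ≠ 0 := by positivity
  field_simp
  linarith

theorem sum_sieveWeight_lcm {q z : ℕ} (hz : 1 ≤ z) :
    ∑ d ∈ sieveSet q z, ∑ e ∈ sieveSet q z,
      sieveWeight q z d * sieveWeight q z e * (1 / (Nat.lcm d e : ℝ)) = 1 / sieveDenom q z := by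
  have hG := sieveDenom_pos (q := q) hz
  have h1 : ∑ d ∈ sieveSet q z, ∑ e ∈ sieveSet q z,
      sieveWeight q z d * sieveWeight q z e * (1 / (Nat.lcm d e : ℝ))
      = ∑ k ∈ sieveSet q z, (k.totient : ℝ) *
        (∑ d ∈ sieveSet q z, (if k ∣ d then sieveWeight q z d / d else 0)) ^ 2 := by
    calc _ = ∑ d ∈ sieveSet q z, ∑ e ∈ sieveSet q z, ∑ k ∈ sieveSet q z, (k.totient : ℝ) *
          ((if k ∣ d then sieveWeight q z d / d else 0) *
            (if k ∣ e then sieveWeight q z e / e else 0)) := by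
          apply Finset.sum_congr rfl
          intro d hd
          apply Finset.sum_congr rfl
          intro e he
          rw [one_div_lcm_eq hd he, Finset.mul_sum]
          apply Finset.sum_congr rfl
          intro k _
          split_ifs <;> ring
      _ = _ := by
          rw [Finset.sum_congr rfl (fun d _ => Finset.sum_comm), Finset.sum_comm]
          apply Finset.sum_congr rfl
          intro k _
          rw [sq, Finset.sum_mul_sum, Finset.mul_sum]
          apply Finset.sum_congr rfl
          intro d _
          rw [Finset.mul_sum]
  rw [h1]
  have h2 : ∀ k ∈ sieveSet q z, (k.totient : ℝ) *
        (∑ d ∈ sieveSet q z, (if k ∣ d then sieveWeight q z d / d else 0)) ^ 2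
      = (1 / (k.totient : ℝ)) * (1 / sieveDenom q z ^ 2) := by
    intro k hk
    rw [sum_sieveWeight_div hk]
    have hk' := mem_sieveSet.1 hk
    have h2 : (ArithmeticFunction.moebius k : ℝ) ^ 2 = 1 := by
      exact_mod_cast ArithmeticFunction.moebius_sq_eq_one_of_squarefree hk'.2.1
    have h3 : 0 < k.totient := Nat.totient_pos.2 hk'.1.1
    have h4 : (0 : ℝ) < k.totient := by exact_mod_cast h3
    rw [div_pow, h2]
    field_simp
  rw [Finset.sum_congr rfl h2, ← Finset.sum_mul]
  change sieveDenom q z * _ = _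
  field_simp

/-- Selberg's upper bound sieve for an interval in an arithmetic progression. -/
theorem card_sifted_le_sieveDenom (A B q a z : ℕ) (hAB : A ≤ B) (hq : 0 < q) (hz : 1 ≤ z) :
    (((Finset.Ioc A B).filter (fun n => n ≡ a [MOD q] ∧
      ∀ p, p.Prime → p ≤ z → Nat.Coprime p q → ¬ p ∣ n)).card : ℝ)
      ≤ ((B : ℝ) - A) / (q * sieveDenom q z) + (z : ℝ) ^ 4 := by
  set D := sieveSet q z with hD
  set lam := sieveWeight q z with hlam
  have h1 : (((Finset.Ioc A B).filter (fun n => n ≡ a [MOD q] ∧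
      ∀ p, p.Prime → p ≤ z → Nat.Coprime p q → ¬ p ∣ n)).card : ℝ)
      ≤ ∑ n ∈ (Finset.Ioc A B).filter (fun n => n ≡ a [MOD q]),
        (∑ d ∈ D, if d ∣ n then lam d else 0) ^ 2 := by
    rw [Finset.card_eq_sum_ones, Nat.cast_sum]
    calc _ ≤ ∑ n ∈ (Finset.Ioc A B).filter (fun n => n ≡ a [MOD q] ∧
            ∀ p, p.Prime → p ≤ z → Nat.Coprime p q → ¬ p ∣ n),
            (∑ d ∈ D, if d ∣ n then lam d else 0) ^ 2 := by
          apply Finset.sum_le_sum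
          intro n hn
          rw [Finset.mem_filter] at hn
          have : (∑ d ∈ D, if d ∣ n then lam d else 0) = 1 := by
            rw [Finset.sum_eq_single 1]
            · simp [hlam, sieveWeight_one hz]
            · intro d hd hd1
              rw [if_neg]
              intro hdn
              obtain ⟨p, hp, hpd⟩ := Nat.exists_prime_and_dvd hd1
              have := mem_sieveSet.1 (sieveSet_of_dvd hd hpd)
              exact hn.2.2 p hp this.1.2 this.2.2 (hpd.trans hdn)
            · intro h
              exact absurd (by rw [hD, mem_sieveSet]; simp [hz]) h
          rw [this]; simp
      _ ≤ _ := by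
          apply Finset.sum_le_sum_of_subset_of_nonneg
          · intro n hn
            rw [Finset.mem_filter] at *
            exact ⟨hn.1, hn.2.1⟩
          · intro n _ _
            positivity
  have h2 : ∑ n ∈ (Finset.Ioc A B).filter (fun n => n ≡ a [MOD q]),
        (∑ d ∈ D, if d ∣ n then lam d else 0) ^ 2
      = ∑ d ∈ D, ∑ e ∈ D, lam d * lam e *
        (((Finset.Ioc A B).filter (fun n => Nat.lcm d e ∣ n ∧ n ≡ a [MOD q])).card : ℝ) := by
    calc _ = ∑ n ∈ (Finset.Ioc A B).filter (fun n => n ≡ a [MOD q]), ∑ d ∈ D, ∑ e ∈ D,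
          (lam d * lam e * if Nat.lcm d e ∣ n then 1 else 0) := by
          apply Finset.sum_congr rfl
          intro n _
          rw [sq, Finset.sum_mul_sum]
          apply Finset.sum_congr rfl
          intro d _
          apply Finset.sum_congr rfl
          intro e _
          by_cases h1 : d ∣ n <;> by_cases h2 : e ∣ n <;> simp [h1, h2, Nat.lcm_dvd_iff]
      _ = _ := by
          rw [Finset.sum_comm]
          apply Finset.sum_congr rfl
          intro d _
          rw [Finset.sum_comm]
          apply Finset.sum_congr rfl
          intro e _
          rw [← Finset.mul_sum, ← Finset.sum_filter, Finset.filter_filter]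
          simp [and_comm]
  have h3 : ∀ d ∈ D, ∀ e ∈ D, lam d * lam e *
        (((Finset.Ioc A B).filter (fun n => Nat.lcm d e ∣ n ∧ n ≡ a [MOD q])).card : ℝ)
      ≤ ((B : ℝ) - A) / q * (lam d * lam e * (1 / (Nat.lcm d e : ℝ))) + (z : ℝ) ^ 2 := by
    intro d hd e he
    have hd' := mem_sieveSet.1 hd
    have he' := mem_sieveSet.1 he
    have hl : 0 < Nat.lcm d e := Nat.lcm_pos hd'.1.1 he'.1.1
    have hc : Nat.Coprime (Nat.lcm d e) q :=
      Nat.Coprime.coprime_dvd_left (Nat.lcm_dvd_mul d e) (Nat.Coprime.mul_left hd'.2.2 he'.2.2)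
    have hcount := card_Ioc_filter_dvd_modEq_sub_le A B q a (Nat.lcm d e) hAB hq hl hc
    set c := (((Finset.Ioc A B).filter (fun n => Nat.lcm d e ∣ n ∧ n ≡ a [MOD q])).card : ℝ)
    have hdz : |lam d| ≤ z := (abs_sieveWeight_le hz d).trans (by exact_mod_cast hd'.1.2)
    have hez : |lam e| ≤ z := (abs_sieveWeight_le hz e).trans (by exact_mod_cast he'.1.2)
    have : lam d * lam e * (c - ((B : ℝ) - A) / (Nat.lcm d e * q)) ≤ z ^ 2 := by
      refine (le_abs_self _).trans ?_
      rw [abs_mul, abs_mul]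
      calc _ ≤ (z : ℝ) * z * 1 := by gcongr
        _ = _ := by ring
    have e1 : ((B : ℝ) - A) / q * (lam d * lam e * (1 / (Nat.lcm d e : ℝ)))
      = lam d * lam e * (((B : ℝ) - A) / (Nat.lcm d e * q)) := by
      field_simp
    rw [e1]
    linarith
  have hcard : (D.card : ℝ) ≤ z := by
    have : D.card ≤ z := (Finset.card_filter_le _ _).trans (by simp)
    exact_mod_cast this
  calc _ ≤ _ := h1
    _ = _ := h2
    _ ≤ ∑ d ∈ D, ∑ e ∈ D,
        (((B : ℝ) - A) / q * (lam d * lam e * (1 / (Nat.lcm d e : ℝ))) + (z : ℝ) ^ 2) :=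
        Finset.sum_le_sum fun d hd => Finset.sum_le_sum fun e he => h3 d hd e he
    _ = ((B : ℝ) - A) / q * (1 / sieveDenom q z) + D.card * (D.card * (z : ℝ) ^ 2) := by
        simp_rw [Finset.sum_add_distrib, ← Finset.mul_sum]
        rw [sum_sieveWeight_lcm hz]
        simp
    _ ≤ ((B : ℝ) - A) / q * (1 / sieveDenom q z) + z * (z * (z : ℝ) ^ 2) := by gcongr
    _ = _ := by
        rw [div_mul_div_comm, mul_one]; ring

theorem sieveDenom_le_prime_mul {p q z : ℕ} (hp : p.Prime) :
    sieveDenom q z ≤ (1 + 1 / ((p : ℝ) - 1)) * sieveDenom (p * q) z := by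
  have hp1 : (1 : ℝ) < p := by exact_mod_cast hp.one_lt
  have h1 : sieveDenom q z = ∑ d ∈ (sieveSet q z).filter (fun d => p ∣ d), 1 / (d.totient : ℝ)
      + ∑ d ∈ (sieveSet q z).filter (fun d => ¬ p ∣ d), 1 / (d.totient : ℝ) :=
    (Finset.sum_filter_add_sum_filter_not _ _ _).symm
  have h2 : ∑ d ∈ (sieveSet q z).filter (fun d => ¬ p ∣ d), 1 / (d.totient : ℝ)
      ≤ sieveDenom (p * q) z := by
    apply Finset.sum_le_sum_of_subset_of_nonneg
    · intro d hd
      rw [Finset.mem_filter, mem_sieveSet] at hd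
      rw [mem_sieveSet]
      exact ⟨hd.1.1, hd.1.2.1, Nat.Coprime.mul_right
        ((Nat.Prime.coprime_iff_not_dvd hp).2 hd.2).symm hd.1.2.2⟩
    · intros; positivity
  have h3 : ∑ d ∈ (sieveSet q z).filter (fun d => p ∣ d), 1 / (d.totient : ℝ)
      ≤ 1 / ((p : ℝ) - 1) * sieveDenom (p * q) z := by
    have : ∀ d ∈ (sieveSet q z).filter (fun d => p ∣ d),
        d / p ∈ sieveSet (p * q) z ∧ p * (d / p) = d ∧
        1 / (d.totient : ℝ) = 1 / ((p : ℝ) - 1) * (1 / ((d / p).totient : ℝ)) := by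
      intro d hd
      rw [Finset.mem_filter, mem_sieveSet] at hd
      obtain ⟨⟨⟨hd1, hdz⟩, hsq, hc⟩, e, rfl⟩ := hd
      rw [Nat.mul_div_cancel_left _ hp.pos]
      have hpe : Nat.Coprime p e := Nat.coprime_of_squarefree_mul hsq
      refine ⟨?_, rfl, ?_⟩
      · rw [mem_sieveSet]
        refine ⟨⟨Nat.pos_of_mul_pos_left hd1, le_trans (Nat.le_mul_of_pos_left _ hp.pos) hdz⟩,
          hsq.squarefree_of_dvd (Dvd.intro_left _ rfl), Nat.Coprime.mul_right hpe.symm ?_⟩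
        exact Nat.Coprime.coprime_dvd_left (Dvd.intro_left _ rfl) hc
      · rw [Nat.totient_mul hpe, Nat.totient_prime hp, Nat.cast_mul, Nat.cast_sub hp.pos,
          one_div_mul_one_div, Nat.cast_one]
    rw [Finset.sum_congr rfl (fun d hd => (this d hd).2.2), ← Finset.mul_sum]
    apply mul_le_mul_of_nonneg_left _ (by apply one_div_nonneg.2; linarith)
    rw [← Finset.sum_image (g := fun d => d / p) (f := fun e => 1 / (e.totient : ℝ))]
    · apply Finset.sum_le_sum_of_subset_of_nonneg
      · intro e he
        obtain ⟨d, hd, rfl⟩ := Finset.mem_image.1 he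
        exact (this d hd).1
      · intros; positivity
    · intro d hd e he hde
      rw [← (this d hd).2.1, ← (this e he).2.1]
      simp only at hde
      rw [hde]
  rw [h1]
  linarith

theorem sieveDenom_one_le_prod (S : Finset ℕ) (hS : ∀ p ∈ S, p.Prime) (z : ℕ) :
    sieveDenom 1 z ≤ (∏ p ∈ S, (1 + 1 / ((p : ℝ) - 1))) * sieveDenom (∏ p ∈ S, p) z := by
  induction S using Finset.induction_on with
  | empty => simp
  | insert p S hp ih =>
    rw [Finset.prod_insert hp, Finset.prod_insert hp]
    refine (ih fun r hr => hS r (Finset.mem_insert_of_mem hr)).trans ?_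
    rw [mul_comm (1 + _), mul_assoc]
    apply mul_le_mul_of_nonneg_left
      (sieveDenom_le_prime_mul (hS p (Finset.mem_insert_self _ _)))
    apply Finset.prod_nonneg
    intro r hr
    have : (1 : ℝ) < r := by exact_mod_cast (hS r (Finset.mem_insert_of_mem hr)).one_lt
    have : 0 ≤ 1 / ((r : ℝ) - 1) := one_div_nonneg.2 (by linarith)
    linarith

theorem prod_primeFactors_one_add {q : ℕ} (hq : 0 < q) :
    ∏ p ∈ q.primeFactors, (1 + 1 / ((p : ℝ) - 1)) = q / q.totient := by
  have h := Nat.totient_mul_prod_primeFactors q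
  have h1 : (q.totient : ℝ) * ∏ p ∈ q.primeFactors, (p : ℝ)
      = q * ∏ p ∈ q.primeFactors, ((p : ℝ) - 1) := by
    have h2 : ((q.totient * ∏ p ∈ q.primeFactors, p : ℕ) : ℝ)
      = ((q * ∏ p ∈ q.primeFactors, (p - 1) : ℕ) : ℝ) := by rw [h]
    rw [Nat.cast_mul, Nat.cast_mul, Nat.cast_prod, Nat.cast_prod] at h2
    rw [h2]
    congr 1
    apply Finset.prod_congr rfl
    intro p hp
    rw [Nat.cast_sub (Nat.prime_of_mem_primeFactors hp).pos, Nat.cast_one]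
  have hphi : (0 : ℝ) < q.totient := by exact_mod_cast Nat.totient_pos.2 hq
  have hpos : ∀ p ∈ q.primeFactors, (0 : ℝ) < (p : ℝ) - 1 := by
    intro p hp
    have : (1 : ℝ) < p := by exact_mod_cast (Nat.prime_of_mem_primeFactors hp).one_lt
    linarith
  have h3 : ∏ p ∈ q.primeFactors, (1 + 1 / ((p : ℝ) - 1))
      = (∏ p ∈ q.primeFactors, (p : ℝ)) / ∏ p ∈ q.primeFactors, ((p : ℝ) - 1) := by
    rw [← Finset.prod_div_distrib]
    apply Finset.prod_congr rfl
    intro p hp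
    have := hpos p hp
    field_simp
    ring
  rw [h3, div_eq_div_iff (Finset.prod_pos hpos).ne' hphi.ne', mul_comm, h1]

theorem sieveDenom_prod_primeFactors {q : ℕ} (hq : 0 < q) (z : ℕ) :
    sieveDenom (∏ p ∈ q.primeFactors, p) z = sieveDenom q z := by
  unfold sieveDenom
  congr 1
  ext d
  rw [mem_sieveSet, mem_sieveSet]
  have : Nat.Coprime d (∏ p ∈ q.primeFactors, p) ↔ Nat.Coprime d q := by
    rw [Nat.coprime_prod_right_iff]
    constructor
    · intro h
      apply Nat.Coprime.symm
      apply Nat.coprime_of_dvd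
      intro p hp hpq hpd
      have := h p (Nat.mem_primeFactors.2 ⟨hp, hpq, hq.ne'⟩)
      rw [Nat.coprime_comm, Nat.Prime.coprime_iff_not_dvd hp] at this
      exact this hpd
    · intro h p hp
      exact Nat.Coprime.coprime_dvd_right (Nat.dvd_of_mem_primeFactors hp) h
  rw [this]

theorem log_le_two_mul_sieveDenom_one (z : ℕ) : Real.log (z + 1) ≤ 2 * sieveDenom 1 z := by
  have h0 : Real.log (z + 1) ≤ ∑ n ∈ Finset.Icc 1 z, 1 / (n : ℝ) := by
    have := log_add_one_le_harmonic z
    rw [harmonic_eq_sum_Icc] at this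
    push_cast at this
    simpa using this
  have h1 : ∑ n ∈ Finset.Icc 1 z, 1 / (n : ℝ)
      ≤ ∑ x ∈ sieveSet 1 z ×ˢ Finset.Icc 1 z, 1 / (x.1 : ℝ) * (1 / (x.2 : ℝ) ^ 2) := by
    have hex : ∀ n ∈ Finset.Icc 1 z, ∃ x : ℕ × ℕ, x ∈ sieveSet 1 z ×ˢ Finset.Icc 1 z ∧
        x.2 ^ 2 * x.1 = n := by
      intro n hn
      rw [Finset.mem_Icc] at hn
      obtain ⟨a, b, ha, hb, hab, hs⟩ := Nat.sq_mul_squarefree_of_pos (show 0 < n by omega)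
      refine ⟨(a, b), ?_, hab⟩
      rw [Finset.mem_product, mem_sieveSet, Finset.mem_Icc]
      have h1 : a ≤ n := Nat.le_of_dvd (by omega) ⟨b ^ 2, by rw [← hab, mul_comm]⟩
      have h2 : b ≤ n := Nat.le_of_dvd (by omega) ⟨b * a, by rw [← hab]; ring⟩
      exact ⟨⟨⟨ha, by omega⟩, hs, Nat.coprime_one_right _⟩, hb, by simp only; omega⟩
    choose! φ hφ using hex
    have : ∀ n ∈ Finset.Icc 1 z, 1 / (n : ℝ) = 1 / ((φ n).1 : ℝ) * (1 / ((φ n).2 : ℝ) ^ 2) := by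
      intro n hn
      have := (hφ n hn).2
      rw [one_div_mul_one_div]
      nth_rw 1 [← this]
      push_cast
      rw [mul_comm]
    rw [Finset.sum_congr rfl this,
      ← Finset.sum_image (g := φ) (f := fun x => 1 / (x.1 : ℝ) * (1 / (x.2 : ℝ) ^ 2))]
    · apply Finset.sum_le_sum_of_subset_of_nonneg
      · intro x hx
        obtain ⟨n, hn, rfl⟩ := Finset.mem_image.1 hx
        exact (hφ n hn).1
      · intros; positivity
    · intro n hn m hm hnm
      rw [← (hφ n hn).2, ← (hφ m hm).2, hnm]
  have h2 : ∑ m ∈ Finset.Icc 1 z, 1 / (m : ℝ) ^ 2 ≤ 2 := by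
    have := sum_Ioo_inv_sq_le (α := ℝ) 0 (z + 1)
    have e : Finset.Ioo 0 (z + 1) = Finset.Icc 1 z := by ext; simp; omega
    rw [e] at this
    simpa using this
  have h3 : ∑ d ∈ sieveSet 1 z, 1 / (d : ℝ) ≤ sieveDenom 1 z := by
    apply Finset.sum_le_sum
    intro d hd
    have hd' := (mem_sieveSet.1 hd).1.1
    have : (0 : ℝ) < d.totient := by exact_mod_cast Nat.totient_pos.2 hd'
    apply one_div_le_one_div_of_le this
    exact_mod_cast Nat.totient_le d
  have h4 : 0 ≤ ∑ d ∈ sieveSet 1 z, 1 / (d : ℝ) := Finset.sum_nonneg fun _ _ => by positivity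
  rw [Finset.sum_product] at h1
  simp_rw [← Finset.mul_sum] at h1
  rw [← Finset.sum_mul] at h1
  nlinarith

theorem totient_mul_log_le_sieveDenom {q : ℕ} (hq : 0 < q) (z : ℕ) :
    (q.totient : ℝ) / q * Real.log (z + 1) ≤ 2 * sieveDenom q z := by
  have h1 := sieveDenom_one_le_prod q.primeFactors
    (fun p hp => Nat.prime_of_mem_primeFactors hp) z
  rw [prod_primeFactors_one_add hq, sieveDenom_prod_primeFactors hq] at h1
  have h2 := log_le_two_mul_sieveDenom_one z
  have hphi : (0 : ℝ) < q.totient := by exact_mod_cast Nat.totient_pos.2 hq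
  have hq' : (0 : ℝ) < q := by exact_mod_cast hq
  calc (q.totient : ℝ) / q * Real.log (z + 1) ≤ q.totient / q * (2 * (q / q.totient * sieveDenom q z)) := by
        gcongr; linarith
    _ = _ := by field_simp

/-- Selberg's sieve bound with the main term in explicit form. -/
theorem card_sifted_le (A B q a z : ℕ) (hAB : A ≤ B) (hq : 0 < q) (hz : 1 ≤ z) :
    (((Finset.Ioc A B).filter (fun n => n ≡ a [MOD q] ∧
      ∀ p, p.Prime → p ≤ z → Nat.Coprime p q → ¬ p ∣ n)).card : ℝ)
      ≤ 2 * ((B : ℝ) - A) / (q.totient * Real.log (z + 1)) + (z : ℝ) ^ 4 := by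
  refine (card_sifted_le_sieveDenom A B q a z hAB hq hz).trans ?_
  have hphi : (0 : ℝ) < q.totient := by exact_mod_cast Nat.totient_pos.2 hq
  have hq' : (0 : ℝ) < q := by exact_mod_cast hq
  have hl : 0 < Real.log (z + 1) := Real.log_pos (by
    have : (1 : ℝ) ≤ z := by exact_mod_cast hz
    linarith)
  have h := totient_mul_log_le_sieveDenom hq z
  have hG := sieveDenom_pos (q := q) hz
  have hAB' : (0 : ℝ) ≤ (B : ℝ) - A := by
    have : (A : ℝ) ≤ B := by exact_mod_cast hAB
    linarith
  gcongr ?_ + _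
  rw [div_le_div_iff₀ (by positivity) (by positivity)]
  rw [div_mul_eq_mul_div, div_le_iff₀ hq'] at h
  nlinarith

open ArithmeticFunction in
theorem sum_vonMangoldt_div_le : ∃ C : ℝ, 0 < C ∧ ∀ N : ℕ, 1 ≤ N →
    ∑ n ∈ Finset.Icc 1 N, vonMangoldt n / n ≤ Real.log N + C := by
  refine ⟨Real.log 4 + 4, by positivity, fun N hN => ?_⟩
  have hN' : (0 : ℝ) < N := by exact_mod_cast hN
  have h1 : ∑ n ∈ Finset.Icc 1 N, Real.log n
      = ∑ d ∈ Finset.Icc 1 N, vonMangoldt d * ((N / d : ℕ) : ℝ) := by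
    calc ∑ n ∈ Finset.Icc 1 N, Real.log n
        = ∑ n ∈ Finset.Icc 1 N, ∑ d ∈ Finset.Icc 1 N, if d ∣ n then vonMangoldt d else 0 := by
          apply Finset.sum_congr rfl
          intro n hn
          rw [Finset.mem_Icc] at hn
          rw [← vonMangoldt_sum, ← Finset.sum_filter]
          apply Finset.sum_congr _ (fun _ _ => rfl)
          ext d
          rw [Nat.mem_divisors, Finset.mem_filter, Finset.mem_Icc]
          constructor
          · rintro ⟨h, h0⟩
            exact ⟨⟨Nat.pos_of_dvd_of_pos h (by omega), (Nat.le_of_dvd (by omega) h).trans hn.2⟩, h⟩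
          · rintro ⟨-, h⟩
            exact ⟨h, by omega⟩
      _ = _ := by
          rw [Finset.sum_comm]
          apply Finset.sum_congr rfl
          intro d hd
          rw [← Finset.sum_filter, Finset.sum_const, nsmul_eq_mul, mul_comm]
          congr 2
          have := Nat.Ioc_filter_dvd_card_eq_div N d
          rw [← this]
          congr 1
  have h2 : ∑ n ∈ Finset.Icc 1 N, Real.log n ≤ N * Real.log N := by
    calc _ ≤ ∑ n ∈ Finset.Icc 1 N, Real.log N := by
          apply Finset.sum_le_sum
          intro n hn
          rw [Finset.mem_Icc] at hn
          apply Real.log_le_log (by exact_mod_cast hn.1) (by exact_mod_cast hn.2)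
      _ = _ := by simp
  have h3 : ∑ d ∈ Finset.Icc 1 N, vonMangoldt d * ((N : ℝ) / d - 1)
      ≤ ∑ d ∈ Finset.Icc 1 N, vonMangoldt d * ((N / d : ℕ) : ℝ) := by
    apply Finset.sum_le_sum
    intro d hd
    apply mul_le_mul_of_nonneg_left _ vonMangoldt_nonneg
    have : (N : ℝ) / d < (N / d : ℕ) + 1 := by
      rw [← Nat.floor_div_eq_div (K := ℝ)]
      exact Nat.lt_floor_add_one _
    linarith
  have h4 : ∑ d ∈ Finset.Icc 1 N, vonMangoldt d ≤ (Real.log 4 + 4) * N := by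
    have := Chebyshev.psi_le_const_mul_self (x := N) hN'.le
    rw [Chebyshev.psi, Nat.floor_natCast] at this
    exact this
  have h5 : ∑ d ∈ Finset.Icc 1 N, vonMangoldt d * ((N : ℝ) / d - 1)
      = N * ∑ d ∈ Finset.Icc 1 N, vonMangoldt d / d - ∑ d ∈ Finset.Icc 1 N, vonMangoldt d := by
    rw [Finset.mul_sum, ← Finset.sum_sub_distrib]
    apply Finset.sum_congr rfl
    intro d _
    ring
  have h6 : (N : ℝ) * ∑ d ∈ Finset.Icc 1 N, vonMangoldt d / d
      ≤ N * (Real.log N + (Real.log 4 + 4)) := by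
    linarith
  exact le_of_mul_le_mul_left h6 hN'

theorem sum_rpow_neg_le {σ : ℝ} (hσ : 1 < σ) (N : ℕ) :
    ∑ n ∈ Finset.Icc 1 N, (n : ℝ) ^ (-σ) ≤ 1 + 1 / (σ - 1) := by
  rcases Nat.eq_zero_or_pos N with rfl | hN
  · have : 0 ≤ 1 / (σ - 1) := one_div_nonneg.2 (by linarith)
    simp
    have : 0 ≤ (σ - 1)⁻¹ := by rw [inv_nonneg]; linarith
    linarith
  rw [← Finset.sum_Ioc_add_eq_sum_Icc hN]
  have h1 : ∑ n ∈ Finset.Ioc 1 N, (n : ℝ) ^ (-σ) ≤ ∫ u in (1 : ℝ)..N, u ^ (-σ) := by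
    have hanti : AntitoneOn (fun u : ℝ => u ^ (-σ)) (Set.Icc (1 : ℕ) (N : ℕ)) := by
      intro a ha b hb hab
      apply Real.rpow_le_rpow_of_nonpos _ hab (by linarith)
      have := ha.1
      push_cast at this
      linarith
    have := hanti.sum_le_integral_Ico hN
    rw [Nat.cast_one] at this
    refine le_trans (le_of_eq ?_) this
    rw [Finset.sum_Ico_add' (fun n : ℕ => (n : ℝ) ^ (-σ)) 1 N 1]
    apply Finset.sum_congr _ (fun _ _ => rfl)
    ext; simp; omega
  have h2 : ∫ u in (1 : ℝ)..N, u ^ (-σ) = (N ^ (-σ + 1) - 1) / (-σ + 1) := by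
    rw [integral_rpow]
    · simp
    · right
      refine ⟨by linarith, ?_⟩
      rw [Set.uIcc_of_le (by exact_mod_cast hN)]
      intro h
      have := h.1
      linarith
  have h3 : ((N : ℝ) ^ (-σ + 1) - 1) / (-σ + 1) ≤ 1 / (σ - 1) := by
    have : ((N : ℝ) ^ (-σ + 1) - 1) / (-σ + 1) = (1 - (N : ℝ) ^ (-σ + 1)) / (σ - 1) := by
      rw [div_eq_div_iff (by linarith) (by linarith)]; ring
    rw [this]
    have h5 : 0 ≤ (N : ℝ) ^ (-σ + 1) := by positivity
    have : 0 < σ - 1 := by linarith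
    gcongr
    linarith
  simp only [Nat.cast_one, Real.one_rpow]
  linarith

theorem prod_primesBelow_one_sub_rpow_inv_le {σ : ℝ} (hσ : 1 < σ) (N : ℕ) :
    ∏ p ∈ N.primesBelow, (1 - (p : ℝ) ^ (-σ))⁻¹ ≤ 1 + 1 / (σ - 1) := by
  let f : ℕ →* ℝ :=
    { toFun := fun n => (n : ℝ) ^ (-σ)
      map_one' := by simp
      map_mul' := fun m n => by
        push_cast
        exact Real.mul_rpow (Nat.cast_nonneg m) (Nat.cast_nonneg n) }
  have hs : Summable f := (Real.summable_nat_rpow (p := -σ)).2 (by linarith)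
  have h := EulerProduct.prod_primesBelow_geometric_eq_tsum_smoothNumbers hs N
  have h2 : ∏ p ∈ N.primesBelow, (1 - (p : ℝ) ^ (-σ))⁻¹ = ∑' m : N.smoothNumbers, f m := h
  rw [h2]
  have h3 : ∑' m : N.smoothNumbers, f m ≤ ∑' m : ℕ, f m :=
    Summable.tsum_subtype_le f _ (fun n => by
      change 0 ≤ (n : ℝ) ^ (-σ)
      positivity) hs
  refine h3.trans ?_
  apply Real.tsum_le_of_sum_range_le
  · intro n
    change 0 ≤ (n : ℝ) ^ (-σ)
    positivity
  · intro n
    refine le_trans (le_trans ?_ (sum_rpow_neg_le hσ n)) le_rfl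
    have : ∑ i ∈ Finset.range n, f i ≤ ∑ i ∈ insert 0 (Finset.Icc 1 n), f i := by
      apply Finset.sum_le_sum_of_subset_of_nonneg
      · intro i hi
        simp at hi ⊢
        omega
      · intro i _ _
        change 0 ≤ (i : ℝ) ^ (-σ)
        positivity
    rw [Finset.sum_insert (by simp)] at this
    have h0 : f 0 = 0 := by
      change ((0 : ℕ) : ℝ) ^ (-σ) = 0
      rw [Nat.cast_zero, Real.zero_rpow (by linarith)]
    rw [h0, zero_add] at this
    exact this

open ArithmeticFunction in
theorem sum_vonMangoldt_div_log_rpow_le {σ : ℝ} (hσ : 1 < σ) (N : ℕ) :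
    ∑ d ∈ Finset.Icc 1 N, vonMangoldt d / Real.log d * (d : ℝ) ^ (-σ)
      ≤ Real.log (1 + 1 / (σ - 1)) := by
  set F : ℕ → ℝ := fun d => vonMangoldt d / Real.log d * (d : ℝ) ^ (-σ) with hF
  have hF0 : ∀ d, 0 ≤ F d := fun d => by
    have := vonMangoldt_nonneg (n := d)
    have := Real.log_natCast_nonneg d
    positivity
  set K := ⌊Real.log (N : ℝ) / Real.log 2⌋₊ with hK
  have h1 : ∑ d ∈ Finset.Icc 1 N, F d = ∑ n ∈ Finset.Ioc 0 ⌊(N : ℝ)⌋₊ with IsPrimePow n, F n := by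
    rw [Nat.floor_natCast, Finset.sum_filter]
    apply Finset.sum_congr rfl
    intro d _
    split_ifs with h
    · rfl
    · simp [hF, vonMangoldt_eq_zero_iff.2 h]
  rw [h1, Chebyshev.sum_PrimePow_eq_sum_sum' F (Nat.cast_nonneg N) (N := K) le_rfl]
  have h2 : ∑ k ∈ Finset.Icc 1 K, ∑ p ∈ Finset.Ioc 0 ⌊(N : ℝ) ^ ((1 : ℝ) / k)⌋₊ with p.Prime, F (p ^ k)
      ≤ ∑ k ∈ Finset.Icc 1 K, ∑ p ∈ (N + 1).primesBelow, F (p ^ k) := by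
    apply Finset.sum_le_sum
    intro k hk
    apply Finset.sum_le_sum_of_subset_of_nonneg
    · intro p hp
      rw [Finset.mem_filter, Finset.mem_Ioc] at hp
      rw [Nat.mem_primesBelow]
      refine ⟨?_, hp.2⟩
      rw [Finset.mem_Icc] at hk
      have hN : 1 ≤ N := by
        by_contra h
        have h0 : N = 0 := by omega
        simp [h0] at hK
        omega
      have : ⌊(N : ℝ) ^ ((1 : ℝ) / k)⌋₊ ≤ N := by
        apply Nat.floor_le_of_le
        calc (N : ℝ) ^ ((1 : ℝ) / k) ≤ (N : ℝ) ^ (1 : ℝ) := by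
              apply Real.rpow_le_rpow_of_exponent_le (by exact_mod_cast hN)
              rw [div_le_one (by exact_mod_cast hk.1)]
              exact_mod_cast hk.1
          _ = N := Real.rpow_one _
      omega
    · intro p _ _
      exact hF0 _
  refine h2.trans ?_
  rw [Finset.sum_comm]
  have h3 : ∀ p ∈ (N + 1).primesBelow, ∑ k ∈ Finset.Icc 1 K, F (p ^ k)
      ≤ Real.log ((1 - (p : ℝ) ^ (-σ))⁻¹) := by
    intro p hp
    have hpp := (Nat.mem_primesBelow.1 hp).2
    have hp1 : (1 : ℝ) < p := by exact_mod_cast hpp.one_lt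
    have hx0 : 0 ≤ (p : ℝ) ^ (-σ) := by positivity
    have hx1 : (p : ℝ) ^ (-σ) < 1 := Real.rpow_lt_one_of_one_lt_of_neg hp1 (by linarith)
    have hlog : Real.log p ≠ 0 := (Real.log_pos hp1).ne'
    have hs := Real.hasSum_pow_div_log_of_abs_lt_one (x := (p : ℝ) ^ (-σ))
      (by rw [abs_of_nonneg hx0]; exact hx1)
    rw [Real.log_inv]
    have h4 : ∑ k ∈ Finset.Icc 1 K, F (p ^ k)
        = ∑ k ∈ Finset.range K, ((p : ℝ) ^ (-σ)) ^ (k + 1) / ((k : ℝ) + 1) := by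
      have e : Finset.Icc 1 K = Finset.Ico (0 + 1) (K + 1) := by ext; simp
      rw [e, ← Finset.sum_Ico_add' (fun k => F (p ^ k)) 0 K 1, Nat.Ico_zero_eq_range]
      apply Finset.sum_congr rfl
      intro k _
      simp only [hF]
      rw [vonMangoldt_apply_pow (by omega), vonMangoldt_apply_prime hpp, Nat.cast_pow, Real.log_pow,
        ← Real.rpow_natCast, ← Real.rpow_natCast, ← Real.rpow_mul (by linarith),
        ← Real.rpow_mul (by linarith)]
      push_cast
      rw [mul_comm (-σ)]
      field_simp
    rw [h4]
    apply sum_le_hasSum _ _ hs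
    intro k _
    positivity
  refine (Finset.sum_le_sum h3).trans ?_
  rw [← Real.log_prod]
  · apply Real.log_le_log _ (prod_primesBelow_one_sub_rpow_inv_le hσ (N + 1))
    apply Finset.prod_pos
    intro p hp
    have hp1 : (1 : ℝ) < p := by exact_mod_cast (Nat.mem_primesBelow.1 hp).2.one_lt
    have hx1 : (p : ℝ) ^ (-σ) < 1 := Real.rpow_lt_one_of_one_lt_of_neg hp1 (by linarith)
    rw [inv_pos]
    linarith
  · intro p hp
    have hp1 : (1 : ℝ) < p := by exact_mod_cast (Nat.mem_primesBelow.1 hp).2.one_lt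
    have hx1 : (p : ℝ) ^ (-σ) < 1 := Real.rpow_lt_one_of_one_lt_of_neg hp1 (by linarith)
    apply inv_ne_zero
    linarith

open ArithmeticFunction in
theorem sum_vonMangoldt_div_mul_log_le : ∃ C : ℝ, 0 < C ∧ ∀ N : ℕ, 2 ≤ N →
    ∑ d ∈ Finset.Icc 1 N, vonMangoldt d / Real.log d * (d : ℝ)⁻¹
      ≤ Real.log (Real.log N) + C := by
  obtain ⟨C, hC, h⟩ := sum_vonMangoldt_div_le
  refine ⟨1 + C / Real.log 2 + 2, by positivity, fun N hN => ?_⟩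
  have hN' : (2 : ℝ) ≤ N := by exact_mod_cast hN
  have hL2 : 0 < Real.log 2 := Real.log_pos (by norm_num)
  have hL : Real.log 2 ≤ Real.log N := Real.log_le_log (by norm_num) hN'
  have hL0 : 0 < Real.log N := by linarith
  set ε := 1 / Real.log N with hε
  have hε0 : 0 < ε := by positivity
  have h1 := sum_vonMangoldt_div_log_rpow_le (σ := 1 + ε) (by linarith) N
  have h2 : ∀ d ∈ Finset.Icc 1 N, vonMangoldt d / Real.log d * (d : ℝ)⁻¹
      ≤ vonMangoldt d / Real.log d * (d : ℝ) ^ (-(1 + ε)) + ε * (vonMangoldt d / d) := by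
    intro d hd
    rw [Finset.mem_Icc] at hd
    have hd0 : (0 : ℝ) < d := by exact_mod_cast hd.1
    rcases hd.1.eq_or_lt with h1 | h1
    · rw [← h1]; simp
    have hd1 : (1 : ℝ) < d := by exact_mod_cast h1
    have hld : 0 < Real.log d := Real.log_pos hd1
    have hv := vonMangoldt_nonneg (n := d)
    have e1 : (d : ℝ) ^ (-(1 + ε)) = (d : ℝ)⁻¹ * Real.exp (-(ε * Real.log d)) := by
      rw [neg_add, Real.rpow_add hd0, Real.rpow_neg_one, Real.rpow_def_of_pos hd0]
      ring_nf
    have e2 : 1 - ε * Real.log d ≤ Real.exp (-(ε * Real.log d)) := by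
      have := Real.add_one_le_exp (-(ε * Real.log d)); linarith
    rw [e1]
    calc vonMangoldt d / Real.log d * (d : ℝ)⁻¹
        = vonMangoldt d / Real.log d * ((d : ℝ)⁻¹ * (1 - ε * Real.log d)) + ε * (vonMangoldt d / d) := by
          field_simp; ring
      _ ≤ _ := by gcongr
  have h3 := Finset.sum_le_sum h2
  rw [Finset.sum_add_distrib, ← Finset.mul_sum] at h3
  have h4 := h N (by omega)
  have h5 : ε * ∑ d ∈ Finset.Icc 1 N, vonMangoldt d / d ≤ 1 + C / Real.log 2 := by
    calc _ ≤ ε * (Real.log N + C) := by gcongr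
      _ = 1 + C / Real.log N := by rw [hε]; field_simp
      _ ≤ _ := by gcongr
  have h6 : Real.log (1 + 1 / (1 + ε - 1)) ≤ Real.log (Real.log N) + 2 := by
    have : 1 + 1 / (1 + ε - 1) = 1 + Real.log N := by
      rw [hε]; field_simp; simp
    rw [this]
    have h7 : 1 + Real.log N ≤ Real.log N * Real.exp 2 := by
      have h8 : (0.69 : ℝ) < Real.log 2 := by have := Real.log_two_gt_d9; linarith
      have h9 : (3 : ℝ) ≤ Real.exp 2 := by have := Real.add_one_le_exp (2 : ℝ); linarith
      nlinarith
    calc _ ≤ Real.log (Real.log N * Real.exp 2) := Real.log_le_log (by linarith) h7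
      _ = _ := by rw [Real.log_mul hL0.ne' (Real.exp_pos _).ne', Real.log_exp]
  linarith

open ArithmeticFunction in
/-- The Brun–Titchmarsh inequality for short multiplicative intervals. -/
theorem sum_vonMangoldt_modEq_le : ∃ C : ℝ, 0 < C ∧ ∀ q a : ℕ, 1 ≤ q →
    ∀ T U : ℝ, 1 ≤ T → ((q : ℝ) * T) ^ 4 ≤ U →
    ∑ n ∈ (Finset.Ioc ⌊U⌋₊ ⌊U * Real.exp (1 / T)⌋₊).filter (fun n => n ≡ a [MOD q]), vonMangoldt n
      ≤ C * (U / (T * q.totient)) := by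
  obtain ⟨C0, hC0⟩ := Chebyshev.psi_sub_theta_le_mul_sqrt
  refine ⟨36 * 3 + 18 + 2 * |C0|, by positivity, fun q a hq T U hT hU => ?_⟩
  have hq1 : (1 : ℝ) ≤ q := by exact_mod_cast hq
  have hphi : (0 : ℝ) < q.totient := by exact_mod_cast Nat.totient_pos.2 hq
  have hphiq : (q.totient : ℝ) ≤ q := by exact_mod_cast Nat.totient_le q
  have hqT : 1 ≤ (q : ℝ) * T := one_le_mul_of_one_le_of_one_le hq1 hT
  have hU1 : 1 ≤ U := (one_le_pow₀ hqT).trans hU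
  have hU0 : 0 < U := by linarith
  set V := U * Real.exp (1 / T) with hV
  have hT' : 1 / T ≤ 1 := by rw [div_le_one (by linarith)]; exact hT
  have hT0 : 0 < 1 / T := by positivity
  have hexp : Real.exp (1 / T) - 1 ≤ 2 / T := by
    have := Real.abs_exp_sub_one_le (x := 1 / T) (by rw [abs_of_pos hT0]; exact hT')
    rw [abs_of_pos hT0] at this
    have h2 := le_abs_self (Real.exp (1 / T) - 1)
    calc _ ≤ 2 * (1 / T) := by linarith
      _ = _ := by ring
  have hexp1 : 1 ≤ Real.exp (1 / T) := Real.one_le_exp hT0.le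
  have hUV : U ≤ V := le_mul_of_one_le_right hU0.le hexp1
  have hV0 : 0 < V := by linarith
  have hV3 : V ≤ 3 * U := by
    have : 2 / T ≤ 2 := by rw [div_le_iff₀ (by linarith)]; linarith
    rw [hV]
    nlinarith
  set A := ⌊U⌋₊ with hA
  set B := ⌊V⌋₊ with hB
  have hAB : A ≤ B := Nat.floor_le_floor hUV
  have hUT : 1 ≤ U / T := by
    rw [one_le_div (by linarith)]
    calc T ≤ q * T := le_mul_of_one_le_left (by linarith) hq1
      _ ≤ (q * T) ^ 4 := le_self_pow₀ hqT (by norm_num)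
      _ ≤ U := hU
  have hBA : (B : ℝ) - A ≤ 3 * (U / T) := by
    have h1 : (B : ℝ) ≤ V := Nat.floor_le hV0.le
    have h2 : U < A + 1 := Nat.lt_floor_add_one U
    have h3 : V - U ≤ 2 * (U / T) := by
      calc V - U = U * (Real.exp (1 / T) - 1) := by rw [hV]; ring
        _ ≤ U * (2 / T) := by gcongr
        _ = _ := by ring
    linarith
  have hsqrt : √U ≤ U / (T * q.totient) := by
    have h1 : (q : ℝ) * T ≤ √U := by
      apply Real.le_sqrt_of_sq_le
      calc ((q : ℝ) * T) ^ 2 ≤ (q * T) ^ 4 := pow_le_pow_right₀ hqT (by norm_num)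
        _ ≤ U := hU
    rw [le_div_iff₀ (by positivity)]
    calc √U * (T * q.totient) ≤ √U * (q * T) := by rw [mul_comm T]; gcongr
      _ ≤ √U * √U := by gcongr
      _ = U := Real.mul_self_sqrt hU0.le
  set z := ⌊U ^ (1 / 16 : ℝ)⌋₊ with hz
  have hz1 : 1 ≤ z := by
    rw [hz, Nat.one_le_floor_iff]
    exact Real.one_le_rpow hU1 (by norm_num)
  have hzU : (z : ℝ) ≤ U ^ (1 / 16 : ℝ) := Nat.floor_le (by positivity)
  have hzU' : U ^ (1 / 16 : ℝ) < z + 1 := Nat.lt_floor_add_one _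
  have hzA : z ≤ A := by
    apply Nat.floor_le_floor
    calc U ^ (1 / 16 : ℝ) ≤ U ^ (1 : ℝ) := Real.rpow_le_rpow_of_exponent_le hU1 (by norm_num)
      _ = U := Real.rpow_one U
  have hlz : Real.log U ≤ 16 * Real.log (z + 1) := by
    have := Real.log_le_log (by positivity) hzU'.le
    rw [Real.log_rpow hU0] at this
    linarith
  have hlz2 : Real.log 2 ≤ Real.log (z + 1) := by
    apply Real.log_le_log (by norm_num)
    have : (1 : ℝ) ≤ z := by exact_mod_cast hz1
    linarith
  have hl2 : (0.69 : ℝ) < Real.log 2 := by have := Real.log_two_gt_d9; linarith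
  have hlV : Real.log V ≤ 18 * Real.log (z + 1) := by
    rw [hV, Real.log_mul hU0.ne' (Real.exp_pos _).ne', Real.log_exp]
    linarith
  set S := (Finset.Ioc A B).filter (fun n => n ≡ a [MOD q]) with hS
  have hsplit : ∑ n ∈ S, vonMangoldt n = ∑ n ∈ S.filter (fun n => n.Prime), vonMangoldt n
      + ∑ n ∈ S.filter (fun n => ¬ n.Prime), vonMangoldt n :=
    (Finset.sum_filter_add_sum_filter_not _ _ _).symm
  have h1 : ∑ n ∈ S.filter (fun n => ¬ n.Prime), vonMangoldt n ≤ 2 * |C0| * √U := by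
    calc _ ≤ ∑ n ∈ Finset.Ioc 0 ⌊V⌋₊ with ¬ n.Prime, vonMangoldt n := by
          apply Finset.sum_le_sum_of_subset_of_nonneg
          · intro n hn
            rw [Finset.mem_filter, hS, Finset.mem_filter, Finset.mem_Ioc] at hn
            rw [Finset.mem_filter, Finset.mem_Ioc]
            exact ⟨⟨by omega, hn.1.1.2⟩, hn.2⟩
          · intros; exact vonMangoldt_nonneg
      _ = Chebyshev.psi V - Chebyshev.theta V := (Chebyshev.psi_sub_theta_eq_sum_not_prime V).symm
      _ ≤ C0 * √V := hC0 V
      _ ≤ |C0| * (2 * √U) := by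
          gcongr
          · exact le_abs_self C0
          · rw [Real.sqrt_le_left (by positivity), mul_pow, Real.sq_sqrt hU0.le]
            linarith
      _ = _ := by ring
  have h2 : ∑ n ∈ S.filter (fun n => n.Prime), vonMangoldt n
      ≤ 18 * Real.log (z + 1) * (2 * ((B : ℝ) - A) / (q.totient * Real.log (z + 1)) + (z : ℝ) ^ 4) := by
    have hc := card_sifted_le A B q a z hAB hq hz1
    calc _ ≤ ∑ n ∈ S.filter (fun n => n.Prime), 18 * Real.log (z + 1) := by
          apply Finset.sum_le_sum
          intro n hn
          rw [Finset.mem_filter, hS, Finset.mem_filter, Finset.mem_Ioc] at hn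
          refine vonMangoldt_le_log.trans (le_trans ?_ hlV)
          apply Real.log_le_log
          · exact_mod_cast hn.2.pos
          · exact (Nat.cast_le.2 hn.1.1.2).trans (Nat.floor_le hV0.le)
      _ = 18 * Real.log (z + 1) * ((S.filter (fun n => n.Prime)).card : ℝ) := by
          rw [Finset.sum_const, nsmul_eq_mul, mul_comm]
      _ ≤ _ := by
          apply mul_le_mul_of_nonneg_left _ (by linarith)
          refine le_trans ?_ hc
          rw [Nat.cast_le]
          apply Finset.card_le_card
          intro n hn
          rw [Finset.mem_filter, hS, Finset.mem_filter, Finset.mem_Ioc] at hn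
          rw [Finset.mem_filter, Finset.mem_Ioc]
          refine ⟨hn.1.1, hn.1.2, fun p hp hpz _ hpn => ?_⟩
          have := (Nat.prime_dvd_prime_iff_eq hp hn.2).1 hpn
          omega
  have hlpos : 0 < Real.log (z + 1) := by linarith
  have h3 : Real.log (z + 1) * (z : ℝ) ^ 4 ≤ √U := by
    have h4 : Real.log (z + 1) ≤ z := by
      have := Real.log_le_sub_one_of_pos (x := (z : ℝ) + 1) (by positivity)
      linarith
    calc Real.log (z + 1) * (z : ℝ) ^ 4 ≤ (z : ℝ) ^ 5 := by
          rw [pow_succ' (z : ℝ) 4]; gcongr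
      _ ≤ (U ^ (1 / 16 : ℝ)) ^ 5 := by gcongr
      _ = U ^ (5 / 16 : ℝ) := by rw [← Real.rpow_natCast, ← Real.rpow_mul hU0.le]; norm_num
      _ ≤ U ^ (1 / 2 : ℝ) := Real.rpow_le_rpow_of_exponent_le hU1 (by norm_num)
      _ = _ := (Real.sqrt_eq_rpow U).symm
  have h5 : 18 * Real.log (z + 1) * (2 * ((B : ℝ) - A) / (q.totient * Real.log (z + 1)))
      ≤ 36 * 3 * (U / (T * q.totient)) := by
    calc _ = 36 * (((B : ℝ) - A) / q.totient) := by field_simp; ring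
      _ ≤ 36 * (3 * (U / T) / q.totient) := by gcongr
      _ = _ := by field_simp
  rw [hsplit]
  have h6 : 0 ≤ |C0| := abs_nonneg _
  nlinarith

/-- The coefficients of `(1 - X)^{-κ}`. -/
def binomCoeff (κ : ℝ) (j : ℕ) : ℝ := ∏ i ∈ Finset.range j, (κ + i) / (i + 1)

/-- The generalized divisor function `d_κ`. -/
def genDivisor (κ : ℝ) (n : ℕ) : ℝ := n.factorization.prod fun _ j => binomCoeff κ j

theorem binomCoeff_zero (κ : ℝ) : binomCoeff κ 0 = 1 := by simp [binomCoeff]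

theorem binomCoeff_succ (κ : ℝ) (j : ℕ) :
    binomCoeff κ (j + 1) = binomCoeff κ j * ((κ + j) / (j + 1)) := Finset.prod_range_succ _ _

theorem binomCoeff_nonneg {κ : ℝ} (hκ : 0 < κ) (j : ℕ) : 0 ≤ binomCoeff κ j :=
  Finset.prod_nonneg fun i _ => by positivity

theorem binomCoeff_succ_le {κ : ℝ} (hκ : 0 < κ) (j : ℕ) :
    binomCoeff κ (j + 1) ≤ max 1 κ * binomCoeff κ j := by
  rw [binomCoeff_succ, mul_comm]
  refine mul_le_mul_of_nonneg_right ?_ (binomCoeff_nonneg hκ j)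
  rw [div_le_iff₀ (by positivity)]
  nlinarith [le_max_left 1 κ, le_max_right 1 κ, (Nat.cast_nonneg j : (0 : ℝ) ≤ j)]

theorem sum_range_binomCoeff (κ : ℝ) (j : ℕ) :
    κ * ∑ i ∈ Finset.range j, binomCoeff κ i = j * binomCoeff κ j := by
  induction j with
  | zero => simp
  | succ j ih =>
    rw [Finset.sum_range_succ, mul_add, ih, binomCoeff_succ]
    push_cast
    field_simp
    ring

theorem genDivisor_nonneg {κ : ℝ} (hκ : 0 < κ) (n : ℕ) : 0 ≤ genDivisor κ n := by
  unfold genDivisor Finsupp.prod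
  exact Finset.prod_nonneg fun _ _ => binomCoeff_nonneg hκ _

theorem genDivisor_one (κ : ℝ) : genDivisor κ 1 = 1 := by simp [genDivisor]

theorem genDivisor_prime_pow (κ : ℝ) {p : ℕ} (hp : p.Prime) (k : ℕ) :
    genDivisor κ (p ^ k) = binomCoeff κ k := by
  rw [genDivisor, hp.factorization_pow]
  exact Finsupp.prod_single_index (binomCoeff_zero κ)

theorem genDivisor_mul (κ : ℝ) {m n : ℕ} (h : m.Coprime n) :
    genDivisor κ (m * n) = genDivisor κ m * genDivisor κ n := by
  unfold genDivisor
  rw [Nat.factorization_mul_of_coprime h, Finsupp.prod_add_index_of_disjoint]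
  exact h.disjoint_primeFactors

theorem genDivisor_mul_prime_le {κ : ℝ} (hκ : 0 < κ) {m p : ℕ} (hm : m ≠ 0) (hp : p.Prime) :
    genDivisor κ (m * p) ≤ max 1 κ * genDivisor κ m := by
  obtain ⟨v, w, hw, rfl⟩ := Nat.exists_eq_pow_mul_and_not_dvd hm p hp.ne_one
  have hc : ∀ k, (p ^ k).Coprime w := fun k =>
    Nat.Coprime.pow_left _ ((Nat.Prime.coprime_iff_not_dvd hp).2 hw)
  have : p ^ v * w * p = p ^ (v + 1) * w := by ring
  rw [this, genDivisor_mul κ (hc _), genDivisor_mul κ (hc _), genDivisor_prime_pow κ hp,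
    genDivisor_prime_pow κ hp, ← mul_assoc]
  exact mul_le_mul_of_nonneg_right (binomCoeff_succ_le hκ v) (genDivisor_nonneg hκ w)

theorem genDivisor_mul_le {κ : ℝ} (hκ : 0 < κ) {m : ℕ} (hm : m ≠ 0) (l : List ℕ)
    (hl : ∀ p ∈ l, p.Prime) :
    genDivisor κ (m * l.prod) ≤ max 1 κ ^ l.length * genDivisor κ m := by
  induction l generalizing m with
  | nil => simp
  | cons p l ih =>
    have hp : p.Prime := hl p (by simp)
    rw [List.prod_cons, ← mul_assoc, List.length_cons, pow_succ, mul_assoc (max 1 κ ^ _)]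
    refine (ih (mul_ne_zero hm hp.ne_zero) fun r hr => hl r (by simp [hr])).trans ?_
    gcongr
    exact genDivisor_mul_prime_le hκ hm hp

open ArithmeticFunction in
theorem genDivisor_mul_log (κ : ℝ) {n : ℕ} (hn : n ≠ 0) :
    genDivisor κ n * Real.log n = κ * ∑ d ∈ n.divisors, vonMangoldt d * genDivisor κ (n / d) := by
  revert hn
  refine Nat.recOnPrimeCoprime ?_ ?_ ?_ n
  · simp
  · intro p k hp _
    rw [Nat.sum_divisors_prime_pow hp, genDivisor_prime_pow κ hp, Finset.sum_range_succ',
      pow_zero, vonMangoldt_apply_one, zero_mul, add_zero]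
    have : ∀ i ∈ Finset.range k, vonMangoldt (p ^ (i + 1)) * genDivisor κ (p ^ k / p ^ (i + 1))
        = Real.log p * binomCoeff κ (k - 1 - i) := by
      intro i hi
      have hik := Finset.mem_range.1 hi
      rw [vonMangoldt_apply_pow (Nat.succ_ne_zero _), vonMangoldt_apply_prime hp,
        Nat.pow_div (by omega) hp.pos, genDivisor_prime_pow κ hp]
      congr 2
      omega
    rw [Finset.sum_congr rfl this, ← Finset.mul_sum, Finset.sum_range_reflect,
      mul_left_comm, sum_range_binomCoeff]
    push_cast
    rw [Real.log_pow]
    ring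
  · intro a b ha' hb' hab ha hb _
    have ha0 : a ≠ 0 := by omega
    have hb0 : b ≠ 0 := by omega
    specialize ha ha0
    specialize hb hb0
    have key : ∀ n : ℕ, ∀ G : ℕ → ℝ, ∑ d ∈ n.divisors, vonMangoldt d * G d
        = ∑ d ∈ n.divisors with IsPrimePow d, vonMangoldt d * G d := by
      intro n G
      rw [Finset.sum_filter]
      refine Finset.sum_congr rfl fun d _ => ?_
      split_ifs with h
      · rfl
      · rw [vonMangoldt_eq_zero_iff.2 h, zero_mul]
    rw [key, Nat.mul_divisors_filter_prime_pow hab, Finset.filter_union,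
      Finset.sum_union (Nat.disjoint_divisors_filter_isPrimePow hab)]
    have h1 : ∑ d ∈ a.divisors with IsPrimePow d, vonMangoldt d * genDivisor κ (a * b / d)
        = (∑ d ∈ a.divisors, vonMangoldt d * genDivisor κ (a / d)) * genDivisor κ b := by
      rw [key, Finset.sum_mul]
      refine Finset.sum_congr rfl fun d hd => ?_
      have hda := (Nat.mem_divisors.1 (Finset.mem_filter.1 hd).1).1
      rw [mul_comm a b, Nat.mul_div_assoc b hda, mul_comm b, genDivisor_mul κ
        (Nat.Coprime.coprime_dvd_left (Nat.div_dvd_of_dvd hda) hab), mul_assoc]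
    have h2 : ∑ d ∈ b.divisors with IsPrimePow d, vonMangoldt d * genDivisor κ (a * b / d)
        = (∑ d ∈ b.divisors, vonMangoldt d * genDivisor κ (b / d)) * genDivisor κ a := by
      rw [key, Finset.sum_mul]
      refine Finset.sum_congr rfl fun d hd => ?_
      have hda := (Nat.mem_divisors.1 (Finset.mem_filter.1 hd).1).1
      rw [Nat.mul_div_assoc a hda, mul_comm a, genDivisor_mul κ
        (Nat.Coprime.coprime_dvd_left (Nat.div_dvd_of_dvd hda) hab.symm), mul_assoc]
    rw [h1, h2, mul_add, ← mul_assoc, ← mul_assoc, ← ha, ← hb, genDivisor_mul κ hab,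
      Nat.cast_mul, Real.log_mul (by exact_mod_cast ha0) (by exact_mod_cast hb0)]
    ring

open ArithmeticFunction in
/-- A nonnegative function bounded through the recursion defining `d_κ` is at most `d_κ`. -/
theorem le_genDivisor {κ : ℝ} (hκ : 0 < κ) {h : ℕ → ℝ} (h1 : h 1 ≤ 1)
    (hrec : ∀ n : ℕ, 1 ≤ n → h n * Real.log n ≤
      κ * ∑ d ∈ n.divisors, vonMangoldt d * h (n / d)) {n : ℕ} (hn : 1 ≤ n) :
    h n ≤ genDivisor κ n := by
  induction n using Nat.strong_induction_on with
  | _ n ih =>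
    rcases hn.eq_or_lt with rfl | hn2
    · simpa [genDivisor_one] using h1
    have hlog : 0 < Real.log n := Real.log_pos (by exact_mod_cast hn2)
    refine le_of_mul_le_mul_right ?_ hlog
    rw [genDivisor_mul_log κ (by omega)]
    refine (hrec n hn).trans (mul_le_mul_of_nonneg_left ?_ hκ.le)
    refine Finset.sum_le_sum fun d hd => ?_
    have hd' := Nat.mem_divisors.1 hd
    rcases eq_or_ne d 1 with rfl | hd1
    · simp
    have hd0 : d ≠ 0 := fun h => by simp [h] at hd'
    refine mul_le_mul_of_nonneg_left (ih _ (Nat.div_lt_self (by omega) (by omega)) ?_)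
      vonMangoldt_nonneg
    exact Nat.div_pos (Nat.le_of_dvd (by omega) hd'.1) (by omega)

open ArithmeticFunction in
theorem genDivisor_le_rpow {κ : ℝ} (hκ : 0 < κ) {ε : ℝ} (hε : 0 < ε) :
    ∃ C : ℝ, 0 < C ∧ ∀ n : ℕ, 1 ≤ n → genDivisor κ n ≤ C * (n : ℝ) ^ ε := by
  obtain ⟨D, hD⟩ : ∃ D : ℕ, 1 ≤ D ∧ κ * (D : ℝ) ^ (-ε) ≤ 1 / 2 := by
    have h1 := (tendsto_rpow_neg_atTop hε).comp (tendsto_natCast_atTop_atTop (R := ℝ))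
    have h2 := (h1.const_mul κ)
    rw [mul_zero] at h2
    obtain ⟨D, hD⟩ := ((h2.eventually (ge_mem_nhds (by norm_num : (0 : ℝ) < 1 / 2))).and
      (Filter.eventually_ge_atTop 1)).exists
    exact ⟨D, hD.2, hD.1⟩
  set Ψ := ∑ d ∈ Finset.Icc 1 D, vonMangoldt d with hΨ
  have hΨ0 : 0 ≤ Ψ := Finset.sum_nonneg fun _ _ => vonMangoldt_nonneg
  set N := ⌈Real.exp (2 * κ * Ψ)⌉₊ with hN
  set C := 1 + ∑ n ∈ Finset.Icc 1 N, genDivisor κ n with hC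
  have hs0 : 0 ≤ ∑ n ∈ Finset.Icc 1 N, genDivisor κ n :=
    Finset.sum_nonneg fun _ _ => genDivisor_nonneg hκ _
  have hC0 : 0 < C := by positivity
  refine ⟨C, hC0, fun n hn => ?_⟩
  induction n using Nat.strong_induction_on with
  | _ n ih =>
    have hn1 : (1 : ℝ) ≤ n := by exact_mod_cast hn
    rcases le_or_gt n N with hnN | hnN
    · have : genDivisor κ n ≤ C := by
        rw [hC]
        have := Finset.single_le_sum (f := fun n => genDivisor κ n)
          (fun i _ => genDivisor_nonneg hκ i) (Finset.mem_Icc.2 ⟨hn, hnN⟩)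
        linarith
      refine this.trans (le_mul_of_one_le_right hC0.le (Real.one_le_rpow hn1 hε.le))
    have hn2 : 1 < n := by
      have : 1 ≤ N := Nat.one_le_ceil_iff.2 (Real.exp_pos _)
      omega
    have hlog : 0 < Real.log n := Real.log_pos (by exact_mod_cast hn2)
    have hlog2 : 2 * κ * Ψ ≤ Real.log n := by
      rw [Real.le_log_iff_exp_le (by linarith)]
      exact (Nat.le_ceil _).trans (by exact_mod_cast hnN.le)
    refine le_of_mul_le_mul_right ?_ hlog
    rw [genDivisor_mul_log κ (by omega)]
    have hterm : ∀ d ∈ n.divisors, vonMangoldt d * genDivisor κ (n / d) ≤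
        C * (n : ℝ) ^ ε * ((if d ∈ Finset.Icc 1 D then vonMangoldt d else 0) +
          (D : ℝ) ^ (-ε) * vonMangoldt d) := by
      intro d hd
      have hd' := Nat.mem_divisors.1 hd
      rcases eq_or_ne d 1 with rfl | hd1
      · simp
      have hd0 : d ≠ 0 := fun h => by simp [h] at hd'
      have hih := ih _ (Nat.div_lt_self (by omega) (by omega : 1 < d))
        (Nat.div_pos (Nat.le_of_dvd (by omega) hd'.1) (by omega))
      have hΛ : 0 ≤ vonMangoldt d := vonMangoldt_nonneg
      have hdpos : (0 : ℝ) < d := by positivity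
      rw [Nat.cast_div hd'.1 (by positivity), Real.div_rpow (by linarith) (by positivity),
        div_eq_mul_inv, ← Real.rpow_neg hdpos.le] at hih
      have hd1' : (1 : ℝ) ≤ d := by exact_mod_cast Nat.one_le_iff_ne_zero.2 hd0
      calc _ ≤ vonMangoldt d * (C * ((n : ℝ) ^ ε * (d : ℝ) ^ (-ε))) :=
            mul_le_mul_of_nonneg_left hih hΛ
        _ = C * (n : ℝ) ^ ε * ((d : ℝ) ^ (-ε) * vonMangoldt d) := by ring
        _ ≤ _ := by
          refine mul_le_mul_of_nonneg_left ?_ (by positivity)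
          split_ifs with hdD
          · have : (d : ℝ) ^ (-ε) ≤ 1 := Real.rpow_le_one_of_one_le_of_nonpos hd1' (by linarith)
            have := mul_le_of_le_one_left hΛ this
            have : 0 ≤ (D : ℝ) ^ (-ε) * vonMangoldt d := by positivity
            linarith
          · rw [zero_add]
            have hDd : D ≤ d := by
              rw [Finset.mem_Icc] at hdD
              omega
            refine mul_le_mul_of_nonneg_right ?_ hΛ
            exact Real.rpow_le_rpow_of_nonpos (by exact_mod_cast hD.1)
              (by exact_mod_cast hDd) (by linarith)
    have hsum := Finset.sum_le_sum hterm
    rw [← Finset.mul_sum, Finset.sum_add_distrib, ← Finset.mul_sum, vonMangoldt_sum] at hsum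
    have hle : ∑ d ∈ n.divisors, (if d ∈ Finset.Icc 1 D then vonMangoldt d else 0) ≤ Ψ := by
      rw [← Finset.sum_filter]
      exact Finset.sum_le_sum_of_subset_of_nonneg (fun d hd => (Finset.mem_filter.1 hd).2)
        fun _ _ _ => vonMangoldt_nonneg
    have hX : 0 ≤ C * (n : ℝ) ^ ε := by positivity
    have : κ * (∑ d ∈ n.divisors, (if d ∈ Finset.Icc 1 D then vonMangoldt d else 0)
        + (D : ℝ) ^ (-ε) * Real.log n) ≤ Real.log n := by
      have h1 := mul_le_mul_of_nonneg_left hle hκ.le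
      have h2 := mul_le_mul_of_nonneg_right hD.2 hlog.le
      nlinarith
    calc _ ≤ κ * (C * (n : ℝ) ^ ε * _) := mul_le_mul_of_nonneg_left hsum hκ.le
      _ = C * (n : ℝ) ^ ε * (κ * _) := by ring
      _ ≤ _ := mul_le_mul_of_nonneg_left this hX

/-- Rankin-type bound for a nonnegative function subject to a von Mangoldt type recursion. -/
theorem sum_le_exp_sum_div_log {h w : ℕ → ℝ} (hh : ∀ n, 0 ≤ h n) (hw : ∀ n, 0 ≤ w n)
    (h1 : h 1 ≤ 1) (hw1 : w 1 = 0)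
    (hrec : ∀ n : ℕ, 1 ≤ n → h n * Real.log n ≤ ∑ d ∈ n.divisors, w d * h (n / d)) (N : ℕ) :
    ∑ n ∈ Finset.Icc 1 N, h n ≤ Real.exp (∑ d ∈ Finset.Icc 1 N, w d / Real.log d) := by
  set Φ : ℝ → ℝ := fun u => ∑ n ∈ Finset.Icc 1 N, h n * Real.exp (-u * Real.log n) with hΦ
  set E : ℝ → ℝ := fun u => ∑ d ∈ Finset.Icc 1 N, w d / Real.log d * Real.exp (-u * Real.log d)
    with hE
  set P : ℝ → ℝ := fun u => ∑ d ∈ Finset.Icc 1 N, w d * Real.exp (-u * Real.log d) with hP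
  have hexp : ∀ (n : ℕ) (u : ℝ), HasDerivAt (fun u : ℝ => Real.exp (-u * Real.log n))
      (Real.exp (-u * Real.log n) * (-Real.log n)) u := by
    intro n u
    have := ((hasDerivAt_id u).neg.mul_const (Real.log n)).exp
    simpa using this
  have hΦd : ∀ u, HasDerivAt Φ
      (∑ n ∈ Finset.Icc 1 N, h n * (Real.exp (-u * Real.log n) * (-Real.log n))) u := by
    intro u
    exact HasDerivAt.fun_sum fun n _ => (hexp n u).const_mul (h n)
  have hEd : ∀ u, HasDerivAt E (-P u) u := by
    intro u
    have := HasDerivAt.fun_sum (u := Finset.Icc 1 N) (x := u)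
      fun n _ => (hexp n u).const_mul (w n / Real.log n)
    refine this.congr_deriv ?_
    rw [hP, ← Finset.sum_neg_distrib]
    refine Finset.sum_congr rfl fun d hd => ?_
    rcases (Finset.mem_Icc.1 hd).1.eq_or_lt with rfl | hd2
    · simp [hw1]
    have : Real.log d ≠ 0 := (Real.log_pos (by exact_mod_cast hd2)).ne'
    field_simp
  have hmain : ∀ u, ∑ n ∈ Finset.Icc 1 N, h n * Real.log n * Real.exp (-u * Real.log n)
      ≤ P u * Φ u := by
    intro u
    calc ∑ n ∈ Finset.Icc 1 N, h n * Real.log n * Real.exp (-u * Real.log n)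
        ≤ ∑ n ∈ Finset.Icc 1 N, ∑ p ∈ n.divisorsAntidiagonal,
          (w p.1 * Real.exp (-u * Real.log p.1)) * (h p.2 * Real.exp (-u * Real.log p.2)) := by
          refine Finset.sum_le_sum fun n hn => ?_
          have hn1 := (Finset.mem_Icc.1 hn).1
          refine (mul_le_mul_of_nonneg_right (hrec n hn1) (Real.exp_pos _).le).trans ?_
          rw [← Nat.sum_divisorsAntidiagonal (fun d e => w d * h e), Finset.sum_mul]
          refine Finset.sum_le_sum fun p hp => le_of_eq ?_
          obtain ⟨hp1, hp2⟩ := Nat.mem_divisorsAntidiagonal.1 hp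
          have ha : (p.1 : ℝ) ≠ 0 := by
            have : p.1 ≠ 0 := by rintro h; simp [h] at hp1; omega
            exact_mod_cast this
          have hb : (p.2 : ℝ) ≠ 0 := by
            have : p.2 ≠ 0 := by rintro h; simp [h] at hp1; omega
            exact_mod_cast this
          rw [← hp1, Nat.cast_mul, Real.log_mul ha hb, mul_add, Real.exp_add]
          ring
      _ = ∑ p ∈ (Finset.Icc 1 N).biUnion fun n => n.divisorsAntidiagonal,
          (w p.1 * Real.exp (-u * Real.log p.1)) * (h p.2 * Real.exp (-u * Real.log p.2)) := by
          rw [Finset.sum_biUnion]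
          intro a _ b _ hab
          refine Finset.disjoint_left.2 fun p hp hp' => hab ?_
          rw [← (Nat.mem_divisorsAntidiagonal.1 hp).1, (Nat.mem_divisorsAntidiagonal.1 hp').1]
      _ ≤ ∑ p ∈ Finset.Icc 1 N ×ˢ Finset.Icc 1 N,
          (w p.1 * Real.exp (-u * Real.log p.1)) * (h p.2 * Real.exp (-u * Real.log p.2)) := by
          refine Finset.sum_le_sum_of_subset_of_nonneg ?_ fun p _ _ => ?_
          · intro p hp
            obtain ⟨n, hn, hp⟩ := Finset.mem_biUnion.1 hp
            obtain ⟨hp1, hp2⟩ := Nat.mem_divisorsAntidiagonal.1 hp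
            have hn' := Finset.mem_Icc.1 hn
            have ha : p.1 ≠ 0 := by rintro h; simp [h] at hp1; omega
            have hb : p.2 ≠ 0 := by rintro h; simp [h] at hp1; omega
            have h1 := Nat.le_mul_of_pos_right p.1 (Nat.pos_of_ne_zero hb)
            have h2 := Nat.le_mul_of_pos_left p.2 (Nat.pos_of_ne_zero ha)
            simp only [Finset.mem_product, Finset.mem_Icc]
            omega
          · have := hw p.1
            have := hh p.2
            positivity
      _ = P u * Φ u := by rw [hP, hΦ, Finset.sum_mul_sum, Finset.sum_product]
  have hmono : Monotone fun u => Φ u * Real.exp (-E u) := by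
    have hd : ∀ u, HasDerivAt (fun u => Φ u * Real.exp (-E u)) _ u :=
      fun u => (hΦd u).mul (hEd u).fun_neg.exp
    refine monotone_of_deriv_nonneg (fun u => (hd u).differentiableAt) fun u => ?_
    rw [(hd u).deriv, neg_neg]
    have h1 : ∑ n ∈ Finset.Icc 1 N, h n * (Real.exp (-u * Real.log n) * (-Real.log n)) =
        -∑ n ∈ Finset.Icc 1 N, h n * Real.log n * Real.exp (-u * Real.log n) := by
      rw [← Finset.sum_neg_distrib]
      exact Finset.sum_congr rfl fun n _ => by ring
    rw [h1]
    have := mul_le_mul_of_nonneg_right (hmain u) (Real.exp_pos (-E u)).le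
    linarith
  have hlim : Filter.Tendsto (fun u => Φ u * Real.exp (-E u)) Filter.atTop
      (nhds ((∑ n ∈ Finset.Icc 1 N, if n = 1 then h n else 0) * Real.exp (-0))) := by
    have hterm : ∀ n : ℕ, 2 ≤ n → Filter.Tendsto (fun u : ℝ => Real.exp (-u * Real.log n))
        Filter.atTop (nhds 0) := by
      intro n hn
      refine Real.tendsto_exp_atBot.comp ?_
      have : 0 < Real.log n := Real.log_pos (by exact_mod_cast hn)
      exact (Filter.tendsto_neg_atTop_atBot).atBot_mul_const this
    refine Filter.Tendsto.mul ?_ ((Real.continuous_exp.tendsto _).comp (Filter.Tendsto.neg ?_))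
    · refine tendsto_finsetSum _ fun n hn => ?_
      rcases (Finset.mem_Icc.1 hn).1.eq_or_lt with rfl | hn2
      · simp
      · rw [if_neg (by omega)]
        simpa using (hterm n hn2).const_mul (h n)
    · rw [← Finset.sum_const_zero (s := Finset.Icc 1 N)]
      refine tendsto_finsetSum _ fun n hn => ?_
      rcases (Finset.mem_Icc.1 hn).1.eq_or_lt with rfl | hn2
      · simp
      · simpa using (hterm n hn2).const_mul (w n / Real.log n)
  have hle := hmono.ge_of_tendsto hlim 0
  have hone : ∑ n ∈ Finset.Icc 1 N, (if n = 1 then h n else 0) ≤ 1 := by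
    rw [Finset.sum_ite_eq' ]
    split_ifs <;> linarith
  have h0 : Φ 0 * Real.exp (-E 0) ≤ 1 := by
    simp only [neg_zero, Real.exp_zero, mul_one] at hle
    exact hle.trans hone
  have hΦ0 : Φ 0 = ∑ n ∈ Finset.Icc 1 N, h n := by simp [hΦ]
  have hE0 : E 0 = ∑ d ∈ Finset.Icc 1 N, w d / Real.log d := by simp [hE]
  rw [← hΦ0, ← hE0]
  rw [Real.exp_neg, ← div_eq_mul_inv, div_le_one (Real.exp_pos _)] at h0
  exact h0

open ArithmeticFunction in
/-- Rankin-type bound for `∑ h(n) t(n)` with `t` multiplicative under the recursion of `h`. -/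
theorem sum_mul_le_exp {κ : ℝ} (hκ : 0 < κ) {h t : ℕ → ℝ} (hh : ∀ n, 0 ≤ h n) (ht : ∀ n, 0 ≤ t n)
    (h1 : h 1 ≤ 1) (ht1 : t 1 = 1) (htm : ∀ m n : ℕ, t (m * n) = t m * t n)
    (hrec : ∀ n : ℕ, 1 ≤ n → h n * Real.log n ≤
      κ * ∑ d ∈ n.divisors, vonMangoldt d * h (n / d)) (N : ℕ) :
    ∑ n ∈ Finset.Icc 1 N, h n * t n ≤
      Real.exp (κ * ∑ d ∈ Finset.Icc 1 N, vonMangoldt d / Real.log d * t d) := by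
  have := sum_le_exp_sum_div_log (h := fun n => h n * t n) (w := fun d => κ * vonMangoldt d * t d)
    (fun n => mul_nonneg (hh n) (ht n))
    (fun n => mul_nonneg (mul_nonneg hκ.le vonMangoldt_nonneg) (ht n))
    (by simpa [ht1] using h1) (by simp) (fun n hn => ?_) N
  · refine this.trans (le_of_eq ?_)
    rw [Finset.mul_sum]
    congr 1
    exact Finset.sum_congr rfl fun d _ => by ring
  · have := mul_le_mul_of_nonneg_right (hrec n hn) (ht n)
    calc h n * t n * Real.log n = h n * Real.log n * t n := by ring
      _ ≤ _ := this
      _ = _ := by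
        rw [Finset.mul_sum, Finset.sum_mul]
        refine Finset.sum_congr rfl fun d hd => ?_
        have hd' := (Nat.mem_divisors.1 hd).1
        have : t n = t d * t (n / d) := by rw [← htm, Nat.mul_div_cancel' hd']
        rw [this]
        ring

theorem genDivisor_rec (κ : ℝ) (n : ℕ) (hn : 1 ≤ n) : genDivisor κ n * Real.log n ≤
    κ * ∑ d ∈ n.divisors, ArithmeticFunction.vonMangoldt d * genDivisor κ (n / d) :=
  (genDivisor_mul_log κ (by omega)).le

theorem sum_genDivisor_rpow_le {κ : ℝ} (hκ : 0 < κ) {σ : ℝ} (hσ : 1 < σ) (N : ℕ) :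
    ∑ n ∈ Finset.Icc 1 N, genDivisor κ n * (n : ℝ) ^ (-σ) ≤ (1 + 1 / (σ - 1)) ^ κ := by
  have h := sum_mul_le_exp hκ (h := genDivisor κ) (t := fun n : ℕ => (n : ℝ) ^ (-σ))
    (genDivisor_nonneg hκ) (fun n => by positivity) (genDivisor_one κ).le (by simp)
    (fun m n => by push_cast; exact Real.mul_rpow (by positivity) (by positivity))
    (genDivisor_rec κ) N
  refine h.trans ?_
  have hpos : 0 < 1 + 1 / (σ - 1) := by
    have : 0 < σ - 1 := by linarith
    positivity
  rw [Real.rpow_def_of_pos hpos, mul_comm κ]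
  gcongr
  exact sum_vonMangoldt_div_log_rpow_le hσ N

theorem sum_genDivisor_div_le {κ : ℝ} (hκ : 0 < κ) : ∃ C : ℝ, 0 < C ∧ ∀ N : ℕ, 2 ≤ N →
    ∑ n ∈ Finset.Icc 1 N, genDivisor κ n / n ≤ C * Real.log N ^ κ := by
  obtain ⟨C, hC, hC'⟩ := sum_vonMangoldt_div_mul_log_le
  refine ⟨Real.exp (κ * C), by positivity, fun N hN => ?_⟩
  have h := sum_mul_le_exp hκ (h := genDivisor κ) (t := fun n : ℕ => (n : ℝ)⁻¹)
    (genDivisor_nonneg hκ) (fun n => by positivity) (genDivisor_one κ).le (by simp)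
    (fun m n => by push_cast; exact mul_inv _ _) (genDivisor_rec κ) N
  simp only [div_eq_mul_inv] at *
  refine h.trans ?_
  have hpos : 0 < Real.log N := Real.log_pos (by exact_mod_cast hN)
  rw [Real.rpow_def_of_pos hpos, ← Real.exp_add]
  gcongr
  nlinarith [hC' N hN]

theorem sum_primePow_not_prime_le (N : ℕ) :
    ∑ d ∈ (Finset.Icc 1 N).filter (fun d => IsPrimePow d ∧ ¬ d.Prime), (d : ℝ) ^ (-(3 / 4) : ℝ)
      ≤ 6 := by
  set T := (Finset.Icc 1 N) ×ˢ (Finset.range 2) with hT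
  set F : ℕ × ℕ → ℕ := fun p => p.1 ^ 2 * p.1.minFac ^ p.2 with hF
  have hsub : (Finset.Icc 1 N).filter (fun d => IsPrimePow d ∧ ¬ d.Prime) ⊆ T.image F := by
    intro d hd
    obtain ⟨hd1, ⟨p, k, hp, hk, rfl⟩, hnp⟩ := Finset.mem_filter.1 hd
    have hp' : p.Prime := hp.nat_prime
    have hk2 : 2 ≤ k := by
      by_contra hlt
      have : k = 1 := by omega
      subst this
      exact hnp (by simpa using hp')
    have hk0 : k / 2 ≠ 0 := by omega
    refine Finset.mem_image.2 ⟨(p ^ (k / 2), k % 2), ?_, ?_⟩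
    · simp only [hT, Finset.mem_product, Finset.mem_Icc, Finset.mem_range]
      refine ⟨⟨Nat.one_le_pow _ _ hp'.pos, ?_⟩, Nat.mod_lt _ (by norm_num)⟩
      exact (Nat.pow_le_pow_right hp'.pos (by omega)).trans (Finset.mem_Icc.1 hd1).2
    · simp only [hF]
      rw [hp'.pow_minFac hk0, ← pow_mul, ← pow_add]
      congr 1
      omega
  have h1 : ∀ e : ℕ × ℕ, e ∈ T → ((F e : ℕ) : ℝ) ^ (-(3 / 4) : ℝ) ≤ (e.1 : ℝ) ^ (-(3 / 2) : ℝ) := by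
    intro e he
    have he1 := (Finset.mem_Icc.1 (Finset.mem_product.1 he).1).1
    have he1' : (1 : ℝ) ≤ e.1 := by exact_mod_cast he1
    have h2 : (e.1 : ℝ) ^ (-(3 / 2) : ℝ) = ((e.1 : ℝ) ^ 2) ^ (-(3 / 4) : ℝ) := by
      rw [← Real.rpow_natCast, ← Real.rpow_mul (by linarith)]
      norm_num
    rw [h2]
    refine Real.rpow_le_rpow_of_nonpos (by positivity) ?_ (by norm_num)
    have : e.1 ^ 2 ≤ F e := Nat.le_mul_of_pos_right _ (Nat.pow_pos (Nat.minFac_pos _))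
    exact_mod_cast this
  calc _ ≤ ∑ d ∈ T.image F, (d : ℝ) ^ (-(3 / 4) : ℝ) :=
        Finset.sum_le_sum_of_subset_of_nonneg hsub fun _ _ _ => by positivity
    _ ≤ ∑ e ∈ T, ((F e : ℕ) : ℝ) ^ (-(3 / 4) : ℝ) :=
        Finset.sum_image_le_of_nonneg fun _ _ => by positivity
    _ ≤ ∑ e ∈ T, (e.1 : ℝ) ^ (-(3 / 2) : ℝ) := Finset.sum_le_sum h1
    _ = 2 * ∑ e ∈ Finset.Icc 1 N, (e : ℝ) ^ (-(3 / 2) : ℝ) := by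
        rw [hT, Finset.sum_product]
        simp [Finset.mul_sum, Finset.sum_add_distrib, two_mul]
    _ ≤ 6 := by
        have := sum_rpow_neg_le (σ := 3 / 2) (by norm_num) N
        norm_num at this ⊢
        linarith

/-- The real number `W` bounds all prime factors of `n`. -/
def SmoothUpTo (W : ℝ) (n : ℕ) : Prop := ∀ p : ℕ, p.Prime → p ∣ n → (p : ℝ) ≤ W

theorem smoothUpTo_mul (W : ℝ) (m n : ℕ) :
    SmoothUpTo W (m * n) ↔ SmoothUpTo W m ∧ SmoothUpTo W n := by
  constructor
  · exact fun h => ⟨fun p hp hpm => h p hp (hpm.mul_right n), fun p hp hpn => h p hp (hpn.mul_left m)⟩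
  · rintro ⟨h1, h2⟩ p hp hpmn
    rcases hp.dvd_mul.1 hpmn with h | h
    exacts [h1 p hp h, h2 p hp h]

theorem smoothUpTo_one (W : ℝ) : SmoothUpTo W 1 := fun _ hp h =>
  absurd (Nat.dvd_one.1 h) hp.ne_one

open ArithmeticFunction in
/-- Rankin's bound over smooth numbers for functions with a von Mangoldt type recursion. -/
theorem sum_smooth_rpow_le {κ : ℝ} (hκ : 0 < κ) {h : ℕ → ℝ} (hh : ∀ n, 0 ≤ h n)
    (h1 : h 1 ≤ 1) (hrec : ∀ n : ℕ, 1 ≤ n → h n * Real.log n ≤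
      κ * ∑ d ∈ n.divisors, vonMangoldt d * h (n / d)) {W θ : ℝ} (hθ : θ ≤ 1 / 4)
    (N : ℕ) :
    ∑ m ∈ (Finset.Icc 1 N).filter (SmoothUpTo W), h m * (m : ℝ) ^ (θ - 1) ≤
      Real.exp (κ * (∑ d ∈ Finset.Icc 1 ⌊W⌋₊, vonMangoldt d / Real.log d * (d : ℝ) ^ (θ - 1) + 6)) := by
  set t : ℕ → ℝ := fun n => if SmoothUpTo W n then (n : ℝ) ^ (θ - 1) else 0 with ht
  have ht0 : ∀ n, 0 ≤ t n := fun n => by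
    simp only [ht]; split_ifs <;> positivity
  have := sum_mul_le_exp hκ (h := h) (t := t) hh ht0 h1 (by simp [ht, smoothUpTo_one])
    (fun m n => by
      simp only [ht, smoothUpTo_mul]
      by_cases hm : SmoothUpTo W m <;> by_cases hn : SmoothUpTo W n <;> simp [hm, hn]
      exact Real.mul_rpow (by positivity) (by positivity)) hrec N
  rw [Finset.sum_filter]
  simp only [ht, mul_ite, mul_zero] at this
  refine this.trans ?_
  gcongr
  set S := (Finset.Icc 1 N).filter (fun d => IsPrimePow d ∧ ¬ d.Prime)
  have hlogs : ∀ d : ℕ, 0 ≤ vonMangoldt d / Real.log d := fun d =>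
    div_nonneg vonMangoldt_nonneg (Real.log_natCast_nonneg d)
  calc _ ≤ ∑ d ∈ Finset.Icc 1 N, ((if d ∈ Finset.Icc 1 ⌊W⌋₊ then
          vonMangoldt d / Real.log d * (d : ℝ) ^ (θ - 1) else 0) +
          (if IsPrimePow d ∧ ¬ d.Prime then (d : ℝ) ^ (-(3 / 4) : ℝ) else 0)) := by
        refine Finset.sum_le_sum fun d hd => ?_
        have hd1 := (Finset.mem_Icc.1 hd).1
        have hd1' : (1 : ℝ) ≤ d := by exact_mod_cast hd1
        have hr1 : 0 ≤ (if d ∈ Finset.Icc 1 ⌊W⌋₊ then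
          vonMangoldt d / Real.log d * (d : ℝ) ^ (θ - 1) else 0) := by
          split_ifs
          · have := hlogs d
            positivity
          · rfl
        have hr2 : 0 ≤ (if IsPrimePow d ∧ ¬ d.Prime then (d : ℝ) ^ (-(3 / 4) : ℝ) else 0) := by
          split_ifs <;> positivity
        by_cases hs : SmoothUpTo W d
        · rw [if_pos hs]
          by_cases hpp : IsPrimePow d
          · by_cases hp : d.Prime
            · have hdW : d ∈ Finset.Icc 1 ⌊W⌋₊ :=
                Finset.mem_Icc.2 ⟨hd1, Nat.le_floor (hs d hp dvd_rfl)⟩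
              rw [if_pos hdW] at hr1 ⊢
              linarith
            · rw [if_pos (show IsPrimePow d ∧ ¬ d.Prime from ⟨hpp, hp⟩)] at hr2 ⊢
              have hle : vonMangoldt d / Real.log d ≤ 1 :=
                div_le_one_of_le₀ vonMangoldt_le_log (Real.log_natCast_nonneg d)
              have := mul_le_mul hle (Real.rpow_le_rpow_of_exponent_le hd1'
                (by linarith : θ - 1 ≤ -(3 / 4))) (by positivity) zero_le_one
              linarith
          · rw [vonMangoldt_eq_zero_iff.2 hpp, zero_div, zero_mul] at *
            positivity
        · rw [if_neg hs]
          linarith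
    _ ≤ _ := by
        rw [Finset.sum_add_distrib]
        refine add_le_add ?_ ?_
        · rw [← Finset.sum_filter]
          refine Finset.sum_le_sum_of_subset_of_nonneg
            (fun d hd => (Finset.mem_filter.1 hd).2) fun d _ _ => ?_
          have := hlogs d
          positivity
        · rw [← Finset.sum_filter]
          exact sum_primePow_not_prime_le N

/-- Rankin's bound for `d_κ` over smooth numbers. -/
theorem sum_smooth_genDivisor_le {κ : ℝ} (hκ : 0 < κ) {A : ℝ} (hA : 0 < A) :
    ∃ C : ℝ, 0 < C ∧ ∀ W : ℝ, 2 ≤ W → 4 * A ≤ Real.log W → ∀ N : ℕ,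
    ∑ m ∈ (Finset.Icc 1 N).filter (SmoothUpTo W),
      genDivisor κ m / m * Real.exp (A * (Real.log m / Real.log W)) ≤ C * Real.log W ^ κ := by
  obtain ⟨C1, hC1, hC1'⟩ := sum_vonMangoldt_div_mul_log_le
  obtain ⟨C2, hC2, hC2'⟩ := sum_vonMangoldt_div_le
  refine ⟨Real.exp (κ * (C1 + Real.exp A * (A + C2 / 4) + 6)), by positivity, fun W hW hAW N => ?_⟩
  have hlogW : 0 < Real.log W := Real.log_pos (by linarith)
  set θ := A / Real.log W with hθ
  have hθ0 : 0 < θ := by positivity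
  have hθ4 : θ ≤ 1 / 4 := by rw [hθ, div_le_iff₀ hlogW]; linarith
  have hfl : 2 ≤ ⌊W⌋₊ := Nat.le_floor (by exact_mod_cast hW)
  have hflW : (⌊W⌋₊ : ℝ) ≤ W := Nat.floor_le (by linarith)
  have hfl0 : (0 : ℝ) < ⌊W⌋₊ := by positivity
  have := sum_smooth_rpow_le hκ (genDivisor_nonneg hκ) (genDivisor_one κ).le (genDivisor_rec κ)
    (W := W) (θ := θ) hθ4 N
  have hleft : ∀ m ∈ (Finset.Icc 1 N).filter (SmoothUpTo W),
      genDivisor κ m / m * Real.exp (A * (Real.log m / Real.log W)) =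
        genDivisor κ m * (m : ℝ) ^ (θ - 1) := by
    intro m hm
    have hm1 : (0 : ℝ) < m := by
      exact_mod_cast (Finset.mem_Icc.1 (Finset.mem_filter.1 hm).1).1
    rw [Real.rpow_sub_one hm1.ne', Real.rpow_def_of_pos hm1, hθ]
    have : A * (Real.log m / Real.log W) = Real.log m * (A / Real.log W) := by ring
    rw [this]
    ring
  rw [Finset.sum_congr rfl hleft]
  refine this.trans ?_
  rw [Real.rpow_def_of_pos hlogW, ← Real.exp_add]
  refine Real.exp_le_exp.2 ?_
  have hterm : ∀ d ∈ Finset.Icc 1 ⌊W⌋₊, ArithmeticFunction.vonMangoldt d / Real.log d * (d : ℝ) ^ (θ - 1) ≤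
      ArithmeticFunction.vonMangoldt d / Real.log d * (d : ℝ)⁻¹ + θ * Real.exp A *
        (ArithmeticFunction.vonMangoldt d / d) := by
    intro d hd
    obtain ⟨hd1, hd2⟩ := Finset.mem_Icc.1 hd
    rcases hd1.eq_or_lt with rfl | hd1
    · simp
    have hd0 : (0 : ℝ) < d := by positivity
    have hlogd : 0 < Real.log d := Real.log_pos (by exact_mod_cast hd1)
    have hle : Real.log d * θ ≤ A := by
      have : Real.log d ≤ Real.log W := Real.log_le_log hd0
        (le_trans (by exact_mod_cast hd2) hflW)
      rw [hθ, ← mul_div_assoc, div_le_iff₀ hlogW]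
      nlinarith
    have hexp : Real.exp (Real.log d * θ) ≤ 1 + Real.log d * θ * Real.exp A := by
      have h1 := Real.add_one_le_exp (-(Real.log d * θ))
      have h2 : Real.exp (Real.log d * θ) * Real.exp (-(Real.log d * θ)) = 1 := by
        rw [← Real.exp_add]; simp
      have h3 := Real.exp_le_exp.2 hle
      have h4 : 0 ≤ Real.log d * θ := by positivity
      nlinarith [Real.exp_pos (Real.log d * θ), mul_le_mul_of_nonneg_left h3 h4]
    rw [Real.rpow_sub_one hd0.ne', Real.rpow_def_of_pos hd0]
    have hΛ : 0 ≤ ArithmeticFunction.vonMangoldt d / Real.log d / d :=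
      div_nonneg (div_nonneg ArithmeticFunction.vonMangoldt_nonneg hlogd.le) hd0.le
    calc _ = ArithmeticFunction.vonMangoldt d / Real.log d / d * Real.exp (Real.log d * θ) := by ring
      _ ≤ ArithmeticFunction.vonMangoldt d / Real.log d / d *
          (1 + Real.log d * θ * Real.exp A) := mul_le_mul_of_nonneg_left hexp hΛ
      _ = _ := by field_simp
  have hsum := Finset.sum_le_sum hterm
  rw [Finset.sum_add_distrib, ← Finset.mul_sum] at hsum
  have hb1 := hC1' _ hfl
  have hb2 := hC2' _ (by omega : 1 ≤ ⌊W⌋₊)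
  have hl1 : Real.log ⌊W⌋₊ ≤ Real.log W := Real.log_le_log hfl0 hflW
  have hl2 : Real.log (Real.log ⌊W⌋₊) ≤ Real.log (Real.log W) :=
    Real.log_le_log (Real.log_pos (by exact_mod_cast hfl)) hl1
  have hb3 : θ * Real.exp A * ∑ i ∈ Finset.Icc 1 ⌊W⌋₊, ArithmeticFunction.vonMangoldt i / i ≤
      Real.exp A * (A + C2 / 4) := by
    calc _ ≤ θ * Real.exp A * (Real.log W + C2) :=
          mul_le_mul_of_nonneg_left (hb2.trans (by linarith)) (by positivity)
      _ = Real.exp A * (θ * Real.log W + C2 * θ) := by ring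
      _ ≤ _ := by
        have : θ * Real.log W = A := by rw [hθ]; field_simp
        rw [this]
        gcongr
        nlinarith
  nlinarith

theorem sum_le_sum_of_forall_exists {α β : Type*} {S : Finset α} {T : Finset β}
    {g : α → ℝ} {w : β → ℝ} (φ : β → α) (hw : ∀ t ∈ T, 0 ≤ w t)
    (h : ∀ n ∈ S, ∃ t ∈ T, φ t = n ∧ g n ≤ w t) : ∑ n ∈ S, g n ≤ ∑ t ∈ T, w t := by
  rcases S.eq_empty_or_nonempty with rfl | ⟨n₀, hn₀⟩
  · simpa using Finset.sum_nonneg hw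
  have : Nonempty β := ⟨(h n₀ hn₀).choose⟩
  choose! ψ hψT hψ hg using h
  have hinj : Set.InjOn ψ S := fun x hx y hy hxy => by rw [← hψ x hx, hxy, hψ y hy]
  calc ∑ n ∈ S, g n ≤ ∑ n ∈ S, w (ψ n) := Finset.sum_le_sum hg
    _ = ∑ t ∈ S.image ψ, w t := (Finset.sum_image hinj).symm
    _ ≤ ∑ t ∈ T, w t := Finset.sum_le_sum_of_subset_of_nonneg
        (fun t ht => by obtain ⟨n, hn, rfl⟩ := Finset.mem_image.1 ht; exact hψT n hn)
        fun t ht _ => hw t ht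

theorem exists_append_of_lt_prod (l : List ℕ) (hl : ∀ p ∈ l, p ≠ 0) {Z : ℝ} (hZ : 1 ≤ Z)
    (h : Z < (l.prod : ℕ)) : ∃ (l₁ : List ℕ) (p : ℕ) (l₂ : List ℕ), l = l₁ ++ p :: l₂ ∧ ((l₁.prod : ℕ) : ℝ) ≤ Z ∧
      Z < ((l₁.prod : ℕ) : ℝ) * p := by
  induction l generalizing Z with
  | nil => simp at h; linarith
  | cons p l ih =>
    have hp : (0 : ℝ) < p := by
      exact_mod_cast Nat.pos_of_ne_zero (hl p (by simp))
    rcases lt_or_ge Z p with hpZ | hpZ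
    · exact ⟨[], p, l, by simp, by simpa using hZ, by simpa using hpZ⟩
    · have h' : Z / p < (l.prod : ℕ) := by
        rw [div_lt_iff₀ hp]
        rw [List.prod_cons] at h
        push_cast at h ⊢
        linarith
      obtain ⟨l₁, r, l₂, e, h1, h2⟩ := ih (fun r hr => hl r (by simp [hr]))
        ((one_le_div hp).2 hpZ) h'
      refine ⟨p :: l₁, r, l₂, by simp [e], ?_, ?_⟩
      · rw [le_div_iff₀ hp] at h1
        rw [List.prod_cons, Nat.cast_mul]
        linarith
      · rw [div_lt_iff₀ hp] at h2
        rw [List.prod_cons, Nat.cast_mul]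
        linarith

/-- Splitting off the largest prefix, of size at most `Z`, of the sorted prime factorization. -/
theorem exists_prime_splitting {n : ℕ} (hn : n ≠ 0) {Z : ℝ} (hZ : 1 ≤ Z) (h : Z < n) :
    ∃ m P : ℕ, ∃ l : List ℕ, n = m * l.prod ∧ P ∣ l.prod ∧ P.Prime ∧ (∀ r ∈ l, r.Prime) ∧
      (m : ℝ) ≤ Z ∧ Z < m * P ∧ (∀ r : ℕ, r.Prime → r ∣ m → r ≤ P) ∧ ∀ r ∈ l, P ≤ r := by
  have hprod := Nat.prod_primeFactorsList hn
  obtain ⟨l₁, P, l₂, e, h1, h2⟩ := exists_append_of_lt_prod n.primeFactorsList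
    (fun p hp => (Nat.prime_of_mem_primeFactorsList hp).ne_zero) hZ (by rwa [hprod])
  have hsort : n.primeFactorsList.Pairwise (· ≤ ·) := (Nat.primeFactorsList_sorted n).pairwise
  have hprime : ∀ r ∈ n.primeFactorsList, r.Prime := fun r => Nat.prime_of_mem_primeFactorsList
  rw [e] at hsort hprime hprod
  obtain ⟨s1, s2, s3⟩ := List.pairwise_append.1 hsort
  refine ⟨l₁.prod, P, P :: l₂, by rw [← hprod, List.prod_append], by simp,
    hprime P (by simp), fun r hr => hprime r (List.mem_append_right _ hr), h1, h2, ?_, ?_⟩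
  · intro r hr hrm
    obtain ⟨s, hs, hrs⟩ := (Nat.Prime.prime hr).dvd_prod_iff.1 hrm
    rw [(Nat.prime_dvd_prime_iff_eq hr (hprime s (List.mem_append_left _ hs))).1 hrs]
    exact s3 s hs P (by simp)
  · intro r hr
    rcases List.mem_cons.1 hr with rfl | hr
    · exact le_rfl
    · exact (List.pairwise_cons.1 s2).1 r hr

theorem card_multiples_sifted_le (X q a z m : ℕ) (hq : 0 < q) (haq : a.Coprime q) (hz : 1 ≤ z)
    (hm : 0 < m) :
    (((Finset.Icc 1 X).filter (fun n => n ≡ a [MOD q] ∧ m ∣ n ∧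
      ∀ p, p.Prime → p ≤ z → ¬ p ∣ n / m)).card : ℝ)
      ≤ 2 * ((X : ℝ) / m) / (q.totient * Real.log (z + 1)) + (z : ℝ) ^ 4 := by
  have hφ : (0 : ℝ) < q.totient := by exact_mod_cast Nat.totient_pos.2 hq
  have hlog : 0 < Real.log ((z : ℝ) + 1) := Real.log_pos (by
    have : (1 : ℝ) ≤ z := by exact_mod_cast hz
    linarith)
  by_cases hmq : m.Coprime q
  · obtain ⟨a', ha'⟩ : ∃ a' : ℕ, m * a' ≡ a [MOD q] := by
      obtain ⟨i, -, hi⟩ := Nat.exists_mul_mod_eq_of_coprime a hmq hq.ne'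
      exact ⟨i, hi⟩
    refine le_trans ?_ ((card_sifted_le 0 (X / m) q a' z (Nat.zero_le _) hq hz).trans ?_)
    · norm_cast
      refine Finset.card_le_card_of_injOn (fun n => n / m) ?_ ?_
      · intro n hn
        obtain ⟨h1, h2, ⟨b, rfl⟩, h4⟩ := Finset.mem_filter.1 hn
        obtain ⟨h5, h6⟩ := Finset.mem_Icc.1 h1
        have hb : m * b / m = b := Nat.mul_div_cancel_left b hm
        simp only [hb] at h4 ⊢
        refine Finset.mem_coe.2 (Finset.mem_filter.2 ⟨Finset.mem_Ioc.2 ⟨?_, ?_⟩, ?_,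
          fun p hp hpz _ => h4 p hp hpz⟩)
        · rcases Nat.eq_zero_or_pos b with rfl | h
          · simp at h5
          · exact h
        · rw [Nat.le_div_iff_mul_le hm, mul_comm]
          exact h6
        · exact Nat.ModEq.cancel_left_of_coprime hmq.symm (h2.trans ha'.symm)
      · intro n hn n' hn' h
        obtain ⟨_, _, ⟨b, rfl⟩, _⟩ := Finset.mem_filter.1 hn
        obtain ⟨_, _, ⟨b', rfl⟩, _⟩ := Finset.mem_filter.1 hn'
        simp only [Nat.mul_div_cancel_left _ hm] at h
        rw [h]
    · have : ((X / m : ℕ) : ℝ) ≤ X / m := Nat.cast_div_le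
      simp only [Nat.cast_zero, sub_zero]
      gcongr
  · rw [Finset.card_eq_zero.2]
    · push_cast
      positivity
    · refine Finset.filter_eq_empty_iff.2 fun n _ ⟨h2, h3, _⟩ => hmq ?_
      have : n.Coprime q := by
        unfold Nat.Coprime
        rw [h2.gcd_eq]
        exact haq
      exact Nat.Coprime.coprime_dvd_left h3 this

theorem totient_le_exp {X q : ℕ} {ℓ : ℝ} (hX : (X : ℝ) = Real.exp (8 * ℓ)) (hqX : q ^ 4 ≤ X) :
    (q.totient : ℝ) ≤ Real.exp (2 * ℓ) := by
  have h1 : (q.totient : ℝ) ≤ q := by exact_mod_cast Nat.totient_le q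
  refine h1.trans (le_of_pow_le_pow_left₀ (n := 4) (by norm_num) (Real.exp_pos _).le ?_)
  rw [← Real.exp_nat_mul]
  have : (q : ℝ) ^ 4 ≤ X := by exact_mod_cast hqX
  refine this.trans (hX.le.trans (Real.exp_le_exp.2 ?_))
  push_cast
  linarith

theorem card_multiples_sifted_le' {X q a m : ℕ} (hq : 0 < q) (haq : a.Coprime q)
    (hm : 0 < m) {ℓ : ℝ} (hℓ : 1 ≤ ℓ) (hX : (X : ℝ) = Real.exp (8 * ℓ)) (hqX : q ^ 4 ≤ X)
    (hmZ : (m : ℝ) ≤ Real.exp ℓ) {r : ℕ} (hr : 1 ≤ r) :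
    (((Finset.Icc 1 X).filter (fun n => n ≡ a [MOD q] ∧ m ∣ n ∧
      ∀ p, p.Prime → p ≤ ⌊Real.exp (ℓ / (r + 1))⌋₊ → ¬ p ∣ n / m)).card : ℝ)
      ≤ 3 * (r + 1) * (X / (m * q.totient * ℓ)) := by
  set z := ⌊Real.exp (ℓ / (r + 1))⌋₊ with hz
  have hφ : (0 : ℝ) < q.totient := by exact_mod_cast Nat.totient_pos.2 hq
  have hm0 : (0 : ℝ) < m := by exact_mod_cast hm
  have hr1 : (1 : ℝ) ≤ r := by exact_mod_cast hr
  have hz1 : 1 ≤ z := Nat.le_floor (by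
    rw [Nat.cast_one]; exact Real.one_le_exp (by positivity))
  refine (card_multiples_sifted_le X q a z m hq haq hz1 hm).trans ?_
  have hlog : ℓ / (r + 1) ≤ Real.log ((z : ℝ) + 1) := by
    rw [Real.le_log_iff_exp_le (by positivity)]
    exact (Nat.lt_floor_add_one _).le
  have hφq := totient_le_exp hX hqX
  have hz4 : (z : ℝ) ^ 4 ≤ X / (m * q.totient * ℓ) := by
    have h1 : (z : ℝ) ^ 4 ≤ Real.exp (2 * ℓ) := by
      have : (z : ℝ) ≤ Real.exp (ℓ / (r + 1)) := Nat.floor_le (Real.exp_pos _).le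
      refine (pow_le_pow_left₀ (by positivity) this 4).trans ?_
      rw [← Real.exp_nat_mul, Real.exp_le_exp]
      have : ℓ / (r + 1) ≤ ℓ / 2 := div_le_div_of_nonneg_left (by linarith) (by norm_num)
        (by linarith)
      push_cast
      linarith
    refine h1.trans ?_
    rw [le_div_iff₀ (by positivity)]
    have h2 : ℓ ≤ Real.exp ℓ := by linarith [Real.add_one_le_exp ℓ]
    calc Real.exp (2 * ℓ) * (m * q.totient * ℓ)
        ≤ Real.exp (2 * ℓ) * (Real.exp ℓ * Real.exp (2 * ℓ) * Real.exp ℓ) := by gcongr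
      _ = Real.exp (6 * ℓ) := by simp only [← Real.exp_add]; ring_nf
      _ ≤ X := by rw [hX, Real.exp_le_exp]; linarith
  have hmain : 2 * ((X : ℝ) / m) / (q.totient * Real.log (z + 1)) ≤
      2 * (r + 1) * (X / (m * q.totient * ℓ)) := by
    calc _ ≤ 2 * ((X : ℝ) / m) / (q.totient * (ℓ / (r + 1))) := by gcongr
      _ = _ := by field_simp
  have : 0 ≤ X / (m * q.totient * ℓ) := by positivity
  nlinarith

theorem sum_Icc_geometric_le (R : ℕ) : ∑ r ∈ Finset.Icc 1 R, ((1 : ℝ) / 2) ^ r ≤ 1 := by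
  have : ∑ r ∈ Finset.Icc 1 R, ((1 : ℝ) / 2) ^ r = 1 - (1 / 2) ^ R := by
    induction R with
    | zero => simp
    | succ R ih => rw [Finset.sum_Icc_succ_top (by omega), ih]; ring
  rw [this]
  have : (0 : ℝ) ≤ (1 / 2) ^ R := by positivity
  linarith

/-- Shiu's theorem for `d_κ`, restricted to integers with a large critical prime. -/
theorem sum_genDivisor_large_prime_le {κ : ℝ} (hκ : 0 < κ) : ∃ C P₀ : ℝ, 0 < C ∧ 3 ≤ P₀ ∧
    ∀ q a X : ℕ, ∀ ℓ : ℝ, 0 < q → a.Coprime q → q ^ 4 ≤ X → (X : ℝ) = Real.exp (8 * ℓ) →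
    1 ≤ ℓ → P₀ ≤ Real.exp ℓ →
    ∑ n ∈ (Finset.Icc 1 X).filter (fun n => n ≡ a [MOD q] ∧ ∃ m P : ℕ, ∃ l : List ℕ,
      n = m * l.prod ∧ P ∣ l.prod ∧ P.Prime ∧ (∀ r ∈ l, r.Prime) ∧ (m : ℝ) ≤ Real.exp ℓ ∧
      Real.exp ℓ < m * P ∧ (∀ r : ℕ, r.Prime → r ∣ m → r ≤ P) ∧ (∀ r ∈ l, P ≤ r) ∧ P₀ ≤ P),
      genDivisor κ n ≤ C * (X / q.totient) * ℓ ^ (κ - 1) := by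
  set K := max 1 κ with hK
  have hK1 : 1 ≤ K := le_max_left _ _
  set A := 2 * Real.log (4 * K ^ 8) with hA
  have hKK : 1 ≤ K ^ 8 := one_le_pow₀ hK1
  have hA0 : 0 < A := by
    have : 0 < Real.log (4 * K ^ 8) := Real.log_pos (by linarith)
    positivity
  obtain ⟨C, hC, hC'⟩ := sum_smooth_genDivisor_le hκ hA0
  have hexpA : Real.exp (-(A / 2)) = (4 * K ^ 8)⁻¹ := by
    rw [hA, Real.exp_neg, mul_div_cancel_left₀ _ two_ne_zero, Real.exp_log (by positivity)]
  refine ⟨24 * K ^ 16 * C, Real.exp (4 * A + 2), by positivity, ?_, ?_⟩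
  · linarith [Real.add_one_le_exp (4 * A + 2)]
  intro q a X ℓ hq haq hqX hX hℓ hP₀
  have hφ : (0 : ℝ) < q.totient := by exact_mod_cast Nat.totient_pos.2 hq
  have hℓ0 : 0 < ℓ := by linarith
  rw [Real.exp_le_exp] at hP₀
  set R := ⌊ℓ / (4 * A + 2)⌋₊ with hR
  set Mr : ℕ → Finset ℕ := fun r => ((Finset.Icc 1 ⌊Real.exp ℓ⌋₊).filter
    (SmoothUpTo (Real.exp (ℓ / r)))).filter fun m => ((r : ℝ) - 1) * ℓ ≤ 2 * r * Real.log m with hMr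
  set Nr : ℕ → ℕ → Finset ℕ := fun r m => (Finset.Icc 1 X).filter (fun n => n ≡ a [MOD q] ∧ m ∣ n ∧
      ∀ p, p.Prime → p ≤ ⌊Real.exp (ℓ / (r + 1))⌋₊ → ¬ p ∣ n / m) with hNr
  set T := (Finset.Icc 1 R).sigma fun r => (Mr r).sigma fun m => Nr r m with hT
  have hstep : ∑ n ∈ (Finset.Icc 1 X).filter (fun n => n ≡ a [MOD q] ∧ ∃ m P : ℕ, ∃ l : List ℕ,
      n = m * l.prod ∧ P ∣ l.prod ∧ P.Prime ∧ (∀ r ∈ l, r.Prime) ∧ (m : ℝ) ≤ Real.exp ℓ ∧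
      Real.exp ℓ < m * P ∧ (∀ r : ℕ, r.Prime → r ∣ m → r ≤ P) ∧ (∀ r ∈ l, P ≤ r) ∧
      Real.exp (4 * A + 2) ≤ P),
      genDivisor κ n ≤ ∑ t ∈ T, K ^ (8 * (t.1 + 1)) * genDivisor κ t.2.1 := by
    refine sum_le_sum_of_forall_exists (fun t : (_ : ℕ) × ((_ : ℕ) × ℕ) => t.2.2)
      (fun t _ => mul_nonneg (by positivity) (genDivisor_nonneg hκ _)) ?_
    intro n hn
    obtain ⟨hnX, hna, m, P, l, rfl, hPl, hP, hl, hmZ, hZm, hmP, hPle, hPP⟩ := Finset.mem_filter.1 hn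
    obtain ⟨hn1, hnX⟩ := Finset.mem_Icc.1 hnX
    have hm0 : m ≠ 0 := by rintro rfl; simp at hn1
    have hm1 : (1 : ℝ) ≤ m := by exact_mod_cast Nat.one_le_iff_ne_zero.2 hm0
    have hlp : l.prod ≠ 0 := by rintro h; simp [h] at hn1
    have hPpos : (0 : ℝ) < P := by exact_mod_cast hP.pos
    set lp := Real.log P with hlp'
    have hlp1 : 4 * A + 2 ≤ lp := by rw [hlp', Real.le_log_iff_exp_le hPpos]; exact hPP
    have hlp0 : 0 < lp := by linarith
    have hPe : (P : ℝ) = Real.exp lp := (Real.exp_log hPpos).symm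
    set r := max 1 ⌊ℓ / lp⌋₊ with hr
    have hr1 : 1 ≤ r := le_max_left _ _
    have hrlt : ℓ < (r + 1) * lp := by
      rw [← div_lt_iff₀ hlp0]
      refine (Nat.lt_floor_add_one _).trans_le ?_
      have : ⌊ℓ / lp⌋₊ ≤ r := le_max_right _ _
      have : (⌊ℓ / lp⌋₊ : ℝ) ≤ r := by exact_mod_cast this
      linarith
    have hrR : r ≤ R := by
      refine max_le ?_ ?_
      · exact Nat.le_floor (by rw [Nat.cast_one, one_le_div (by linarith)]; exact hP₀)
      · exact Nat.floor_le_floor (div_le_div_of_nonneg_left hℓ0.le (by linarith) hlp1)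
    have hrcase : r = 1 ∨ (2 ≤ r ∧ r * lp ≤ ℓ) := by
      rcases le_or_gt ⌊ℓ / lp⌋₊ 1 with h | h
      · left; rw [hr]; exact max_eq_left h
      · right
        have : r = ⌊ℓ / lp⌋₊ := max_eq_right h.le
        refine ⟨by omega, ?_⟩
        rw [← le_div_iff₀ hlp0, this]
        exact Nat.floor_le (by positivity)
    have hlogm : ℓ - lp ≤ Real.log m := by
      rw [Real.le_log_iff_exp_le (by linarith), Real.exp_sub, div_le_iff₀ (Real.exp_pos _), ← hPe]
      exact hZm.le
    refine ⟨⟨r, m, m * l.prod⟩, ?_, rfl, ?_⟩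
    · simp only [hT, Finset.mem_sigma, hMr, hNr, Finset.mem_filter, Finset.mem_Icc]
      refine ⟨⟨hr1, hrR⟩, ⟨⟨⟨Nat.one_le_iff_ne_zero.2 hm0, Nat.le_floor hmZ⟩, ?_⟩, ?_⟩,
        ⟨hn1, hnX⟩, hna, dvd_mul_right _ _, ?_⟩
      · intro p hp hpm
        rcases hrcase with h | ⟨h, h'⟩
        · rw [h, Nat.cast_one, div_one]
          refine le_trans ?_ hmZ
          exact_mod_cast Nat.le_of_dvd (Nat.pos_of_ne_zero hm0) hpm
        · have : (p : ℝ) ≤ P := by exact_mod_cast hmP p hp hpm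
          refine this.trans ?_
          rw [hPe, Real.exp_le_exp, le_div_iff₀ (by positivity)]
          linarith
      · rcases hrcase with h | ⟨h, h'⟩
        · rw [h]
          have := Real.log_nonneg hm1
          norm_num
          linarith
        · have h2 : (2 : ℝ) ≤ r := by exact_mod_cast h
          nlinarith
      · intro p hp hpz hpb
        rw [Nat.mul_div_cancel_left _ (Nat.pos_of_ne_zero hm0)] at hpb
        obtain ⟨s, hs, hps⟩ := (Nat.Prime.prime hp).dvd_prod_iff.1 hpb
        rw [← (Nat.prime_dvd_prime_iff_eq hp (hl s hs)).1 hps] at hs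
        have h1 : (P : ℝ) ≤ p := by exact_mod_cast hPle p hs
        have h2 : (p : ℝ) ≤ Real.exp (ℓ / (r + 1)) :=
          (by exact_mod_cast hpz : (p : ℝ) ≤ _).trans (Nat.floor_le (Real.exp_pos _).le)
        have h3 := h1.trans h2
        rw [hPe, Real.exp_le_exp, le_div_iff₀ (by positivity)] at h3
        linarith
    · refine (genDivisor_mul_le hκ hm0 l hl).trans ?_
      refine mul_le_mul_of_nonneg_right (pow_le_pow_right₀ hK1 ?_) (genDivisor_nonneg hκ _)
      have h1 : P ^ l.length ≤ l.prod := List.pow_card_le_prod l P hPle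
      have h2 : l.prod ≤ X := (Nat.le_mul_of_pos_left _ (Nat.pos_of_ne_zero hm0)).trans hnX
      have h3 : (P : ℝ) ^ l.length ≤ X := by exact_mod_cast h1.trans h2
      rw [hPe, hX, ← Real.exp_nat_mul, Real.exp_le_exp] at h3
      have h4 : (l.length : ℝ) * lp < 8 * (r + 1) * lp := by linarith
      have h5 : (l.length : ℝ) < 8 * (r + 1) := lt_of_mul_lt_mul_right h4 hlp0.le
      exact_mod_cast h5.le
  refine hstep.trans ?_
  rw [hT, Finset.sum_sigma]
  have hr : ∀ r ∈ Finset.Icc 1 R, ∑ t ∈ (Mr r).sigma fun m => Nr r m,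
      K ^ (8 * (r + 1)) * genDivisor κ t.1 ≤
        24 * K ^ 16 * C * (X / q.totient) * ℓ ^ (κ - 1) * (1 / 2) ^ r := by
    intro r hr
    obtain ⟨hr1, hrR⟩ := Finset.mem_Icc.1 hr
    have hr1' : (1 : ℝ) ≤ r := by exact_mod_cast hr1
    have hlr : 4 * A + 2 ≤ ℓ / r := by
      have : (r : ℝ) ≤ ℓ / (4 * A + 2) := (Nat.le_floor_iff (by positivity)).1 hrR
      rw [le_div_iff₀ (by linarith)] at this
      rw [le_div_iff₀ (by positivity)]
      linarith
    rw [Finset.sum_sigma]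
    have hm : ∀ m ∈ Mr r, ∑ n ∈ Nr r m, K ^ (8 * (r + 1)) * genDivisor κ m ≤
        K ^ (8 * (r + 1)) * (3 * (r + 1) * (X / (q.totient * ℓ))) * (4 * K ^ 8)⁻¹ ^ (r - 1) *
          (genDivisor κ m / m * Real.exp (A * (Real.log m / Real.log (Real.exp (ℓ / r))))) := by
      intro m hm
      obtain ⟨hm1, hm2⟩ := Finset.mem_filter.1 hm
      obtain ⟨hm3, hm4⟩ := Finset.mem_filter.1 hm1
      obtain ⟨hm5, hm6⟩ := Finset.mem_Icc.1 hm3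
      have hmpos : (0 : ℝ) < m := by exact_mod_cast hm5
      rw [Finset.sum_const, nsmul_eq_mul]
      have hcard := card_multiples_sifted_le' hq haq hm5 hℓ hX hqX
        ((Nat.le_floor_iff (Real.exp_pos _).le).1 hm6) hr1
      have hg := genDivisor_nonneg hκ m
      have hexp : 1 ≤ (4 * K ^ 8)⁻¹ ^ (r - 1) *
          Real.exp (A * (Real.log m / Real.log (Real.exp (ℓ / r)))) := by
        rw [← hexpA, ← Real.exp_nat_mul, ← Real.exp_add, Real.log_exp]
        refine Real.one_le_exp ?_
        rw [Nat.cast_sub hr1, Nat.cast_one]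
        have : Real.log m / (ℓ / r) = 2 * r * Real.log m / (2 * ℓ) := by field_simp
        rw [this]
        have : ((r : ℝ) - 1) / 2 ≤ 2 * r * Real.log m / (2 * ℓ) := by
          rw [div_le_div_iff₀ (by norm_num) (by positivity)]
          linarith
        nlinarith
      calc _ ≤ 3 * (r + 1) * (X / (m * q.totient * ℓ)) * (K ^ (8 * (r + 1)) * genDivisor κ m) :=
            mul_le_mul_of_nonneg_right hcard (by positivity)
        _ ≤ 3 * (r + 1) * (X / (m * q.totient * ℓ)) * (K ^ (8 * (r + 1)) * genDivisor κ m) *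
            ((4 * K ^ 8)⁻¹ ^ (r - 1) *
          Real.exp (A * (Real.log m / Real.log (Real.exp (ℓ / r))))) :=
            le_mul_of_one_le_right (by positivity) hexp
        _ = _ := by field_simp
    refine (Finset.sum_le_sum hm).trans ?_
    rw [← Finset.mul_sum]
    have hsm : ∑ m ∈ Mr r, (genDivisor κ m / m *
        Real.exp (A * (Real.log m / Real.log (Real.exp (ℓ / r))))) ≤ C * ℓ ^ κ := by
      refine (Finset.sum_le_sum_of_subset_of_nonneg (Finset.filter_subset _ _) fun m _ _ =>
        mul_nonneg (div_nonneg (genDivisor_nonneg hκ _) (Nat.cast_nonneg _))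
          (Real.exp_pos _).le).trans ((hC' (Real.exp (ℓ / r)) ?_ ?_ _).trans ?_)
      · linarith [Real.add_one_le_exp (ℓ / r)]
      · rw [Real.log_exp]; linarith
      · rw [Real.log_exp]
        gcongr
        exact div_le_self hℓ0.le hr1'
    refine (mul_le_mul_of_nonneg_left hsm (by positivity)).trans (le_trans
      (b := 12 * K ^ 16 * C * (X / q.totient) * ℓ ^ (κ - 1) * ((r + 1) / 4 ^ r)) (le_of_eq ?_) ?_)
    · rw [Real.rpow_sub_one hℓ0.ne']
      obtain ⟨s, rfl⟩ : ∃ s, r = s + 1 := ⟨r - 1, by omega⟩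
      rw [Nat.add_sub_cancel, inv_pow, mul_pow, ← pow_mul]
      have : K ^ (8 * (s + 1 + 1)) = K ^ 16 * K ^ (8 * s) := by rw [← pow_add]; ring_nf
      rw [this, pow_succ]
      have : K ^ (8 * s) ≠ 0 := by positivity
      field_simp
      ring
    · have : ((r : ℝ) + 1) / 4 ^ r ≤ 2 * (1 / 2) ^ r := by
        have h1 : ((r : ℝ) + 1) ≤ 2 ^ r := by exact_mod_cast Nat.lt_two_pow_self
        have h2 : (4 : ℝ) ^ r = 2 ^ r * 2 ^ r := by rw [← mul_pow]; norm_num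
        rw [h2, div_le_iff₀ (by positivity), one_div, inv_pow]
        have h3 : (0 : ℝ) < 2 ^ r := by positivity
        field_simp
        linarith
      have h0 : 0 ≤ 12 * K ^ 16 * C * (X / q.totient) * ℓ ^ (κ - 1) := by positivity
      nlinarith [mul_le_mul_of_nonneg_left this h0]
  refine (Finset.sum_le_sum hr).trans ?_
  rw [← Finset.mul_sum]
  exact mul_le_of_le_one_right (by positivity) (sum_Icc_geometric_le R)

theorem sum_genDivisor_smooth_part_le {κ : ℝ} (hκ : 0 < κ) {P₀ : ℝ} (hP₀ : 3 ≤ P₀) :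
    ∃ C : ℝ, 0 < C ∧
    ∀ q a X : ℕ, ∀ ℓ : ℝ, 0 < q → a.Coprime q → q ^ 4 ≤ X → (X : ℝ) = Real.exp (8 * ℓ) →
    1 ≤ ℓ →
    ∑ n ∈ (Finset.Icc 1 X).filter (fun n => n ≡ a [MOD q] ∧ ∃ m : ℕ, 0 < m ∧ m ∣ n ∧
      SmoothUpTo P₀ m ∧ (m : ℝ) ≤ Real.exp ℓ ∧ Real.exp ℓ < m * P₀),
      genDivisor κ n ≤ C * (X / q.totient) * Real.exp (-(ℓ / 8)) := by
  obtain ⟨C1, hC1, hC1'⟩ := genDivisor_le_rpow hκ (ε := 1 / 64) (by norm_num)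
  set C3 := Real.exp (1 * (∑ d ∈ Finset.Icc 1 ⌊P₀⌋₊, ArithmeticFunction.vonMangoldt d / Real.log d *
    (d : ℝ) ^ ((1 / 4 : ℝ) - 1) + 6)) with hC3
  have hC3' : ∀ N, ∑ m ∈ (Finset.Icc 1 N).filter (SmoothUpTo P₀), (m : ℝ) ^ ((1 / 4 : ℝ) - 1) ≤ C3 := by
    intro N
    have := sum_smooth_rpow_le (κ := 1) one_pos (h := fun _ => 1) (fun _ => zero_le_one) le_rfl
      (fun n hn => by simp [ArithmeticFunction.vonMangoldt_sum]) (W := P₀) (θ := 1 / 4) le_rfl N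
    rw [hC3]
    refine le_trans (le_of_eq ?_) this
    exact Finset.sum_congr rfl fun m _ => (one_mul _).symm
  refine ⟨C1 * 4 * P₀ ^ (1 / 4 : ℝ) * C3, by positivity, ?_⟩
  intro q a X ℓ hq haq hqX hX hℓ
  have hφ : (0 : ℝ) < q.totient := by exact_mod_cast Nat.totient_pos.2 hq
  have hφq := totient_le_exp hX hqX
  set M : Finset ℕ := ((Finset.Icc 1 ⌊Real.exp ℓ⌋₊).filter (SmoothUpTo P₀)).filter
    (fun m : ℕ => Real.exp ℓ < m * P₀) with hM
  set Nr : ℕ → Finset ℕ := fun m => (Finset.Icc 1 X).filter (fun n => n ≡ a [MOD q] ∧ m ∣ n ∧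
      ∀ p, p.Prime → p ≤ 1 → ¬ p ∣ n / m) with hNr
  have hstep : ∑ n ∈ (Finset.Icc 1 X).filter (fun n => n ≡ a [MOD q] ∧ ∃ m : ℕ, 0 < m ∧ m ∣ n ∧
      SmoothUpTo P₀ m ∧ (m : ℝ) ≤ Real.exp ℓ ∧ Real.exp ℓ < m * P₀),
      genDivisor κ n ≤ ∑ t ∈ M.sigma Nr, C1 * Real.exp (ℓ / 8) := by
    refine sum_le_sum_of_forall_exists (fun t : (_ : ℕ) × ℕ => t.2) (fun t _ => by positivity) ?_
    intro n hn
    obtain ⟨hnX, hna, m, hm0, hmn, hms, hm1, hm2⟩ := Finset.mem_filter.1 hn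
    have hn1 := (Finset.mem_Icc.1 hnX).1
    refine ⟨⟨m, n⟩, ?_, rfl, ?_⟩
    · simp only [Finset.mem_sigma, hM, hNr, Finset.mem_filter, Finset.mem_Icc]
      exact ⟨⟨⟨⟨hm0, Nat.le_floor hm1⟩, hms⟩, hm2⟩, Finset.mem_Icc.1 hnX, hna, hmn,
        fun p hp hp1 => absurd hp.two_le (by omega)⟩
    · refine (hC1' n hn1).trans ?_
      gcongr
      have : (n : ℝ) ≤ X := by exact_mod_cast (Finset.mem_Icc.1 hnX).2
      calc (n : ℝ) ^ (1 / 64 : ℝ) ≤ (X : ℝ) ^ (1 / 64 : ℝ) := by gcongr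
        _ = Real.exp (ℓ / 8) := by rw [hX, ← Real.exp_mul]; ring_nf
  refine hstep.trans ?_
  rw [Finset.sum_sigma]
  have hm : ∀ m ∈ M, ∑ n ∈ Nr m, C1 * Real.exp (ℓ / 8) ≤
      C1 * Real.exp (ℓ / 8) * (4 * (X / q.totient)) * (P₀ ^ (1 / 4 : ℝ) * Real.exp (-(ℓ / 4))) *
        (m : ℝ) ^ ((1 / 4 : ℝ) - 1) := by
    intro m hm
    obtain ⟨hm1, hm2⟩ := Finset.mem_filter.1 hm
    obtain ⟨hm3, hm4⟩ := Finset.mem_filter.1 hm1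
    obtain ⟨hm5, hm6⟩ := Finset.mem_Icc.1 hm3
    have hmpos : (0 : ℝ) < m := by exact_mod_cast hm5
    have hmZ : (m : ℝ) ≤ Real.exp ℓ := (Nat.le_floor_iff (Real.exp_pos _).le).1 hm6
    rw [Finset.sum_const, nsmul_eq_mul]
    have hcard := card_multiples_sifted_le X q a 1 m hq haq le_rfl hm5
    have hcard2 : 2 * ((X : ℝ) / m) / (q.totient * Real.log ((1 : ℕ) + 1)) + ((1 : ℕ) : ℝ) ^ 4 ≤
        4 * (X / q.totient) / m := by
      have h1 : 1 ≤ X / q.totient / (m : ℝ) := by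
        rw [one_le_div hmpos, le_div_iff₀ hφ]
        calc (m : ℝ) * q.totient ≤ Real.exp ℓ * Real.exp (2 * ℓ) := by gcongr
          _ ≤ X := by rw [hX, ← Real.exp_add, Real.exp_le_exp]; linarith
      have h2 : 2 * ((X : ℝ) / m) / (q.totient * Real.log ((1 : ℕ) + 1)) =
          2 / Real.log 2 * (X / q.totient / (m : ℝ)) := by
        push_cast
        rw [show (1 : ℝ) + 1 = 2 by norm_num]
        field_simp
      have h3 : 2 / Real.log 2 ≤ 3 := by
        rw [div_le_iff₀ (Real.log_pos (by norm_num))]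
        linarith [Real.log_two_gt_d9]
      rw [h2]
      push_cast
      have h4 := mul_le_mul_of_nonneg_right h3 (by linarith : 0 ≤ X / q.totient / (m : ℝ))
      have h5 : 4 * ((X : ℝ) / q.totient) / m = 4 * (X / q.totient / (m : ℝ)) := by ring
      rw [h5]
      linarith
    have hone : 1 ≤ P₀ ^ (1 / 4 : ℝ) * Real.exp (-(ℓ / 4)) * (m : ℝ) ^ (1 / 4 : ℝ) := by
      have h1 : Real.exp (-(ℓ / 4)) = (Real.exp (-ℓ)) ^ (1 / 4 : ℝ) := by
        rw [← Real.exp_mul]; ring_nf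
      rw [h1, ← Real.mul_rpow (by positivity) (by positivity),
        ← Real.mul_rpow (by positivity) (by positivity)]
      refine Real.one_le_rpow ?_ (by norm_num)
      rw [Real.exp_neg]
      have := Real.exp_pos ℓ
      have : P₀ * (Real.exp ℓ)⁻¹ * m = m * P₀ / Real.exp ℓ := by ring
      rw [this, one_le_div (by positivity)]
      exact hm2.le
    rw [Real.rpow_sub_one hmpos.ne']
    calc _ ≤ 4 * (X / q.totient) / m * (C1 * Real.exp (ℓ / 8)) :=
          mul_le_mul_of_nonneg_right (hcard.trans hcard2) (by positivity)
      _ ≤ 4 * (X / q.totient) / m * (C1 * Real.exp (ℓ / 8)) *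
          (P₀ ^ (1 / 4 : ℝ) * Real.exp (-(ℓ / 4)) * (m : ℝ) ^ (1 / 4 : ℝ)) :=
          le_mul_of_one_le_right (by positivity) hone
      _ = _ := by ring
  refine (Finset.sum_le_sum hm).trans ?_
  rw [← Finset.mul_sum]
  have hs : ∑ m ∈ M, (m : ℝ) ^ ((1 / 4 : ℝ) - 1) ≤ C3 :=
    (Finset.sum_le_sum_of_subset_of_nonneg (Finset.filter_subset _ _)
      fun m _ _ => by positivity).trans (hC3' _)
  refine (mul_le_mul_of_nonneg_left hs (by positivity)).trans (le_of_eq ?_)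
  have : Real.exp (-(ℓ / 8)) = Real.exp (ℓ / 8) * Real.exp (-(ℓ / 4)) := by
    rw [← Real.exp_add]; ring_nf
  rw [this]
  ring

/-- Shiu's theorem for `d_κ` on the initial segment of an arithmetic progression. -/
theorem sum_genDivisor_modEq_le {κ : ℝ} (hκ : 0 < κ) : ∃ C X₀ : ℝ, 0 < C ∧ 0 < X₀ ∧
    ∀ q a X : ℕ, 0 < q → a.Coprime q → q ^ 4 ≤ X → X₀ ≤ X →
    ∑ n ∈ (Finset.Icc 1 X).filter (fun n => n ≡ a [MOD q]), genDivisor κ n ≤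
      C * (X / q.totient) * Real.log X ^ (κ - 1) := by
  obtain ⟨C1, P₀, hC1, hP₀, hC1'⟩ := sum_genDivisor_large_prime_le hκ
  obtain ⟨C2, hC2, hC2'⟩ := sum_genDivisor_smooth_part_le hκ hP₀
  obtain ⟨C3, hC3, hC3'⟩ := genDivisor_le_rpow hκ (ε := 1 / 64) (by norm_num)
  set D := C1 + (C2 + C3) * 8 with hD
  refine ⟨D / 8 ^ (κ - 1), Real.exp (8 * P₀), by positivity, by positivity, ?_⟩
  intro q a X hq haq hqX hX₀
  have hX0 : (0 : ℝ) < X := (Real.exp_pos _).trans_le hX₀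
  set ℓ := Real.log X / 8 with hℓ
  have hX : (X : ℝ) = Real.exp (8 * ℓ) := by
    rw [hℓ, mul_div_cancel₀ _ (by norm_num), Real.exp_log hX0]
  have hPℓ : P₀ ≤ ℓ := by
    rw [hX, Real.exp_le_exp] at hX₀
    linarith
  have hℓ1 : 1 ≤ ℓ := by linarith
  have hφ : (0 : ℝ) < q.totient := by exact_mod_cast Nat.totient_pos.2 hq
  have hφq := totient_le_exp hX hqX
  have h1 := hC1' q a X ℓ hq haq hqX hX hℓ1 (by linarith [Real.add_one_le_exp ℓ])
  have h2 := hC2' q a X ℓ hq haq hqX hX hℓ1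
  have h3 : ∑ n ∈ Finset.Icc 1 ⌊Real.exp ℓ⌋₊, genDivisor κ n ≤
      C3 * (X / q.totient) * Real.exp (-(ℓ / 8)) := by
    calc ∑ n ∈ Finset.Icc 1 ⌊Real.exp ℓ⌋₊, genDivisor κ n
        ≤ ∑ n ∈ Finset.Icc 1 ⌊Real.exp ℓ⌋₊, C3 * Real.exp (ℓ / 64) := by
          refine Finset.sum_le_sum fun n hn => ?_
          obtain ⟨hn1, hn2⟩ := Finset.mem_Icc.1 hn
          refine (hC3' n hn1).trans ?_
          gcongr
          have := (Nat.le_floor_iff (Real.exp_pos _).le).1 hn2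
          calc (n : ℝ) ^ (1 / 64 : ℝ) ≤ (Real.exp ℓ) ^ (1 / 64 : ℝ) := by gcongr
            _ = Real.exp (ℓ / 64) := by rw [← Real.exp_mul]; ring_nf
      _ = ⌊Real.exp ℓ⌋₊ * (C3 * Real.exp (ℓ / 64)) := by
          rw [Finset.sum_const, nsmul_eq_mul, Nat.card_Icc, Nat.add_sub_cancel]
      _ ≤ Real.exp ℓ * (C3 * Real.exp (ℓ / 64)) := by
          gcongr
          exact Nat.floor_le (Real.exp_pos _).le
      _ ≤ C3 * (Real.exp (8 * ℓ) / Real.exp (2 * ℓ)) * Real.exp (-(ℓ / 8)) := by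
          have e1 : Real.exp ℓ * (C3 * Real.exp (ℓ / 64)) = C3 * Real.exp (ℓ + ℓ / 64) := by
            rw [Real.exp_add]; ring
          have e2 : C3 * (Real.exp (8 * ℓ) / Real.exp (2 * ℓ)) * Real.exp (-(ℓ / 8)) =
              C3 * Real.exp (8 * ℓ - 2 * ℓ + -(ℓ / 8)) := by
            rw [Real.exp_add, Real.exp_sub]; ring
          rw [e1, e2]
          refine mul_le_mul_of_nonneg_left (Real.exp_le_exp.2 ?_) hC3.le
          linarith
      _ ≤ _ := by rw [hX]; gcongr
  have hsub : (Finset.Icc 1 X).filter (fun n => n ≡ a [MOD q]) ⊆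
      ((Finset.Icc 1 X).filter (fun n => n ≡ a [MOD q] ∧ ∃ m P : ℕ, ∃ l : List ℕ,
      n = m * l.prod ∧ P ∣ l.prod ∧ P.Prime ∧ (∀ r ∈ l, r.Prime) ∧ (m : ℝ) ≤ Real.exp ℓ ∧
      Real.exp ℓ < m * P ∧ (∀ r : ℕ, r.Prime → r ∣ m → r ≤ P) ∧ (∀ r ∈ l, P ≤ r) ∧ P₀ ≤ P)) ∪
      (((Finset.Icc 1 X).filter (fun n => n ≡ a [MOD q] ∧ ∃ m : ℕ, 0 < m ∧ m ∣ n ∧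
      SmoothUpTo P₀ m ∧ (m : ℝ) ≤ Real.exp ℓ ∧ Real.exp ℓ < m * P₀)) ∪
      Finset.Icc 1 ⌊Real.exp ℓ⌋₊) := by
    intro n hn
    obtain ⟨hn1, hna⟩ := Finset.mem_filter.1 hn
    have hn1' := (Finset.mem_Icc.1 hn1).1
    rw [Finset.mem_union, Finset.mem_union]
    rcases le_or_gt (n : ℝ) (Real.exp ℓ) with h | h
    · exact Or.inr (Or.inr (Finset.mem_Icc.2 ⟨hn1', Nat.le_floor h⟩))
    obtain ⟨m, P, l, e, hPl, hP, hl, hm1, hm2, hm3, hl2⟩ :=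
      exists_prime_splitting (by omega : n ≠ 0) (Real.one_le_exp (by linarith)) h
    rcases le_or_gt P₀ P with hPP | hPP
    · exact Or.inl (Finset.mem_filter.2 ⟨hn1, hna, m, P, l, e, hPl, hP, hl, hm1, hm2, hm3, hl2, hPP⟩)
    · refine Or.inr (Or.inl (Finset.mem_filter.2 ⟨hn1, hna, m, ?_, Dvd.intro _ e.symm, ?_, hm1, ?_⟩))
      · refine Nat.pos_of_ne_zero ?_
        rintro rfl
        simp at e
        omega
      · intro p hp hpm
        exact (by exact_mod_cast hm3 p hp hpm : (p : ℝ) ≤ P).trans hPP.le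
      · refine hm2.trans_le ?_
        gcongr
  have hg := genDivisor_nonneg hκ
  have htot := Finset.sum_le_sum_of_subset_of_nonneg hsub (fun n _ _ => hg n)
  have hu : ∀ s t : Finset ℕ, ∑ n ∈ s ∪ t, genDivisor κ n ≤
      ∑ n ∈ s, genDivisor κ n + ∑ n ∈ t, genDivisor κ n := by
    intro s t
    rw [← Finset.sum_union_inter]
    exact le_add_of_nonneg_right (Finset.sum_nonneg fun n _ => hg n)
  have htot2 := htot.trans ((hu _ _).trans (add_le_add h1 ((hu _ _).trans (add_le_add h2 h3))))
  have hdecay : Real.exp (-(ℓ / 8)) ≤ 8 * ℓ ^ (κ - 1) := by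
    have e1 : ℓ ^ (1 - κ) ≤ ℓ := by
      calc ℓ ^ (1 - κ) ≤ ℓ ^ (1 : ℝ) := Real.rpow_le_rpow_of_exponent_le hℓ1 (by linarith)
        _ = ℓ := Real.rpow_one _
    have e2 : ℓ ≤ 8 * Real.exp (ℓ / 8) := by linarith [Real.add_one_le_exp (ℓ / 8)]
    have e3 : ℓ ^ (κ - 1) * ℓ ^ (1 - κ) = 1 := by
      rw [← Real.rpow_add (by linarith)]; simp
    have e4 : Real.exp (-(ℓ / 8)) * Real.exp (ℓ / 8) = 1 := by rw [← Real.exp_add]; simp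
    have e5 : 0 < ℓ ^ (κ - 1) := by positivity
    have e6 := mul_le_mul_of_nonneg_left (e1.trans e2) e5.le
    refine le_of_mul_le_mul_right ?_ (Real.exp_pos (ℓ / 8))
    linarith
  have hL : ℓ ^ (κ - 1) = Real.log X ^ (κ - 1) / 8 ^ (κ - 1) := by
    rw [hℓ, Real.div_rpow (by linarith) (by norm_num)]
  have hpos : 0 ≤ X / (q.totient : ℝ) := by positivity
  have hdecay2 := mul_le_mul_of_nonneg_left hdecay (by positivity : 0 ≤ (C2 + C3) * (X / (q.totient : ℝ)))
  calc _ ≤ _ := htot2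
    _ ≤ D * (X / q.totient) * ℓ ^ (κ - 1) := by rw [hD]; nlinarith
    _ = _ := by rw [hL]; ring

theorem IsHalaszClass.norm_le_genDivisor {κ : ℝ} (hκ : 0 < κ) {f Λf : ℕ → ℂ}
    (h : IsHalaszClass κ f Λf) {n : ℕ} (hn : 1 ≤ n) : ‖f n‖ ≤ genDivisor κ n := by
  refine le_genDivisor hκ (h := fun n => ‖f n‖) (by simp [h.map_one]) ?_ hn
  intro n hn
  have e : ‖f n * (Real.log n : ℂ)‖ = ‖f n‖ * Real.log n := by
    rw [norm_mul, Complex.norm_real, Real.norm_of_nonneg (Real.log_natCast_nonneg n)]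
  rw [← e, h.conv n hn, Finset.mul_sum]
  refine (norm_sum_le _ _).trans (Finset.sum_le_sum fun d hd => ?_)
  rw [norm_mul, ← mul_assoc]
  exact mul_le_mul_of_nonneg_right (h.bound d (Nat.pos_of_mem_divisors hd)) (norm_nonneg _)

theorem IsHalaszClass.sum_rpow_le {κ : ℝ} (hκ : 0 < κ) {f Λf : ℕ → ℂ}
    (h : IsHalaszClass κ f Λf) {σ : ℝ} (hσ : 1 < σ) :
    Summable (fun n : ℕ => ‖f n‖ * (n : ℝ) ^ (-σ)) ∧
    ∑' n : ℕ, ‖f n‖ * (n : ℝ) ^ (-σ) ≤ (1 + 1 / (σ - 1)) ^ κ := by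
  have hs : Summable (fun n : ℕ => ‖f n‖ * (n : ℝ) ^ (-σ)) := by
    refine (h.abs_conv σ hσ).congr fun n => ?_
    rw [Real.rpow_neg (by positivity), div_eq_mul_inv]
  refine ⟨hs, ?_⟩
  refine Real.tsum_le_of_sum_range_le (fun n => by positivity) fun N => ?_
  calc ∑ n ∈ Finset.range N, ‖f n‖ * (n : ℝ) ^ (-σ)
      ≤ ∑ n ∈ Finset.Icc 0 N, ‖f n‖ * (n : ℝ) ^ (-σ) := by
        refine Finset.sum_le_sum_of_subset_of_nonneg (fun n hn => ?_) fun n _ _ => by positivity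
        simp at hn ⊢
        omega
    _ = ∑ n ∈ Finset.Icc 1 N, ‖f n‖ * (n : ℝ) ^ (-σ) := by
        rw [Finset.sum_subset (s₁ := Finset.Icc 1 N) (s₂ := Finset.Icc 0 N)]
        · intro n hn
          simp at hn ⊢
          omega
        · intro n hn hn'
          have : n = 0 := by
            simp at hn hn'
            omega
          subst this
          rw [Nat.cast_zero, Real.zero_rpow (by linarith), mul_zero]
    _ ≤ ∑ n ∈ Finset.Icc 1 N, genDivisor κ n * (n : ℝ) ^ (-σ) := by
        refine Finset.sum_le_sum fun n hn => ?_
        exact mul_le_mul_of_nonneg_right (h.norm_le_genDivisor hκ (Finset.mem_Icc.1 hn).1)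
          (by positivity)
    _ ≤ _ := sum_genDivisor_rpow_le hκ hσ N

theorem FserChi_term_norm_le {q : ℕ} (f : ℕ → ℂ) (χ : DirichletCharacter ℂ q) {s : ℂ}
    (hs : s.re ≠ 0) (n : ℕ) :
    ‖f n * χ (n : ZMod q) / (n : ℂ) ^ s‖ ≤ ‖f n‖ * (n : ℝ) ^ (-s.re) := by
  rw [norm_div, norm_mul]
  have hχ := χ.norm_le_one (n : ZMod q)
  have : ‖(n : ℂ) ^ s‖ = (n : ℝ) ^ s.re := by
    rcases Nat.eq_zero_or_pos n with rfl | hn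
    · have : s ≠ 0 := fun h => hs (by simp [h])
      simp [this, Real.zero_rpow hs]
    · exact Complex.norm_natCast_cpow_of_pos hn s
  rw [this, Real.rpow_neg (by positivity), ← div_eq_mul_inv]
  gcongr
  exact mul_le_of_le_one_right (norm_nonneg _) hχ

theorem FserChi_summable {κ : ℝ} (hκ : 0 < κ) {f Λf : ℕ → ℂ} (h : IsHalaszClass κ f Λf)
    {q : ℕ} (χ : DirichletCharacter ℂ q) {s : ℂ} (hs : 1 < s.re) :
    Summable (fun n : ℕ => f n * χ (n : ZMod q) / (n : ℂ) ^ s) :=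
  Summable.of_norm_bounded (h.sum_rpow_le hκ hs).1 fun n =>
    FserChi_term_norm_le f χ (by linarith) n

theorem norm_FserChi_le {κ : ℝ} (hκ : 0 < κ) {f Λf : ℕ → ℂ} (h : IsHalaszClass κ f Λf)
    {q : ℕ} (χ : DirichletCharacter ℂ q) {s : ℂ} (hs : 1 < s.re) :
    ‖FserChi f χ s‖ ≤ (1 + 1 / (s.re - 1)) ^ κ :=
  (tsum_of_norm_bounded (h.sum_rpow_le hκ hs).1.hasSum fun n =>
    FserChi_term_norm_le f χ (by linarith) n).trans (h.sum_rpow_le hκ hs).2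

theorem FserChi_differentiableOn {κ : ℝ} (hκ : 0 < κ) {f Λf : ℕ → ℂ} (h : IsHalaszClass κ f Λf)
    {q : ℕ} (χ : DirichletCharacter ℂ q) :
    DifferentiableOn ℂ (FserChi f χ) {s | 1 < s.re} := by
  have hterm : ∀ s : ℂ, 1 < s.re → ∀ n : ℕ,
      LSeries.term (fun n => f n * χ (n : ZMod q)) s n = f n * χ (n : ZMod q) / (n : ℂ) ^ s := by
    intro s hs n
    have : s ≠ 0 := fun h => by simp [h] at hs; linarith
    rw [LSeries.term_def]
    split_ifs with hn
    · simp [hn, this]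
    · rfl
  have ha : LSeries.abscissaOfAbsConv (fun n => f n * χ (n : ZMod q)) ≤ (1 : ℝ) := by
    refine LSeries.abscissaOfAbsConv_le_of_forall_lt_LSeriesSummable fun y hy => ?_
    have : 1 < (y : ℂ).re := by simpa using hy
    exact (FserChi_summable hκ h χ this).congr fun n => (hterm _ this n).symm
  refine ((LSeries_differentiableOn (fun n => f n * χ (n : ZMod q))).mono ?_).congr ?_
  · intro s hs
    exact ha.trans_lt (by exact_mod_cast hs)
  · intro s hs
    exact tsum_congr fun n => (hterm s hs n).symm

theorem one_half_le_norm_FserChi {κ : ℝ} (hκ : 0 < κ) {f Λf : ℕ → ℂ} (h : IsHalaszClass κ f Λf)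
    {q : ℕ} (χ : DirichletCharacter ℂ q) {σ : ℝ} (hσ : 1 < σ)
    (hσ2 : (1 + 1 / (σ - 1)) ^ κ ≤ 3 / 2) : 1 / 2 ≤ ‖FserChi f χ σ‖ := by
  have hs : 1 < (σ : ℂ).re := by simpa using hσ
  have hsum := FserChi_summable hκ h χ hs
  obtain ⟨hb, hb2⟩ := h.sum_rpow_le hκ hσ
  have e1 := hsum.tsum_eq_add_tsum_ite 1
  have e2 := hb.tsum_eq_add_tsum_ite 1
  have e3 : f 1 * χ ((1 : ℕ) : ZMod q) / ((1 : ℕ) : ℂ) ^ (σ : ℂ) = 1 := by simp [h.map_one]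
  have e4 : ‖f 1‖ * ((1 : ℕ) : ℝ) ^ (-σ) = 1 := by simp [h.map_one]
  rw [e3] at e1
  rw [e4] at e2
  have hsm : Summable (fun n : ℕ => if n = 1 then 0 else ‖f n‖ * (n : ℝ) ^ (-σ)) := by
    refine hb.of_nonneg_of_le (fun n => ?_) (fun n => ?_)
    · split_ifs <;> positivity
    · split_ifs
      · positivity
      · rfl
  have h3 : ‖∑' n : ℕ, if n = 1 then 0 else f n * χ (n : ZMod q) / (n : ℂ) ^ (σ : ℂ)‖ ≤
      ∑' n : ℕ, if n = 1 then 0 else ‖f n‖ * (n : ℝ) ^ (-σ) := by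
    refine tsum_of_norm_bounded hsm.hasSum fun n => ?_
    split_ifs
    · simp
    · simpa using FserChi_term_norm_le f χ (s := σ) (by simp; linarith) n
  have h4 : ‖FserChi f χ σ‖ ≥ 1 - ‖∑' n : ℕ, if n = 1 then 0 else f n * χ (n : ZMod q) / (n : ℂ) ^ (σ : ℂ)‖ := by
    have : FserChi f χ σ = 1 + ∑' n : ℕ, if n = 1 then 0 else f n * χ (n : ZMod q) / (n : ℂ) ^ (σ : ℂ) := e1
    rw [this]
    have := norm_sub_le (1 + ∑' n : ℕ, if n = 1 then 0 else f n * χ (n : ZMod q) / (n : ℂ) ^ (σ : ℂ))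
      (∑' n : ℕ, if n = 1 then 0 else f n * χ (n : ZMod q) / (n : ℂ) ^ (σ : ℂ))
    rw [add_sub_cancel_right, norm_one] at this
    linarith
  linarith

theorem phragmenLindelof_FserChi {κ : ℝ} (hκ : 0 < κ) {f Λf : ℕ → ℂ} (h : IsHalaszClass κ f Λf)
    {q : ℕ} (χ : DirichletCharacter ℂ q) (j : ℕ) {σ : ℝ} (hσ : 1 < σ) {B : ℝ}
    (hB : ∀ t : ℝ, ‖FserChi f χ (σ + t * I) / (σ + t * I) ^ j‖ ≤ B) {s : ℂ} (hs : σ ≤ s.re) :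
    ‖FserChi f χ s / s ^ j‖ ≤ B := by
  set G : ℂ → ℂ := fun z => FserChi f χ (σ + z) / (σ + z) ^ j with hG
  have hne : ∀ z : ℂ, 1 < z.re → z ≠ 0 := fun z hz h => by simp [h] at hz; linarith
  have hbd : ∀ z : ℂ, 0 ≤ z.re → ‖G z‖ ≤ (1 + 1 / (σ - 1)) ^ κ := by
    intro z hz
    have hre : 1 < (σ + z : ℂ).re := by simp; linarith
    rw [hG, norm_div, norm_pow]
    have h1 : 1 ≤ ‖(σ + z : ℂ)‖ := hre.le.trans (Complex.re_le_norm _)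
    have h2 := norm_FserChi_le hκ h χ hre
    refine (div_le_self (norm_nonneg _) (one_le_pow₀ h1)).trans (h2.trans ?_)
    have h3 : σ - 1 ≤ (σ + z : ℂ).re - 1 := by simp [hz]
    have h4 : 0 < σ - 1 := by linarith
    gcongr
  have hd : DifferentiableOn ℂ G {z | 1 - σ < z.re} := by
    refine DifferentiableOn.div ?_ (by fun_prop) ?_
    · refine (FserChi_differentiableOn hκ h χ).comp (by fun_prop) ?_
      intro z hz
      simp at hz ⊢
      linarith
    · intro z hz
      refine pow_ne_zero _ (hne _ ?_)
      simp at hz ⊢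
      linarith
  have hdc : DiffContOnCl ℂ G {z | 0 < z.re} := by
    refine DifferentiableOn.diffContOnCl (hd.mono ?_)
    rw [Complex.closure_setOfPred_lt_re]
    intro z hz
    simp at hz ⊢
    linarith
  have key := PhragmenLindelof.right_half_plane_of_bounded_on_real (f := G) (C := B) (z := s - σ) hdc
    ⟨0, by norm_num, 0, ?_⟩ ?_ ?_ (by simpa using hs)
  · simpa [hG] using key
  · simp only [zero_mul, Real.exp_zero]
    refine Asymptotics.IsBigO.of_bound ((1 + 1 / (σ - 1)) ^ κ) ?_
    refine Filter.eventually_inf_principal.2 (Filter.Eventually.of_forall fun z hz => ?_)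
    simpa using hbd z (le_of_lt hz)
  · refine ⟨(1 + 1 / (σ - 1)) ^ κ, ?_⟩
    rw [Filter.eventually_map]
    filter_upwards [Filter.eventually_ge_atTop 0] with x hx
    exact hbd x (by simpa using hx)
  · intro t
    simpa [hG] using hB t

theorem one_add_rpow_le_two_rpow_mul {κ L : ℝ} (hκ : 0 < κ) (hL : 1 ≤ L) :
    (1 + L) ^ κ ≤ 2 ^ κ * L ^ κ := by
  rw [← Real.mul_rpow (by norm_num) (by linarith)]
  exact Real.rpow_le_rpow (by linarith) (by linarith) hκ.le

/-- A bound for `F_χ(s)/s` on a bounded piece of the line `re s = 1 + 1/L` extends to the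
half-plane to its right, and is bounded below. -/
theorem FserChi_halfPlane_bound {κ : ℝ} (hκ : 0 < κ) : ∃ C L₀ : ℝ, 1 ≤ C ∧ 1 ≤ L₀ ∧
    ∀ f Λf : ℕ → ℂ, IsHalaszClass κ f Λf → ∀ (q : ℕ) (χ : DirichletCharacter ℂ q) (L Q : ℝ),
    L₀ ≤ L → (∀ t : ℝ, |t| ≤ L ^ κ → ‖FserChi f χ ((1 + 1 / L : ℝ) + t * I) /
      ((1 + 1 / L : ℝ) + t * I)‖ ≤ Q) →
    1 ≤ C * Q ∧ ∀ s : ℂ, 1 + 1 / L ≤ s.re → ‖FserChi f χ s / s‖ ≤ C * Q := by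
  set δ : ℝ := (3 / 2) ^ (1 / κ) - 1 with hδ
  have hδ0 : 0 < δ := by
    have := Real.one_lt_rpow (x := 3 / 2) (by norm_num) (z := 1 / κ) (by positivity)
    linarith
  set σ₀ := 1 + 1 / δ with hσ₀
  have hσ₀1 : 1 < σ₀ := by
    have : 0 < 1 / δ := by positivity
    linarith
  have hσ₀2 : (1 + 1 / (σ₀ - 1)) ^ κ ≤ 3 / 2 := by
    have : 1 + 1 / (σ₀ - 1) = (3 / 2) ^ (1 / κ) := by
      rw [hσ₀, add_sub_cancel_left, one_div_one_div, hδ]; ring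
    rw [this, ← Real.rpow_mul (by norm_num), one_div_mul_cancel hκ.ne', Real.rpow_one]
  have h2κ : (1 : ℝ) ≤ 2 ^ κ := Real.one_le_rpow (by norm_num) hκ.le
  refine ⟨2 * σ₀ ^ 2 * 2 ^ κ, max (max 1 δ) ((4 * σ₀ ^ 2 * 2 ^ κ) ^ (1 / κ)), ?_, ?_, ?_⟩
  · have : 1 ≤ σ₀ ^ 2 := one_le_pow₀ hσ₀1.le
    nlinarith
  · exact (le_max_left _ _).trans (le_max_left _ _)
  intro f Λf h q χ L Q hL hQ
  have hL1 : 1 ≤ L := (le_max_left _ _).trans ((le_max_left _ _).trans hL)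
  have hLδ : δ ≤ L := (le_max_right _ _).trans ((le_max_left _ _).trans hL)
  have hLκ : 4 * σ₀ ^ 2 * 2 ^ κ ≤ L ^ κ := by
    have := Real.rpow_le_rpow (by positivity) ((le_max_right _ _).trans hL) hκ.le
    rwa [← Real.rpow_mul (by positivity), one_div_mul_cancel hκ.ne', Real.rpow_one] at this
  have hT : 0 < L ^ κ := by positivity
  have hσ : 1 < 1 + 1 / L := by
    have : 0 < 1 / L := by positivity
    linarith
  have hQ0 : 0 ≤ Q := (norm_nonneg _).trans (hQ 0 (by simp; positivity))
  have hF : ∀ t : ℝ, ‖FserChi f χ ((1 + 1 / L : ℝ) + t * I)‖ ≤ 2 ^ κ * L ^ κ := by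
    intro t
    have hre : ((1 + 1 / L : ℝ) + t * I : ℂ).re = 1 + 1 / L := by simp
    have := norm_FserChi_le hκ h χ (s := (1 + 1 / L : ℝ) + t * I) (by rw [hre]; exact hσ)
    rw [hre, add_sub_cancel_left, one_div_one_div] at this
    exact this.trans (one_add_rpow_le_two_rpow_mul hκ hL1)
  have hs1 : ∀ t : ℝ, 1 ≤ ‖((1 + 1 / L : ℝ) + t * I : ℂ)‖ := by
    intro t
    refine le_trans ?_ (Complex.re_le_norm _)
    simp
    linarith
  have hst : ∀ t : ℝ, |t| ≤ ‖((1 + 1 / L : ℝ) + t * I : ℂ)‖ := by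
    intro t
    refine le_trans (le_of_eq ?_) (Complex.abs_im_le_norm _)
    simp
  have hb1 : ∀ t : ℝ, ‖FserChi f χ ((1 + 1 / L : ℝ) + t * I) / ((1 + 1 / L : ℝ) + t * I) ^ 1‖ ≤
      max Q (2 ^ κ) := by
    intro t
    rw [pow_one]
    rcases le_or_gt |t| (L ^ κ) with ht | ht
    · exact (hQ t ht).trans (le_max_left _ _)
    · refine le_trans ?_ (le_max_right _ _)
      rw [norm_div, div_le_iff₀ (by linarith [hs1 t])]
      refine (hF t).trans ?_
      gcongr
      exact ht.le.trans (hst t)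
  have hb2 : ∀ t : ℝ, ‖FserChi f χ ((1 + 1 / L : ℝ) + t * I) / ((1 + 1 / L : ℝ) + t * I) ^ 2‖ ≤
      max Q (2 ^ κ / L ^ κ) := by
    intro t
    rw [pow_two, ← div_div, norm_div]
    rcases le_or_gt |t| (L ^ κ) with ht | ht
    · exact ((div_le_self (norm_nonneg _) (hs1 t)).trans (hQ t ht)).trans (le_max_left _ _)
    · refine le_trans ?_ (le_max_right _ _)
      have : ‖FserChi f χ ((1 + 1 / L : ℝ) + t * I) / ((1 + 1 / L : ℝ) + t * I)‖ ≤ 2 ^ κ := by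
        rw [norm_div, div_le_iff₀ (by linarith [hs1 t])]
        refine (hF t).trans ?_
        gcongr
        exact ht.le.trans (hst t)
      gcongr
      exact ht.le.trans (hst t)
  have hlow : 1 / (2 * σ₀ ^ 2) ≤ Q := by
    have h1 := phragmenLindelof_FserChi hκ h χ 2 hσ hb2 (s := (σ₀ : ℂ)) (by
      rw [Complex.ofReal_re, hσ₀]
      gcongr)
    have h2 := one_half_le_norm_FserChi hκ h χ hσ₀1 hσ₀2
    rw [norm_div, norm_pow, Complex.norm_real, Real.norm_of_nonneg (by linarith)] at h1
    have h3 : 1 / (2 * σ₀ ^ 2) ≤ max Q (2 ^ κ / L ^ κ) := by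
      refine le_trans ?_ h1
      rw [← div_div]
      gcongr
    rcases le_max_iff.1 h3 with h3 | h3
    · exact h3
    · exfalso
      rw [div_le_div_iff₀ (by positivity) (by positivity)] at h3
      have : 0 < σ₀ ^ 2 * 2 ^ κ := by positivity
      nlinarith
  have hlow2 : 1 ≤ 2 * σ₀ ^ 2 * Q := by
    rw [div_le_iff₀ (by positivity)] at hlow
    linarith
  refine ⟨by nlinarith, fun s hs => ?_⟩
  have h1 := phragmenLindelof_FserChi hκ h χ 1 hσ hb1 hs
  rw [pow_one] at h1
  refine h1.trans (max_le ?_ ?_)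
  · have : 1 ≤ σ₀ ^ 2 := one_le_pow₀ hσ₀1.le
    have : 1 ≤ 2 * σ₀ ^ 2 * 2 ^ κ := by nlinarith
    exact le_mul_of_one_le_left hQ0 this
  · nlinarith

theorem exists_norm_FserChi_sub_sum_le {κ : ℝ} (hκ : 0 < κ) {f Λf : ℕ → ℂ}
    (h : IsHalaszClass κ f Λf) {σ : ℝ} (hσ : 1 < σ) :
    ∃ K₀ : ℕ, ∀ K, K₀ ≤ K → ∀ (q : ℕ) (χ : DirichletCharacter ℂ q) (s : ℂ), s.re = σ →
    ‖∑ m ∈ Finset.Icc 1 K, f m * χ (m : ZMod q) / (m : ℂ) ^ s‖ ≤ ‖FserChi f χ s‖ + 1 := by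
  have hb := (h.sum_rpow_le hκ hσ).1
  have ht := tendsto_sum_nat_add (fun n : ℕ => ‖f n‖ * (n : ℝ) ^ (-σ))
  obtain ⟨K₀, hK₀⟩ := Filter.eventually_atTop.1 (ht.eventually_le_const one_pos)
  refine ⟨K₀, fun K hK q χ s hs => ?_⟩
  have hs1 : 1 < s.re := by rw [hs]; exact hσ
  have hs0 : s ≠ 0 := fun h => by simp [h] at hs1; linarith
  have hsum := FserChi_summable hκ h χ hs1
  have e := hsum.sum_add_tsum_nat_add (K + 1)
  have e2 : ∑ m ∈ Finset.range (K + 1), f m * χ (m : ZMod q) / (m : ℂ) ^ s =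
      ∑ m ∈ Finset.Icc 1 K, f m * χ (m : ZMod q) / (m : ℂ) ^ s := by
    symm
    refine Finset.sum_subset (fun m hm => ?_) fun m hm hm' => ?_
    · simp at hm ⊢; omega
    · have : m = 0 := by simp at hm hm'; omega
      subst this
      simp [hs0]
  have hsb := (summable_nat_add_iff (K + 1)).2 hb
  have htail : ‖∑' n : ℕ, f (n + (K + 1)) * χ ((n + (K + 1) : ℕ) : ZMod q) / ((n + (K + 1) : ℕ) : ℂ) ^ s‖ ≤ 1 := by
    refine le_trans (tsum_of_norm_bounded hsb.hasSum fun n => ?_) (hK₀ (K + 1) (by omega))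
    rw [← hs]
    exact FserChi_term_norm_le f χ (by linarith) _
  rw [← e2]
  have : ∑ m ∈ Finset.range (K + 1), f m * χ (m : ZMod q) / (m : ℂ) ^ s = FserChi f χ s -
      ∑' n : ℕ, f (n + (K + 1)) * χ ((n + (K + 1) : ℕ) : ZMod q) / ((n + (K + 1) : ℕ) : ℂ) ^ s := by
    rw [eq_sub_iff_add_eq]
    exact e
  rw [this]
  exact (norm_sub_le _ _).trans (by gcongr)

set_option maxHeartbeats 400000 in
theorem exists_partial_FserChi_le {κ : ℝ} (hκ : 0 < κ) : ∃ C L₀ : ℝ, 1 ≤ C ∧ 1 ≤ L₀ ∧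
    ∀ f Λf : ℕ → ℂ, IsHalaszClass κ f Λf → ∀ (q : ℕ) (L Q : ℝ), L₀ ≤ L →
    (∀ (χ : DirichletCharacter ℂ q) (t : ℝ), |t| ≤ L ^ κ →
      ‖FserChi f χ ((1 + 1 / L : ℝ) + t * I) / ((1 + 1 / L : ℝ) + t * I)‖ ≤ Q) →
    1 ≤ C * Q ∧ ∀ α : ℝ, 1 / L ≤ α → α ≤ 1 → ∃ K₀ : ℕ, ∀ K, K₀ ≤ K →
      ∀ (χ : DirichletCharacter ℂ q) (t : ℝ),
      ‖∑ m ∈ Finset.Icc 1 K, f m * χ (m : ZMod q) / (m : ℂ) ^ ((1 + α : ℝ) + t * I)‖ ^ 2 *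
        (1 + t ^ 2 / (L ^ κ) ^ 2) ≤
        C * (min Q ((1 / α) ^ κ)) ^ 2 * ((1 + α) ^ 2 + t ^ 2) := by
  obtain ⟨C, L₀, hC, hL₀, H⟩ := FserChi_halfPlane_bound hκ
  have h2κ : (1 : ℝ) ≤ 2 ^ κ := Real.one_le_rpow (by norm_num) hκ.le
  refine ⟨(4 + 2 * (2 ^ κ + 1) ^ 2) * C ^ 2, L₀, by nlinarith, hL₀, ?_⟩
  intro f Λf h q L Q hL hQ
  have hL1 : 1 ≤ L := hL₀.trans hL
  obtain ⟨hCQ, -⟩ := H f Λf h q 1 L Q hL (hQ 1)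
  have hQ0 : 0 < Q := by
    by_contra hn
    nlinarith
  refine ⟨?_, ?_⟩
  · have h1 : C ≤ (4 + 2 * (2 ^ κ + 1) ^ 2) * C ^ 2 := by nlinarith
    exact hCQ.trans (mul_le_mul_of_nonneg_right h1 hQ0.le)
  intro α hα hα1
  have hα0 : 0 < α := lt_of_lt_of_le (by positivity) hα
  obtain ⟨K₀, hK₀⟩ := exists_norm_FserChi_sub_sum_le hκ h (σ := 1 + α) (by linarith)
  refine ⟨K₀, fun K hK χ t => ?_⟩
  set s : ℂ := (1 + α : ℝ) + t * I with hs
  have hre : s.re = 1 + α := by simp [hs]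
  have him : s.im = t := by simp [hs]
  have hF := hK₀ K hK q χ s hre
  have hF1 := (H f Λf h q χ L Q hL (hQ χ)).2 s (by rw [hre]; linarith)
  have hF2 := norm_FserChi_le hκ h χ (s := s) (by rw [hre]; linarith)
  rw [hre, add_sub_cancel_left] at hF2
  set P := ‖∑ m ∈ Finset.Icc 1 K, f m * χ (m : ZMod q) / (m : ℂ) ^ s‖ with hP
  have hP0 : 0 ≤ P := norm_nonneg _
  have hs2 : ‖s‖ ^ 2 = (1 + α) ^ 2 + t ^ 2 := by
    rw [Complex.sq_norm, Complex.normSq_apply, hre, him]; ring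
  have hs1 : 1 ≤ ‖s‖ := by
    have := Complex.re_le_norm s
    rw [hre] at this
    linarith
  have hαinv : 1 ≤ 1 / α := by rw [one_le_div hα0]; exact hα1
  have hαL : 1 / α ≤ L := by rw [div_le_iff₀ hα0]; rw [div_le_iff₀ (by linarith)] at hα; linarith
  set Y := (1 / α) ^ κ with hY
  have hY1 : 1 ≤ Y := Real.one_le_rpow hαinv hκ.le
  set T := L ^ κ with hT
  have hYT : Y ≤ T := Real.rpow_le_rpow (by positivity) hαL hκ.le
  have hPY : P ≤ (2 ^ κ + 1) * Y := by
    have := one_add_rpow_le_two_rpow_mul hκ hαinv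
    linarith
  have hPQ : P ≤ 2 * C * Q * ‖s‖ := by
    rw [norm_div, div_le_iff₀ (by linarith)] at hF1
    have : 1 ≤ C * Q * ‖s‖ := by nlinarith
    linarith
  have hT1 : 1 ≤ T := hY1.trans hYT
  have hPT : P / T ≤ 2 ^ κ + 1 := by
    rw [div_le_iff₀ (by linarith)]
    exact hPY.trans (mul_le_mul_of_nonneg_left hYT (by positivity))
  have ht2 : t ^ 2 ≤ ‖s‖ ^ 2 := by rw [hs2]; nlinarith
  have hPT0 : 0 ≤ P / T := by positivity
  have hsplit : P ^ 2 * (1 + t ^ 2 / T ^ 2) = P ^ 2 + (P / T) ^ 2 * t ^ 2 := by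
    field_simp
  rw [← hs2, hsplit]
  have hPT2 : (P / T) ^ 2 * t ^ 2 ≤ (P / T) ^ 2 * ‖s‖ ^ 2 := by gcongr
  rcases min_cases Q Y with ⟨e, -⟩ | ⟨e, -⟩
  · rw [e]
    have h1 : P ^ 2 ≤ (2 * C * Q * ‖s‖) ^ 2 := by gcongr
    have h2 : (P / T) ^ 2 ≤ ((2 ^ κ + 1) * (C * Q)) ^ 2 := by
      have : P / T ≤ (2 ^ κ + 1) * (C * Q) := hPT.trans (le_mul_of_one_le_right (by positivity) hCQ)
      gcongr
    have h3 : (P / T) ^ 2 * ‖s‖ ^ 2 ≤ ((2 ^ κ + 1) * (C * Q)) ^ 2 * ‖s‖ ^ 2 := by gcongr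
    have h4 : 0 ≤ (2 ^ κ + 1) ^ 2 * C ^ 2 * Q ^ 2 * ‖s‖ ^ 2 := by positivity
    nlinarith
  · rw [e]
    have h1 : P ^ 2 ≤ ((2 ^ κ + 1) * Y) ^ 2 := by gcongr
    have h2 : (P / T) ^ 2 ≤ P ^ 2 := by
      have : P / T ≤ P := div_le_self hP0 hT1
      gcongr
    have h3 : (P / T) ^ 2 * ‖s‖ ^ 2 ≤ ((2 ^ κ + 1) * Y) ^ 2 * ‖s‖ ^ 2 := by
      have := h2.trans h1
      gcongr
    have h5 : ((2 ^ κ + 1) * Y) ^ 2 ≤ ((2 ^ κ + 1) * Y) ^ 2 * ‖s‖ ^ 2 :=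
      le_mul_of_one_le_right (by positivity) (one_le_pow₀ hs1)
    have h6 : 2 * (((2 ^ κ + 1) * Y) ^ 2 * ‖s‖ ^ 2) ≤
        (4 + 2 * (2 ^ κ + 1) ^ 2) * C ^ 2 * Y ^ 2 * ‖s‖ ^ 2 := by
      have : 2 * (2 ^ κ + 1) ^ 2 ≤ (4 + 2 * ((2 : ℝ) ^ κ + 1) ^ 2) * C ^ 2 := by
        have e1 : 0 ≤ ((2 : ℝ) ^ κ + 1) ^ 2 := sq_nonneg _
        have e2 : 0 ≤ 4 + 2 * ((2 : ℝ) ^ κ + 1) ^ 2 := by linarith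
        exact le_trans (by linarith) (le_mul_of_one_le_right e2 (one_le_pow₀ hC))
      calc 2 * (((2 ^ κ + 1) * Y) ^ 2 * ‖s‖ ^ 2) = 2 * (2 ^ κ + 1) ^ 2 * (Y ^ 2 * ‖s‖ ^ 2) := by ring
        _ ≤ (4 + 2 * ((2 : ℝ) ^ κ + 1) ^ 2) * C ^ 2 * (Y ^ 2 * ‖s‖ ^ 2) := by gcongr
        _ = _ := by ring
    linarith

theorem integral_exp_neg_mul_abs_mul_cexp {β : ℝ} (hβ : 0 < β) (v : ℝ) :
    Integrable (fun u : ℝ => Complex.exp ((v * I) * u) * (Real.exp (-(β * |u|)) : ℂ)) ∧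
    ∫ u : ℝ, Complex.exp ((v * I) * u) * (Real.exp (-(β * |u|)) : ℂ) =
      2 * β / (β ^ 2 + v ^ 2) := by
  set a : ℂ := v * I with ha
  have hre : a.re = 0 := by simp [ha]
  have h1 : Set.EqOn (fun u : ℝ => Complex.exp ((-β + a) * u))
      (fun u : ℝ => Complex.exp (a * u) * (Real.exp (-(β * |u|)) : ℂ)) (Set.Ioi (0 : ℝ)) := by
    intro u hu
    simp only
    rw [abs_of_pos hu]
    push_cast
    rw [← Complex.exp_add]
    ring_nf
  have h2 : Set.EqOn (fun u : ℝ => Complex.exp ((β + a) * u))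
      (fun u : ℝ => Complex.exp (a * u) * (Real.exp (-(β * |u|)) : ℂ)) (Set.Iic (0 : ℝ)) := by
    intro u hu
    simp only
    rw [abs_of_nonpos hu]
    push_cast
    rw [← Complex.exp_add]
    ring_nf
  have hr1 : (-β + a).re < 0 := by simp [hre, hβ]
  have hr2 : 0 < (β + a).re := by simp [hre, hβ]
  have i1 := (integrableOn_exp_mul_complex_Ioi hr1 0).congr_fun h1 measurableSet_Ioi
  have i2 := (integrableOn_exp_mul_complex_Iic hr2 0).congr_fun h2 measurableSet_Iic
  refine ⟨by simpa using! i2.union i1, ?_⟩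
  rw [← intervalIntegral.integral_Iic_add_Ioi i2 i1, ← setIntegral_congr_fun measurableSet_Ioi h1,
    ← setIntegral_congr_fun measurableSet_Iic h2, integral_exp_mul_complex_Ioi hr1,
    integral_exp_mul_complex_Iic hr2]
  have hn1 : (-β + a) ≠ 0 := fun h => by simp [h] at hr1
  have hn2 : (β + a) ≠ 0 := fun h => by simp [h] at hr2
  have hn3 : (β ^ 2 + v ^ 2 : ℂ) ≠ 0 := by
    have : (β ^ 2 + v ^ 2 : ℝ) ≠ 0 := by positivity
    exact_mod_cast this
  have e : a ^ 2 = -v ^ 2 := by rw [ha, mul_pow, I_sq]; ring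
  simp only [Complex.ofReal_zero, mul_zero, Complex.exp_zero]
  field_simp
  ring_nf
  rw [e]
  ring

open FourierTransform in
theorem integral_cexp_div_sq_add_sq {β : ℝ} (hβ : 0 < β) (u : ℝ) :
    ∫ t : ℝ, Complex.exp ((u * I) * t) * ((β ^ 2 + t ^ 2)⁻¹ : ℝ) =
      (Real.pi / β * Real.exp (-(β * |u|)) : ℝ) := by
  set F : ℝ → ℂ := fun u : ℝ => (Real.exp (-(β * |u|)) : ℂ) with hF
  have hFi : Integrable F := by simpa [hF] using (integral_exp_neg_mul_abs_mul_cexp hβ 0).1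
  have hFT : 𝓕 F = fun w : ℝ => ((2 * β * (β ^ 2 + (2 * Real.pi * w) ^ 2)⁻¹ : ℝ) : ℂ) := by
    ext w
    rw [Real.fourier_real_eq_integral_exp_smul]
    have := (integral_exp_neg_mul_abs_mul_cexp hβ (-2 * Real.pi * w)).2
    rw [show (β ^ 2 + ((-2 * Real.pi * w : ℝ) : ℂ) ^ 2) = β ^ 2 + (2 * Real.pi * w) ^ 2 by
      push_cast; ring] at this
    push_cast
    rw [← div_eq_mul_inv, ← this]
    refine integral_congr_ae (Filter.Eventually.of_forall fun v => ?_)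
    simp only [smul_eq_mul, hF]
    push_cast
    ring_nf
  have hint : Integrable (fun w : ℝ => (β ^ 2 + w ^ 2)⁻¹) := by
    have h1 := (integrable_inv_one_add_sq.comp_div hβ.ne').const_mul ((β ^ 2)⁻¹)
    refine h1.congr (Filter.Eventually.of_forall fun w => ?_)
    simp only
    rw [← mul_inv]
    congr 1
    field_simp
  have hFTi : Integrable (𝓕 F) := by
    rw [hFT]
    refine Integrable.ofReal ?_
    have h1 := (hint.comp_mul_left' (R := 2 * Real.pi) (by positivity)).const_mul (2 * β)
    exact h1
  have hinv := hFi.fourierInv_fourier_eq hFTi (v := u) (by fun_prop)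
  rw [Real.fourierInv_eq', hFT] at hinv
  have h3 := Measure.integral_comp_mul_left
    (fun t : ℝ => Complex.exp ((u * I) * t) * ((β ^ 2 + t ^ 2)⁻¹ : ℝ)) (2 * Real.pi)
  have h4 : ∫ w : ℝ, Complex.exp ((u * I) * (2 * Real.pi * w : ℝ)) *
      ((β ^ 2 + (2 * Real.pi * w) ^ 2)⁻¹ : ℝ) = (2 * β : ℂ)⁻¹ * Real.exp (-(β * |u|)) := by
    rw [eq_inv_mul_iff_mul_eq₀ (by norm_cast; positivity), ← integral_const_mul]
    rw [← hF] at *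
    rw [show (Real.exp (-(β * |u|)) : ℂ) = F u from rfl, ← hinv]
    refine integral_congr_ae (Filter.Eventually.of_forall fun v => ?_)
    simp only [smul_eq_mul]
    push_cast
    have : (inner ℝ v u : ℝ) = u * v := by simp
    rw [this]
    push_cast
    ring_nf
  rw [h4, abs_of_pos (a := (2 * Real.pi)⁻¹) (by positivity), Complex.real_smul] at h3
  have h5 : ((2 * Real.pi : ℝ) : ℂ) * ((2 * β : ℂ)⁻¹ * Real.exp (-(β * |u|))) =
      ∫ t : ℝ, Complex.exp ((u * I) * t) * ((β ^ 2 + t ^ 2)⁻¹ : ℝ) := by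
    rw [h3, ← mul_assoc, ← Complex.ofReal_mul, mul_inv_cancel₀ (by positivity)]
    simp
  rw [← h5]
  push_cast
  have : (β : ℂ) ≠ 0 := by exact_mod_cast hβ.ne'
  field_simp

theorem integrable_inv_sq_add_sq {β : ℝ} (hβ : 0 < β) :
    Integrable (fun t : ℝ => (β ^ 2 + t ^ 2)⁻¹) := by
  have h1 := (integrable_inv_one_add_sq.comp_div hβ.ne').const_mul ((β ^ 2)⁻¹)
  refine h1.congr (Filter.Eventually.of_forall fun w => ?_)
  simp only
  rw [← mul_inv]
  congr 1
  field_simp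

theorem ofReal_norm_sq_sum {ι : Type*} (s : Finset ι) (z : ι → ℂ) :
    ((‖∑ i ∈ s, z i‖ ^ 2 : ℝ) : ℂ) = ∑ i ∈ s, ∑ j ∈ s, z i * (starRingEnd ℂ) (z j) := by
  rw [Complex.sq_norm, Complex.normSq_eq_conj_mul_self, mul_comm, map_sum, Finset.sum_mul_sum]

theorem integral_norm_sq_sum_div {ι : Type*} (s : Finset ι) (c : ι → ℂ) (l : ι → ℝ) {β : ℝ}
    (hβ : 0 < β) :
    Integrable (fun t : ℝ => ‖∑ i ∈ s, c i * Complex.exp (-(l i * I) * t)‖ ^ 2 * (β ^ 2 + t ^ 2)⁻¹) ∧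
    ((∫ t : ℝ, ‖∑ i ∈ s, c i * Complex.exp (-(l i * I) * t)‖ ^ 2 * (β ^ 2 + t ^ 2)⁻¹ : ℝ) : ℂ) =
      (Real.pi / β : ℝ) * ∑ i ∈ s, ∑ j ∈ s, c i * (starRingEnd ℂ) (c j) *
        (Real.exp (-(β * |l i - l j|)) : ℝ) := by
  have hi := integrable_inv_sq_add_sq hβ
  have hint : ∀ u : ℝ, Integrable (fun t : ℝ => Complex.exp ((u * I) * t) * ((β ^ 2 + t ^ 2)⁻¹ : ℝ)) := by
    intro u
    refine hi.ofReal.bdd_mul (c := 1) (by fun_prop) (Filter.Eventually.of_forall fun t => ?_)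
    rw [show ((u : ℂ) * I * t) = ((u * t : ℝ) : ℂ) * I by push_cast; ring, Complex.norm_exp_ofReal_mul_I]
  have hexp : ∀ t : ℝ, ((‖∑ i ∈ s, c i * Complex.exp (-(l i * I) * t)‖ ^ 2 * (β ^ 2 + t ^ 2)⁻¹ : ℝ) : ℂ) =
      ∑ i ∈ s, ∑ j ∈ s, c i * (starRingEnd ℂ) (c j) *
        (Complex.exp (((l j - l i : ℝ) * I) * t) * ((β ^ 2 + t ^ 2)⁻¹ : ℝ)) := by
    intro t
    rw [Complex.ofReal_mul, ofReal_norm_sq_sum, Finset.sum_mul]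
    refine Finset.sum_congr rfl fun i _ => ?_
    rw [Finset.sum_mul]
    refine Finset.sum_congr rfl fun j _ => ?_
    rw [map_mul, ← Complex.exp_conj]
    simp only [map_mul, map_neg, Complex.conj_ofReal, Complex.conj_I]
    have : Complex.exp (((l j - l i : ℝ) * I) * t) =
        Complex.exp (-(l i * I) * t) * Complex.exp (-(l j * -I) * t) := by
      rw [← Complex.exp_add]
      push_cast
      ring_nf
    rw [this]
    ring
  refine ⟨?_, ?_⟩
  · refine hi.bdd_mul (c := (∑ i ∈ s, ‖c i‖) ^ 2) (by fun_prop) (Filter.Eventually.of_forall fun t => ?_)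
    rw [Real.norm_of_nonneg (by positivity)]
    gcongr
    refine (norm_sum_le _ _).trans (Finset.sum_le_sum fun i _ => ?_)
    rw [norm_mul, show (-((l i : ℂ) * I) * t) = ((-(l i * t) : ℝ) : ℂ) * I by push_cast; ring,
      Complex.norm_exp_ofReal_mul_I, mul_one]
  rw [← integral_complex_ofReal]
  simp_rw [hexp]
  rw [integral_finsetSum _ fun i _ => integrable_finsetSum _ fun j _ => (hint _).const_mul _,
    Finset.mul_sum]
  refine Finset.sum_congr rfl fun i _ => ?_
  rw [integral_finsetSum _ fun j _ => (hint _).const_mul _, Finset.mul_sum]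
  refine Finset.sum_congr rfl fun j _ => ?_
  rw [integral_const_mul, integral_cexp_div_sq_add_sq hβ, abs_sub_comm]
  push_cast
  ring

theorem natCast_cpow_neg {n : ℕ} (hn : 1 ≤ n) (σ t : ℝ) :
    (n : ℂ) ^ (-(σ + t * I)) = ((n : ℝ) ^ (-σ) : ℝ) * Complex.exp (-(Real.log n * I) * t) := by
  have hn0 : (n : ℂ) ≠ 0 := by exact_mod_cast (by omega : n ≠ 0)
  have hnp : (0 : ℝ) < n := by exact_mod_cast hn
  rw [Complex.cpow_def_of_ne_zero hn0, Real.rpow_def_of_pos hnp, Complex.ofReal_exp, ← Complex.exp_add,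
    ← Complex.natCast_log]
  push_cast
  ring_nf

theorem integral_norm_sq_sum_le_le {ι : Type*} (s : Finset ι) (c : ι → ℂ) (n : ι → ℕ)
    (hn : ∀ i ∈ s, 1 ≤ n i) {σ : ℝ} (hσ : 0 < σ) :
    Integrable (fun t : ℝ => ‖∑ i ∈ s, c i * (n i : ℂ) ^ (-(σ + t * I))‖ ^ 2 * (σ ^ 2 + t ^ 2)⁻¹) ∧
    IntegrableOn (fun u : ℝ => ‖∑ i ∈ s with (n i : ℝ) ≤ u, c i‖ ^ 2 * u ^ (-2 * σ - 1)) (Set.Ioi 1) ∧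
    ∫ u in Set.Ioi (1 : ℝ), ‖∑ i ∈ s with (n i : ℝ) ≤ u, c i‖ ^ 2 * u ^ (-2 * σ - 1) =
      1 / (2 * Real.pi) *
      ∫ t : ℝ, ‖∑ i ∈ s, c i * (n i : ℂ) ^ (-(σ + t * I))‖ ^ 2 * (σ ^ 2 + t ^ 2)⁻¹ := by
  have hD : ∀ t : ℝ, ∑ i ∈ s, c i * (n i : ℂ) ^ (-(σ + t * I)) =
      ∑ i ∈ s, (c i * ((n i : ℝ) ^ (-σ) : ℝ)) * Complex.exp (-(Real.log (n i) * I) * t) := by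
    intro t
    refine Finset.sum_congr rfl fun i hi => ?_
    rw [natCast_cpow_neg (hn i hi), mul_assoc]
  simp_rw [hD]
  obtain ⟨h1, h2⟩ := integral_norm_sq_sum_div s (fun i => c i * ((n i : ℝ) ^ (-σ) : ℝ))
    (fun i => Real.log (n i)) hσ
  refine ⟨h1, ?_⟩
  have hexp : ∀ u ∈ Set.Ioi (1 : ℝ),
      ((‖∑ i ∈ s with (n i : ℝ) ≤ u, c i‖ ^ 2 * u ^ (-2 * σ - 1) : ℝ) : ℂ) =
      ∑ i ∈ s, ∑ j ∈ s, c i * (starRingEnd ℂ) (c j) *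
        ((Set.Ici (max (n i : ℝ) (n j))).indicator (fun u : ℝ => u ^ (-2 * σ - 1)) u : ℝ) := by
    intro u hu
    rw [Complex.ofReal_mul, Finset.sum_filter, ofReal_norm_sq_sum, Finset.sum_mul]
    refine Finset.sum_congr rfl fun i _ => ?_
    rw [Finset.sum_mul]
    refine Finset.sum_congr rfl fun j _ => ?_
    by_cases hi : (n i : ℝ) ≤ u <;> by_cases hj : (n j : ℝ) ≤ u <;>
      simp [hi, hj, Set.indicator]
  have hind : ∀ i ∈ s, ∀ j ∈ s, IntegrableOn
      ((Set.Ici (max (n i : ℝ) (n j))).indicator (fun u : ℝ => u ^ (-2 * σ - 1))) (Set.Ioi 1) ∧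
      ∫ u in Set.Ioi (1 : ℝ), (Set.Ici (max (n i : ℝ) (n j))).indicator (fun u : ℝ => u ^ (-2 * σ - 1)) u =
        (max (n i : ℝ) (n j)) ^ (-2 * σ) / (2 * σ) := by
    intro i hi j hj
    have hi1 : (1 : ℝ) ≤ n i := by exact_mod_cast hn i hi
    have hm : 0 < max (n i : ℝ) (n j) := lt_max_of_lt_left (by linarith)
    have hio : IntegrableOn (fun u : ℝ => u ^ (-2 * σ - 1)) (Set.Ioi (max (n i : ℝ) (n j))) :=
      integrableOn_Ioi_rpow_of_lt (by linarith) hm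
    have hio2 : IntegrableOn (fun u : ℝ => u ^ (-2 * σ - 1)) (Set.Ici (max (n i : ℝ) (n j))) :=
      (integrableOn_Ici_iff_integrableOn_Ioi (by simp)).2 hio
    refine ⟨((integrable_indicator_iff measurableSet_Ici).2 hio2).integrableOn, ?_⟩
    rw [setIntegral_indicator measurableSet_Ici]
    have hset : ∫ u in Set.Ioi (1 : ℝ) ∩ Set.Ici (max (n i : ℝ) (n j)), u ^ (-2 * σ - 1) =
        ∫ u in Set.Ioi (max (n i : ℝ) (n j)), u ^ (-2 * σ - 1) := by
      rcases (le_max_of_le_left hi1 : 1 ≤ max (n i : ℝ) (n j)).eq_or_lt with h | h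
      · rw [← h, Set.inter_eq_left.2 Set.Ioi_subset_Ici_self]
      · rw [Set.inter_eq_right.2 (Set.Ici_subset_Ioi.2 h), integral_Ici_eq_integral_Ioi]
    rw [hset, integral_Ioi_rpow_of_lt (by linarith) hm]
    rw [show -2 * σ - 1 + 1 = -2 * σ by ring]
    rw [neg_div, ← div_neg]
    ring_nf
  have hmax : ∀ i ∈ s, ∀ j ∈ s, ((n i : ℝ) ^ (-σ)) * ((n j : ℝ) ^ (-σ)) *
      Real.exp (-(σ * |Real.log (n i) - Real.log (n j)|)) = (max (n i : ℝ) (n j)) ^ (-2 * σ) := by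
    intro i hi j hj
    have hi1 : (0 : ℝ) < n i := by exact_mod_cast hn i hi
    have hj1 : (0 : ℝ) < n j := by exact_mod_cast hn j hj
    rw [Real.rpow_def_of_pos hi1, Real.rpow_def_of_pos hj1, ← Real.exp_add, ← Real.exp_add,
      Real.rpow_def_of_pos (lt_max_of_lt_left hi1)]
    congr 1
    rcases le_total (n i : ℝ) (n j) with h | h
    · rw [max_eq_right h, abs_of_nonpos (sub_nonpos.2 (Real.log_le_log hi1 h))]
      ring
    · rw [max_eq_left h, abs_of_nonneg (sub_nonneg.2 (Real.log_le_log hj1 h))]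
      ring
  have hsum : IntegrableOn (fun u : ℝ => ∑ i ∈ s, ∑ j ∈ s, c i * (starRingEnd ℂ) (c j) *
        ((Set.Ici (max (n i : ℝ) (n j))).indicator (fun u : ℝ => u ^ (-2 * σ - 1)) u : ℝ)) (Set.Ioi 1) :=
    integrable_finsetSum _ fun i hi => integrable_finsetSum _ fun j hj =>
      ((hind i hi j hj).1.ofReal).const_mul _
  refine ⟨?_, ?_⟩
  · have := (hsum.congr_fun (fun u hu => (hexp u hu).symm) measurableSet_Ioi).re
    simpa only [RCLike.re_to_complex, Complex.ofReal_re] using! this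
  · apply Complex.ofReal_injective
    rw [Complex.ofReal_mul, h2, ← integral_complex_ofReal, setIntegral_congr_fun measurableSet_Ioi hexp,
      integral_finsetSum _ fun i hi => integrable_finsetSum _ fun j hj =>
      ((hind i hi j hj).1.ofReal).const_mul _, Finset.mul_sum, Finset.mul_sum]
    refine Finset.sum_congr rfl fun i hi => ?_
    rw [integral_finsetSum _ fun j hj => ((hind i hi j hj).1.ofReal).const_mul _,
      Finset.mul_sum, Finset.mul_sum]
    refine Finset.sum_congr rfl fun j hj => ?_
    rw [integral_const_mul, integral_complex_ofReal, (hind i hi j hj).2, ← hmax i hi j hj]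
    rw [map_mul, Complex.conj_ofReal]
    push_cast
    have : (σ : ℂ) ≠ 0 := by exact_mod_cast hσ.ne'
    have : (Real.pi : ℂ) ≠ 0 := by exact_mod_cast Real.pi_ne_zero
    field_simp

theorem sum_vonMangoldt_mul_div_rpow_le : ∃ C : ℝ, 0 < C ∧ ∀ q a : ℕ, 1 ≤ q → ∀ T y U : ℝ,
    1 ≤ T → Real.exp 1 * ((q : ℝ) * T) ^ 4 ≤ y → 0 < U →
    ∑ d ∈ (Finset.Ioc ⌊y⌋₊ ⌊U⌋₊).filter (fun n => n ≡ a [MOD q]),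
      ArithmeticFunction.vonMangoldt d * ((d : ℝ) / U) ^ (T / 2) ≤ C * (U / (T * q.totient)) := by
  obtain ⟨C, hC, hBT⟩ := sum_vonMangoldt_modEq_le
  refine ⟨3 * C, by positivity, fun q a hq T y U hT hy hU => ?_⟩
  have hT0 : 0 < T := by linarith
  have hq1 : (1 : ℝ) ≤ q := by exact_mod_cast hq
  have hy0 : 0 < y := lt_of_lt_of_le (by positivity) hy
  have hφ : 0 < (q.totient : ℝ) := by exact_mod_cast Nat.totient_pos.2 hq
  set s := (Finset.Ioc ⌊y⌋₊ ⌊U⌋₊).filter (fun n => n ≡ a [MOD q]) with hs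
  have hmem : ∀ d ∈ s, y < d ∧ (d : ℝ) ≤ U ∧ d ≡ a [MOD q] := by
    intro d hd
    rw [hs, Finset.mem_filter, Finset.mem_Ioc] at hd
    exact ⟨(Nat.floor_lt hy0.le).1 hd.1.1, (Nat.le_floor_iff hU.le).1 hd.1.2, hd.2⟩
  set k : ℕ → ℕ := fun d => ⌊T * Real.log (U / d)⌋₊ with hk
  obtain ⟨K, hK⟩ : ∃ K, ∀ d ∈ s, k d < K := by
    refine ⟨s.sup k + 1, fun d hd => Nat.lt_succ_of_le (Finset.le_sup (f := k) hd)⟩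
  rw [← Finset.sum_fiberwise_of_maps_to (t := Finset.range K) (g := k)
    fun d hd => Finset.mem_range.2 (hK d hd)]
  have hfib : ∀ j : ℕ, ∑ d ∈ s.filter (fun d => k d = j),
      ArithmeticFunction.vonMangoldt d * ((d : ℝ) / U) ^ (T / 2) ≤
        C * (U / (T * q.totient)) * (Real.exp (-(1 / 2))) ^ j := by
    intro j
    rcases (s.filter (fun d => k d = j)).eq_empty_or_nonempty with h | ⟨d₀, hd₀⟩
    · rw [h]
      simp only [Finset.sum_empty]
      positivity
    have hcell : ∀ d ∈ s.filter (fun d => k d = j),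
        U * Real.exp (-((j + 1) / T)) < d ∧ (d : ℝ) ≤ U * Real.exp (-(j / T)) := by
      intro d hd
      rw [Finset.mem_filter] at hd
      obtain ⟨h1, h2, h3⟩ := hmem d hd.1
      have hd0 : (0 : ℝ) < d := hy0.trans h1
      have hl : 0 ≤ T * Real.log (U / d) :=
        mul_nonneg hT0.le (Real.log_nonneg ((one_le_div hd0).2 h2))
      have e1 : (j : ℝ) ≤ T * Real.log (U / d) := by
        rw [← hd.2]; exact Nat.floor_le hl
      have e2 : T * Real.log (U / d) < j + 1 := by
        rw [← hd.2]; exact Nat.lt_floor_add_one _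
      rw [Real.log_div hU.ne' hd0.ne'] at e1 e2
      constructor
      · rw [← Real.log_lt_log_iff (by positivity) hd0,
          Real.log_mul hU.ne' (Real.exp_pos _).ne', Real.log_exp]
        have : Real.log U - Real.log d < (j + 1) / T := by
          rw [lt_div_iff₀ hT0]; linarith
        linarith
      · rw [← Real.log_le_log_iff hd0 (by positivity),
          Real.log_mul hU.ne' (Real.exp_pos _).ne', Real.log_exp]
        have : j / T ≤ Real.log U - Real.log d := by
          rw [div_le_iff₀ hT0]; linarith
        linarith
    have hw : ∀ d ∈ s.filter (fun d => k d = j),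
        ((d : ℝ) / U) ^ (T / 2) ≤ (Real.exp (-(1 / 2))) ^ j := by
      intro d hd
      have h1 := (hcell d hd).2
      have h0 : (0 : ℝ) ≤ (d : ℝ) / U := by positivity
      calc ((d : ℝ) / U) ^ (T / 2) ≤ (Real.exp (-(j / T))) ^ (T / 2) := by
            apply Real.rpow_le_rpow h0 _ (by positivity)
            rw [div_le_iff₀ hU]; linarith
        _ = (Real.exp (-(1 / 2))) ^ j := by
            rw [← Real.exp_mul, ← Real.exp_nat_mul]
            congr 1
            field_simp
    set V := U * Real.exp (-((j + 1) / T)) with hV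
    have hVU : V ≤ U := by
      rw [hV]
      refine mul_le_of_le_one_right hU.le (Real.exp_le_one_iff.2 ?_)
      have : 0 ≤ ((j : ℝ) + 1) / T := by positivity
      linarith
    have hVe : V * Real.exp (1 / T) = U * Real.exp (-(j / T)) := by
      rw [hV, mul_assoc, ← Real.exp_add]
      congr 2
      field_simp
      ring
    have hV4 : ((q : ℝ) * T) ^ 4 ≤ V := by
      have h1 := (hcell d₀ hd₀).2
      have h2 := (hmem d₀ (Finset.mem_filter.1 hd₀).1).1
      rw [← hVe] at h1
      have h3 : Real.exp (1 / T) ≤ Real.exp 1 :=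
        Real.exp_le_exp.2 ((div_le_one hT0).2 hT)
      have hV0 : 0 < V := by positivity
      have h4 : V * Real.exp (1 / T) ≤ V * Real.exp 1 := mul_le_mul_of_nonneg_left h3 hV0.le
      have h5 : Real.exp 1 * ((q : ℝ) * T) ^ 4 ≤ Real.exp 1 * V := by linarith
      exact le_of_mul_le_mul_left h5 (Real.exp_pos 1)
    calc ∑ d ∈ s.filter (fun d => k d = j),
          ArithmeticFunction.vonMangoldt d * ((d : ℝ) / U) ^ (T / 2)
        ≤ ∑ d ∈ s.filter (fun d => k d = j),
          ArithmeticFunction.vonMangoldt d * (Real.exp (-(1 / 2))) ^ j :=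
          Finset.sum_le_sum fun d hd => mul_le_mul_of_nonneg_left (hw d hd)
            ArithmeticFunction.vonMangoldt_nonneg
      _ = (∑ d ∈ s.filter (fun d => k d = j), ArithmeticFunction.vonMangoldt d) *
          (Real.exp (-(1 / 2))) ^ j := by rw [Finset.sum_mul]
      _ ≤ (C * (V / (T * q.totient))) * (Real.exp (-(1 / 2))) ^ j := by
          refine mul_le_mul_of_nonneg_right ?_ (by positivity)
          refine le_trans ?_ (hBT q a hq T V hT hV4)
          refine Finset.sum_le_sum_of_subset_of_nonneg (fun d hd => ?_)
            fun _ _ _ => ArithmeticFunction.vonMangoldt_nonneg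
          obtain ⟨h1, h2⟩ := hcell d hd
          rw [Finset.mem_filter, Finset.mem_Ioc]
          refine ⟨⟨(Nat.floor_lt (by positivity)).2 h1, Nat.le_floor ?_⟩,
            (hmem d (Finset.mem_filter.1 hd).1).2.2⟩
          rw [hVe]; exact h2
      _ ≤ _ := by gcongr
  calc _ ≤ ∑ j ∈ Finset.range K, C * (U / (T * q.totient)) * (Real.exp (-(1 / 2))) ^ j :=
        Finset.sum_le_sum fun j _ => hfib j
    _ = C * (U / (T * q.totient)) * ∑ j ∈ Finset.range K, (Real.exp (-(1 / 2))) ^ j := by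
        rw [Finset.mul_sum]
    _ ≤ C * (U / (T * q.totient)) * 3 := by
        refine mul_le_mul_of_nonneg_left ?_ (by positivity)
        have he : Real.exp (-(1 / 2)) ≤ 2 / 3 := by
          rw [Real.exp_neg, inv_le_comm₀ (Real.exp_pos _) (by norm_num)]
          have := Real.add_one_le_exp (1 / 2 : ℝ)
          linarith
        have hlt : Real.exp (-(1 / 2)) < 1 := by linarith
        calc _ ≤ (1 - Real.exp (-(1 / 2)))⁻¹ := by
              rw [← tsum_geometric_of_lt_one (Real.exp_pos _).le hlt]
              exact (summable_geometric_of_lt_one (Real.exp_pos _).le hlt).sum_le_tsum _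
                fun _ _ => by positivity
          _ ≤ 3 := by
              rw [inv_le_comm₀ (by linarith) (by norm_num)]
              linarith
    _ = _ := by ring

theorem norm_sum_dirichletCharacter_mul_conj (q : ℕ) [NeZero q] (d e : ℕ) :
    ‖∑ χ : DirichletCharacter ℂ q, χ (d : ZMod q) * (starRingEnd ℂ) (χ (e : ZMod q))‖ ≤
      if d ≡ e [MOD q] then (q.totient : ℝ) else 0 := by
  by_cases he : IsUnit (e : ZMod q)
  · have h := DirichletCharacter.sum_char_inv_mul_char_eq ℂ he (d : ZMod q)
    have h2 : ∑ χ : DirichletCharacter ℂ q, χ (d : ZMod q) * (starRingEnd ℂ) (χ (e : ZMod q)) =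
        ∑ χ : DirichletCharacter ℂ q, χ (e : ZMod q)⁻¹ * χ (d : ZMod q) := by
      refine Finset.sum_congr rfl fun χ _ => ?_
      have : (starRingEnd ℂ) (χ (e : ZMod q)) = χ⁻¹ (e : ZMod q) := MulChar.star_apply' χ _
      obtain ⟨u, hu⟩ := he
      rw [this, MulChar.inv_apply, mul_comm, ← hu, Ring.inverse_unit, ZMod.inv_coe_unit]
    rw [h2, h]
    by_cases hde : d ≡ e [MOD q]
    · have := (ZMod.natCast_eq_natCast_iff e d q).2 hde.symm
      simp [hde, this]
    · have : (e : ZMod q) ≠ d := fun h => hde ((ZMod.natCast_eq_natCast_iff e d q).1 h).symm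
      simp [hde, this]
  · have : ∀ χ : DirichletCharacter ℂ q, χ (e : ZMod q) = 0 := fun χ => χ.map_nonunit he
    simp only [this, map_zero, mul_zero, Finset.sum_const_zero, norm_zero]
    split_ifs <;> positivity

theorem sum_sum_le_two_mul_sum_sum_filter_le (s : Finset ℕ) (w : ℕ → ℕ → ℝ)
    (hw : ∀ i j, 0 ≤ w i j) (hs : ∀ i j, w i j = w j i) :
    ∑ i ∈ s, ∑ j ∈ s, w i j ≤ 2 * ∑ i ∈ s, ∑ j ∈ s.filter (fun j => j ≤ i), w i j := by
  have h1 : ∀ i j, w i j ≤ (if j ≤ i then w i j else 0) + (if i ≤ j then w j i else 0) := by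
    intro i j
    have := hw i j
    rcases le_total i j with h | h
    · rw [if_pos h, ← hs i j]
      split_ifs <;> linarith
    · rw [if_pos h, ← hs i j]
      split_ifs <;> linarith
  calc ∑ i ∈ s, ∑ j ∈ s, w i j
      ≤ ∑ i ∈ s, ∑ j ∈ s, ((if j ≤ i then w i j else 0) + (if i ≤ j then w j i else 0)) :=
        Finset.sum_le_sum fun i _ => Finset.sum_le_sum fun j _ => h1 i j
    _ = ∑ i ∈ s, ∑ j ∈ s, (if j ≤ i then w i j else 0) +
          ∑ j ∈ s, ∑ i ∈ s, (if i ≤ j then w j i else 0) := by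
        simp only [Finset.sum_add_distrib]
        congr 1
        exact Finset.sum_comm
    _ = _ := by
        rw [two_mul]
        simp only [Finset.sum_filter]

theorem sum_integral_norm_sq_character_sum_le : ∃ C : ℝ, 0 < C ∧ ∀ (κ : ℝ) (c : ℕ → ℂ), 0 ≤ κ →
    (∀ n, 1 ≤ n → ‖c n‖ ≤ κ * ArithmeticFunction.vonMangoldt n) → ∀ (q : ℕ) [NeZero q] (T y σ : ℝ)
    (D : ℕ), 2 ≤ T → Real.exp 1 * ((q : ℝ) * T) ^ 4 ≤ y → 1 ≤ σ →
    (∀ χ : DirichletCharacter ℂ q, Integrable fun t : ℝ => ‖∑ d ∈ Finset.Ioc ⌊y⌋₊ D,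
      c d * χ (d : ZMod q) * (d : ℂ) ^ (-(σ + t * I))‖ ^ 2 * (T ^ 2 + t ^ 2)⁻¹) ∧
    ∑ χ : DirichletCharacter ℂ q, ∫ t : ℝ, ‖∑ d ∈ Finset.Ioc ⌊y⌋₊ D,
      c d * χ (d : ZMod q) * (d : ℂ) ^ (-(σ + t * I))‖ ^ 2 * (T ^ 2 + t ^ 2)⁻¹ ≤
      C * κ ^ 2 / T ^ 2 * ∑ d ∈ Finset.Ioc ⌊y⌋₊ D, ArithmeticFunction.vonMangoldt d / d := by
  obtain ⟨C, hC, hW⟩ := sum_vonMangoldt_mul_div_rpow_le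
  refine ⟨2 * Real.pi * C, by positivity, fun κ c hκ hc q _ T y σ D hT hy hσ => ?_⟩
  have hT0 : 0 < T := by linarith
  have hq : 1 ≤ q := Nat.one_le_iff_ne_zero.2 (NeZero.ne q)
  have hφ : 0 < (q.totient : ℝ) := by exact_mod_cast Nat.totient_pos.2 hq
  have hq1 : (1 : ℝ) ≤ q := by exact_mod_cast hq
  have hqT : 1 ≤ ((q : ℝ) * T) ^ 4 := one_le_pow₀ (by nlinarith)
  have hy1 : 1 ≤ y := by
    have := Real.add_one_le_exp (1 : ℝ)
    nlinarith
  set s := Finset.Ioc ⌊y⌋₊ D with hs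
  have hs1 : ∀ d ∈ s, 1 ≤ d := fun d hd => by
    have := (Finset.mem_Ioc.1 hd).1
    omega
  have hrw : ∀ (χ : DirichletCharacter ℂ q) (t : ℝ),
      ∑ d ∈ s, c d * χ (d : ZMod q) * (d : ℂ) ^ (-(σ + t * I)) =
      ∑ d ∈ s, (c d * χ (d : ZMod q) * ((d : ℝ) ^ (-σ) : ℝ)) *
        Complex.exp (-(Real.log d * I) * t) := by
    intro χ t
    refine Finset.sum_congr rfl fun d hd => ?_
    rw [natCast_cpow_neg (hs1 d hd)]
    ring
  simp_rw [hrw]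
  have hP := fun χ : DirichletCharacter ℂ q => integral_norm_sq_sum_div s
    (fun d => c d * χ (d : ZMod q) * ((d : ℝ) ^ (-σ) : ℝ)) (fun d => Real.log d) hT0
  refine ⟨fun χ => (hP χ).1, ?_⟩
  set A := ∑ χ : DirichletCharacter ℂ q, ∫ t : ℝ, ‖∑ d ∈ s,
    (c d * χ (d : ZMod q) * ((d : ℝ) ^ (-σ) : ℝ)) *
        Complex.exp (-(Real.log d * I) * t)‖ ^ 2 * (T ^ 2 + t ^ 2)⁻¹ with hA
  have hA0 : 0 ≤ A := Finset.sum_nonneg fun χ _ => integral_nonneg fun t => by positivity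
  have hAeq : (A : ℂ) = (Real.pi / T : ℝ) * ∑ d ∈ s, ∑ e ∈ s,
      (c d * (starRingEnd ℂ) (c e) * ((d : ℝ) ^ (-σ) : ℝ) * ((e : ℝ) ^ (-σ) : ℝ) *
      (Real.exp (-(T * |Real.log d - Real.log e|)) : ℝ)) *
      ∑ χ : DirichletCharacter ℂ q, χ (d : ZMod q) * (starRingEnd ℂ) (χ (e : ZMod q)) := by
    rw [hA, Complex.ofReal_sum]
    simp_rw [(hP _).2]
    rw [← Finset.mul_sum, Finset.sum_comm]
    congr 1
    refine Finset.sum_congr rfl fun d _ => ?_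
    rw [Finset.sum_comm]
    refine Finset.sum_congr rfl fun e _ => ?_
    rw [Finset.mul_sum]
    refine Finset.sum_congr rfl fun χ _ => ?_
    simp only [map_mul, Complex.conj_ofReal]
    ring
  set w : ℕ → ℕ → ℝ := fun d e => if d ≡ e [MOD q] then ArithmeticFunction.vonMangoldt d *
    ArithmeticFunction.vonMangoldt e * ((d : ℝ)⁻¹ * (e : ℝ)⁻¹) *
      Real.exp (-(T * |Real.log d - Real.log e|)) else 0 with hw
  have hw0 : ∀ d e, 0 ≤ w d e := by
    intro d e
    simp only [hw]
    have h1 : 0 ≤ ArithmeticFunction.vonMangoldt d := ArithmeticFunction.vonMangoldt_nonneg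
    have h2 : 0 ≤ ArithmeticFunction.vonMangoldt e := ArithmeticFunction.vonMangoldt_nonneg
    split_ifs <;> positivity
  have hwsym : ∀ d e, w d e = w e d := by
    intro d e
    simp only [hw, Nat.ModEq.comm (a := d) (b := e), abs_sub_comm (Real.log d)]
    split_ifs <;> ring
  have hrp : ∀ d ∈ s, (d : ℝ) ^ (-σ) ≤ (d : ℝ)⁻¹ := by
    intro d hd
    rw [← Real.rpow_neg_one]
    exact Real.rpow_le_rpow_of_exponent_le (by exact_mod_cast hs1 d hd) (by linarith)
  have hbound : A ≤ Real.pi / T * (κ ^ 2 * q.totient * ∑ d ∈ s, ∑ e ∈ s, w d e) := by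
    have : A = ‖(A : ℂ)‖ := by rw [Complex.norm_real, Real.norm_of_nonneg hA0]
    rw [this, hAeq, norm_mul, Complex.norm_real, Real.norm_of_nonneg (by positivity)]
    refine mul_le_mul_of_nonneg_left ?_ (by positivity)
    rw [Finset.mul_sum]
    refine (norm_sum_le _ _).trans (Finset.sum_le_sum fun d hd => ?_)
    rw [Finset.mul_sum]
    refine (norm_sum_le _ _).trans (Finset.sum_le_sum fun e he => ?_)
    rw [norm_mul]
    have hch := norm_sum_dirichletCharacter_mul_conj q d e
    by_cases hde : d ≡ e [MOD q]
    · rw [if_pos hde] at hch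
      simp only [hw, if_pos hde, norm_mul, RCLike.norm_conj, Complex.norm_real]
      rw [Real.norm_of_nonneg (by positivity : 0 ≤ (d : ℝ) ^ (-σ)),
        Real.norm_of_nonneg (by positivity : 0 ≤ (e : ℝ) ^ (-σ)), Real.norm_of_nonneg (Real.exp_pos _).le]
      calc ‖c d‖ * ‖c e‖ * (d : ℝ) ^ (-σ) * (e : ℝ) ^ (-σ) *
            Real.exp (-(T * |Real.log d - Real.log e|)) * _
          ≤ (κ * ArithmeticFunction.vonMangoldt d) * (κ * ArithmeticFunction.vonMangoldt e) *
            (d : ℝ)⁻¹ * (e : ℝ)⁻¹ *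
            Real.exp (-(T * |Real.log d - Real.log e|)) * q.totient := by
            have h1 : 0 ≤ ArithmeticFunction.vonMangoldt d := ArithmeticFunction.vonMangoldt_nonneg
            have h2 : 0 ≤ ArithmeticFunction.vonMangoldt e := ArithmeticFunction.vonMangoldt_nonneg
            gcongr
            · exact hc d (hs1 d hd)
            · exact hc e (hs1 e he)
            · exact hrp d hd
            · exact hrp e he
        _ = _ := by ring
    · rw [if_neg hde] at hch
      have : ‖∑ χ : DirichletCharacter ℂ q, χ (d : ZMod q) * (starRingEnd ℂ) (χ (e : ZMod q))‖ = 0 :=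
        le_antisymm hch (norm_nonneg _)
      rw [this]
      simp [hw, hde]
  have hinner : ∀ d ∈ s, ∑ e ∈ s.filter (fun e => e ≤ d), w d e ≤
      ArithmeticFunction.vonMangoldt d / d * (C / (T * q.totient)) := by
    intro d hd
    have hd0 : (0 : ℝ) < d := by exact_mod_cast hs1 d hd
    have hv : 0 ≤ ArithmeticFunction.vonMangoldt d := ArithmeticFunction.vonMangoldt_nonneg
    calc ∑ e ∈ s.filter (fun e => e ≤ d), w d e
        ≤ ∑ e ∈ (Finset.Ioc ⌊y⌋₊ ⌊(d : ℝ)⌋₊).filter (fun n => n ≡ d [MOD q]),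
          ArithmeticFunction.vonMangoldt d / d ^ 2 *
          (ArithmeticFunction.vonMangoldt e * ((e : ℝ) / d) ^ (T / 2)) := by
          have hsub : (Finset.Ioc ⌊y⌋₊ ⌊(d : ℝ)⌋₊).filter (fun n => n ≡ d [MOD q]) =
              (s.filter (fun e => e ≤ d)).filter (fun n => n ≡ d [MOD q]) := by
            rw [Nat.floor_natCast]
            congr 1
            ext e
            simp only [hs, Finset.mem_filter, Finset.mem_Ioc]
            have := (Finset.mem_Ioc.1 hd).2
            constructor
            · rintro ⟨h1, h2⟩; exact ⟨⟨h1, h2.trans this⟩, h2⟩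
            · rintro ⟨h1, h2⟩; exact ⟨h1.1, h2⟩
          rw [hsub, Finset.sum_filter (p := fun n => n ≡ d [MOD q])]
          refine Finset.sum_le_sum fun e he => ?_
          obtain ⟨hes, hed⟩ := Finset.mem_filter.1 he
          have he0 : (0 : ℝ) < e := by exact_mod_cast hs1 e hes
          have hed' : (e : ℝ) ≤ d := by exact_mod_cast hed
          simp only [hw]
          by_cases hm : d ≡ e [MOD q]
          · rw [if_pos hm, if_pos hm.symm]
            have hv' : 0 ≤ ArithmeticFunction.vonMangoldt e := ArithmeticFunction.vonMangoldt_nonneg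
            have hr : Real.exp (-(T * |Real.log d - Real.log e|)) ≤ (e : ℝ) / d * ((e : ℝ) / d) ^ (T / 2) := by
              rw [abs_of_nonneg (sub_nonneg.2 (Real.log_le_log he0 hed')),
                Real.rpow_def_of_pos (by positivity)]
              nth_rw 1 [← Real.exp_log (show 0 < (e : ℝ) / d by positivity)]
              rw [← Real.exp_add, Real.exp_le_exp, Real.log_div he0.ne' hd0.ne']
              have := Real.log_le_log he0 hed'
              nlinarith
            calc _ ≤ ArithmeticFunction.vonMangoldt d *
                  ArithmeticFunction.vonMangoldt e * ((d : ℝ)⁻¹ * (e : ℝ)⁻¹) *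
                    ((e : ℝ) / d * ((e : ℝ) / d) ^ (T / 2)) := by gcongr
              _ = _ := by field_simp
          · rw [if_neg hm, if_neg fun h => hm h.symm]
      _ = ArithmeticFunction.vonMangoldt d / d ^ 2 *
          ∑ e ∈ (Finset.Ioc ⌊y⌋₊ ⌊(d : ℝ)⌋₊).filter (fun n => n ≡ d [MOD q]),
          (ArithmeticFunction.vonMangoldt e * ((e : ℝ) / d) ^ (T / 2)) := by rw [Finset.mul_sum]
      _ ≤ ArithmeticFunction.vonMangoldt d / d ^ 2 * (C * (d / (T * q.totient))) :=
          mul_le_mul_of_nonneg_left (hW q d hq T y d (by linarith) hy hd0) (by positivity)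
      _ = _ := by field_simp
  calc A ≤ Real.pi / T * (κ ^ 2 * q.totient * ∑ d ∈ s, ∑ e ∈ s, w d e) := hbound
    _ ≤ Real.pi / T * (κ ^ 2 * q.totient * (2 * ∑ d ∈ s,
          ArithmeticFunction.vonMangoldt d / d * (C / (T * q.totient)))) := by
        have := (sum_sum_le_two_mul_sum_sum_filter_le s w hw0 hwsym).trans
          (mul_le_mul_of_nonneg_left (Finset.sum_le_sum hinner) zero_le_two)
        have := Real.pi_pos
        gcongr
    _ = _ := by
        rw [← Finset.sum_mul]
        field_simp

/-- The sum of `f` over the positive integers up to `u` in the residue class `b`. -/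
def resSum {q : ℕ} (f : ℕ → ℂ) (u : ℝ) (b : ZMod q) : ℂ :=
  ∑ n ∈ (Finset.Icc 1 ⌊u⌋₊).filter (fun n : ℕ => (n : ZMod q) = b), f n

/-- The sum over reduced residue classes of the absolute values of `resSum`. -/
def unitSum (f : ℕ → ℂ) (q : ℕ) [NeZero q] (u : ℝ) : ℝ :=
  ∑ b : (ZMod q)ˣ, ‖resSum f u (b : ZMod q)‖

theorem measurable_resSum {q : ℕ} (f : ℕ → ℂ) (b : ZMod q) :
    Measurable fun u : ℝ => resSum f u b :=
  (measurable_from_nat (f := fun N : ℕ =>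
    ∑ n ∈ (Finset.Icc 1 N).filter (fun n : ℕ => (n : ZMod q) = b), f n)).comp Nat.measurable_floor

theorem measurable_unitSum (f : ℕ → ℂ) (q : ℕ) [NeZero q] : Measurable (unitSum f q) :=
  Finset.measurable_sum _ fun b _ => (measurable_resSum f (b : ZMod q)).norm

theorem resSum_of_lt_one {q : ℕ} (f : ℕ → ℂ) {u : ℝ} (hu : u < 1) (b : ZMod q) :
    resSum f u b = 0 := by
  rw [resSum, Nat.floor_eq_zero.2 hu]
  simp

theorem unitSum_of_lt_one (f : ℕ → ℂ) (q : ℕ) [NeZero q] {u : ℝ} (hu : u < 1) :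
    unitSum f q u = 0 := by
  simp [unitSum, resSum_of_lt_one f hu]

theorem unitSum_nonneg (f : ℕ → ℂ) (q : ℕ) [NeZero q] (u : ℝ) : 0 ≤ unitSum f q u :=
  Finset.sum_nonneg fun _ _ => norm_nonneg _

theorem norm_resSum_le {q : ℕ} (f : ℕ → ℂ) {u x : ℝ} (h : u ≤ x) (b : ZMod q) :
    ‖resSum f u b‖ ≤ ∑ n ∈ Finset.Icc 1 ⌊x⌋₊, ‖f n‖ :=
  (norm_sum_le _ _).trans (Finset.sum_le_sum_of_subset_of_nonneg
    ((Finset.filter_subset _ _).trans (Finset.Icc_subset_Icc_right (Nat.floor_le_floor h)))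
    fun _ _ _ => norm_nonneg _)

theorem unitSum_le_sum (f : ℕ → ℂ) (q : ℕ) [NeZero q] {u x : ℝ} (h : u ≤ x) :
    unitSum f q u ≤ ∑ n ∈ Finset.Icc 1 ⌊x⌋₊, ‖f n‖ := by
  have h1 : unitSum f q u ≤ ∑ b : (ZMod q)ˣ, ∑ n ∈ Finset.Icc 1 ⌊x⌋₊,
      if (n : ZMod q) = b then ‖f n‖ else 0 := by
    refine Finset.sum_le_sum fun b _ => ?_
    rw [← Finset.sum_filter]
    exact (norm_sum_le _ _).trans (Finset.sum_le_sum_of_subset_of_nonneg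
      (Finset.filter_subset_filter _ (Finset.Icc_subset_Icc_right (Nat.floor_le_floor h)))
      fun _ _ _ => norm_nonneg _)
  rw [Finset.sum_comm] at h1
  refine h1.trans (Finset.sum_le_sum fun n _ => ?_)
  by_cases hn : IsUnit (n : ZMod q)
  · obtain ⟨b, hb⟩ := hn
    have : ∀ c : (ZMod q)ˣ, (n : ZMod q) = c ↔ c = b := fun c => by
      rw [← hb, Units.val_inj, eq_comm]
    simp [this]
  · have : ∀ c : (ZMod q)ˣ, (n : ZMod q) ≠ c := fun c h => hn (h ▸ c.isUnit)
    simp [this]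

theorem integrableOn_div_pow_of_bounded {g : ℝ → ℝ} (hg : Measurable g) {x K : ℝ}
    (h0 : ∀ v < 1, g v = 0) (hK : ∀ v ≤ x, |g v| ≤ K) (p : ℕ) :
    IntegrableOn (fun v => g v / v ^ p) (Set.Ioc 0 x) := by
  refine Measure.integrableOn_of_bounded (M := K) (by simp)
    (hg.div (measurable_id.pow_const p)).aestronglyMeasurable ?_
  filter_upwards [ae_restrict_mem measurableSet_Ioc] with v hv
  rcases lt_or_ge v 1 with h | h
  · rw [h0 v h]
    simpa using (abs_nonneg _).trans (hK v hv.2)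
  · rw [Real.norm_eq_abs, abs_div, abs_of_nonneg (by positivity : 0 ≤ v ^ p)]
    exact (div_le_self (abs_nonneg _) (one_le_pow₀ h)).trans (hK v hv.2)

theorem integrableOn_unitSum_div_pow (f : ℕ → ℂ) (q : ℕ) [NeZero q] (x : ℝ) (p : ℕ) :
    IntegrableOn (fun v => unitSum f q v / v ^ p) (Set.Ioc 0 x) :=
  integrableOn_div_pow_of_bounded (measurable_unitSum f q) (fun v hv => unitSum_of_lt_one f q hv)
    (K := ∑ n ∈ Finset.Icc 1 ⌊x⌋₊, ‖f n‖)
    (fun v hv => by rw [abs_of_nonneg (unitSum_nonneg f q v)]; exact unitSum_le_sum f q hv) p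

theorem integrableOn_norm_resSum_div_pow {q : ℕ} (f : ℕ → ℂ) (b : ZMod q) (x : ℝ) (p : ℕ) :
    IntegrableOn (fun v => ‖resSum f v b‖ / v ^ p) (Set.Ioc 0 x) :=
  integrableOn_div_pow_of_bounded (measurable_resSum f b).norm
    (fun v hv => by rw [resSum_of_lt_one f hv, norm_zero])
    (K := ∑ n ∈ Finset.Icc 1 ⌊x⌋₊, ‖f n‖)
    (fun v hv => by rw [abs_norm]; exact norm_resSum_le f hv b) p

theorem sum_vonMangoldt_short_le : ∃ C : ℝ, 0 < C ∧ ∀ (q : ℕ) [NeZero q] (b : ZMod q)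
    (T y u v : ℝ) (D : ℕ), 1 ≤ T → Real.exp 1 * ((q : ℝ) * T) ^ 4 ≤ y → 0 < u → 0 < v →
    ∑ d ∈ (Finset.Ioc ⌊y⌋₊ D).filter
        (fun d : ℕ => (d : ZMod q) = b ∧ u * Real.exp (-(1 / T)) / v < d ∧ d ≤ u / v),
      ArithmeticFunction.vonMangoldt d ≤ C * (u / (v * (T * q.totient))) := by
  obtain ⟨C, hC, hBT⟩ := sum_vonMangoldt_modEq_le
  refine ⟨C, hC, fun q _ b T y u v D hT hy hu hv => ?_⟩
  have hq : 1 ≤ q := Nat.one_le_iff_ne_zero.2 (NeZero.ne q)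
  have hT0 : 0 < T := by linarith
  have hφ : 0 < (q.totient : ℝ) := by exact_mod_cast Nat.totient_pos.2 hq
  have hq1 : (0 : ℝ) < q := by exact_mod_cast hq
  set s := (Finset.Ioc ⌊y⌋₊ D).filter
        (fun d : ℕ => (d : ZMod q) = b ∧ u * Real.exp (-(1 / T)) / v < d ∧ d ≤ u / v) with hs
  rcases s.eq_empty_or_nonempty with h | ⟨d₀, hd₀⟩
  · rw [h]
    simp only [Finset.sum_empty]
    positivity
  set V := u * Real.exp (-(1 / T)) / v with hV
  have hy0 : 0 < y := lt_of_lt_of_le (by positivity) hy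
  have hVe : V * Real.exp (1 / T) = u / v := by
    rw [hV, div_mul_eq_mul_div, mul_assoc, ← Real.exp_add]
    simp
  have hV0 : 0 < V := by positivity
  have hVu : V ≤ u / v := by
    rw [← hVe]
    exact le_mul_of_one_le_right hV0.le (Real.one_le_exp (by positivity))
  have hV4 : ((q : ℝ) * T) ^ 4 ≤ V := by
    rw [hs, Finset.mem_filter, Finset.mem_Ioc] at hd₀
    have h1 : y < d₀ := (Nat.floor_lt hy0.le).1 hd₀.1.1
    have h2 := hd₀.2.2.2
    rw [← hVe] at h2
    have h3 : Real.exp (1 / T) ≤ Real.exp 1 := Real.exp_le_exp.2 ((div_le_one hT0).2 hT)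
    have h4 : V * Real.exp (1 / T) ≤ V * Real.exp 1 := mul_le_mul_of_nonneg_left h3 hV0.le
    exact le_of_mul_le_mul_left (by linarith : Real.exp 1 * ((q : ℝ) * T) ^ 4 ≤ Real.exp 1 * V)
      (Real.exp_pos 1)
  calc ∑ d ∈ s, ArithmeticFunction.vonMangoldt d ≤ C * (V / (T * q.totient)) := by
        refine le_trans ?_ (hBT q b.val hq T V hT hV4)
        refine Finset.sum_le_sum_of_subset_of_nonneg (fun d hd => ?_)
          fun _ _ _ => ArithmeticFunction.vonMangoldt_nonneg
        rw [hs, Finset.mem_filter, Finset.mem_Ioc] at hd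
        obtain ⟨-, h1, h2, h3⟩ := hd
        rw [Finset.mem_filter, Finset.mem_Ioc]
        refine ⟨⟨(Nat.floor_lt hV0.le).2 h2, Nat.le_floor (by rw [hVe]; exact h3)⟩, ?_⟩
        rw [← ZMod.natCast_eq_natCast_iff, h1, ZMod.natCast_zmod_val]
    _ ≤ C * ((u / v) / (T * q.totient)) := by gcongr
    _ = _ := by rw [div_div]

theorem norm_resSum_le_add {q : ℕ} (f : ℕ → ℂ) {v z : ℝ} (h : v ≤ z) (b : ZMod q) :
    ‖resSum f z b‖ ≤ ‖resSum f v b‖ +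
      ∑ n ∈ (Finset.Ioc ⌊v⌋₊ ⌊z⌋₊).filter (fun n : ℕ => (n : ZMod q) = b), ‖f n‖ := by
  have hd : Finset.Icc 1 ⌊z⌋₊ = Finset.Icc 1 ⌊v⌋₊ ∪ Finset.Ioc ⌊v⌋₊ ⌊z⌋₊ := by
    ext n
    have := Nat.floor_le_floor h
    simp only [Finset.mem_union, Finset.mem_Icc, Finset.mem_Ioc]
    omega
  have hdis : Disjoint (Finset.Icc 1 ⌊v⌋₊) (Finset.Ioc ⌊v⌋₊ ⌊z⌋₊) := by
    rw [Finset.disjoint_left]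
    intro n
    simp only [Finset.mem_Icc, Finset.mem_Ioc]
    omega
  rw [resSum, hd, Finset.filter_union, Finset.sum_union (Finset.disjoint_filter_filter hdis)]
  exact (norm_add_le _ _).trans (add_le_add le_rfl (norm_sum_le _ _))

theorem ZMod.eq_mul_inv_iff_of_isUnit {q : ℕ} {d : ZMod q} (hd : IsUnit d) (a n : ZMod q) :
    n = a * d⁻¹ ↔ d * n = a := by
  have h := ZMod.mul_inv_of_unit d hd
  constructor
  · rintro rfl
    rw [mul_left_comm, h, mul_one]
  · rintro rfl
    rw [mul_comm d n, mul_assoc, h, mul_one]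

theorem norm_resSum_le_integral_add {q : ℕ} (f : ℕ → ℂ) (b : ZMod q) {T z : ℝ} (hT : 0 < T)
    (hz : 0 < z) :
    ‖resSum f z b‖ ≤ T * (∫ v in Set.Ioc (z * Real.exp (-(1 / T))) z, ‖resSum f v b‖ / v) +
      ∑ n ∈ (Finset.Ioc ⌊z * Real.exp (-(1 / T))⌋₊ ⌊z⌋₊).filter (fun n : ℕ => (n : ZMod q) = b),
        ‖f n‖ := by
  set w := z * Real.exp (-(1 / T)) with hw
  set G := ∑ n ∈ (Finset.Ioc ⌊w⌋₊ ⌊z⌋₊).filter (fun n : ℕ => (n : ZMod q) = b), ‖f n‖ with hG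
  have hw0 : 0 < w := by positivity
  have hwz : w ≤ z := by
    refine mul_le_of_le_one_right hz.le (Real.exp_le_one_iff.2 ?_)
    have : 0 < 1 / T := by positivity
    linarith
  have h1 : ∀ v ∈ Set.Ioc w z, (‖resSum f z b‖ - G) * v⁻¹ ≤ ‖resSum f v b‖ / v := by
    intro v hv
    have hv0 : 0 < v := hw0.trans hv.1
    rw [div_eq_mul_inv]
    refine mul_le_mul_of_nonneg_right ?_ (by positivity)
    have h2 := norm_resSum_le_add f hv.2 b
    have h3 : ∑ n ∈ (Finset.Ioc ⌊v⌋₊ ⌊z⌋₊).filter (fun n : ℕ => (n : ZMod q) = b), ‖f n‖ ≤ G :=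
      Finset.sum_le_sum_of_subset_of_nonneg (Finset.filter_subset_filter _
        (Finset.Ioc_subset_Ioc_left (Nat.floor_le_floor hv.1.le))) fun _ _ _ => norm_nonneg _
    linarith
  have hint : ∫ v in Set.Ioc w z, v⁻¹ = 1 / T := by
    rw [← intervalIntegral.integral_of_le hwz, integral_inv_of_pos hw0 hz, hw, div_mul_eq_div_div,
      div_self hz.ne', one_div, Real.log_inv, Real.log_exp, neg_neg]
  have hi1 : IntegrableOn (fun v : ℝ => v⁻¹) (Set.Ioc w z) := by
    rw [← intervalIntegrable_iff_integrableOn_Ioc_of_le hwz]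
    refine intervalIntegrable_inv_iff.2 (Or.inr ?_)
    rw [Set.uIcc_of_le hwz]
    exact fun h => absurd h.1 (not_le.2 hw0)
  have hi2 : IntegrableOn (fun v : ℝ => ‖resSum f v b‖ / v) (Set.Ioc w z) := by
    have := integrableOn_norm_resSum_div_pow f b z 1
    simp only [pow_one] at this
    exact this.mono_set (Set.Ioc_subset_Ioc_left hw0.le)
  have h4 : (‖resSum f z b‖ - G) * (1 / T) ≤ ∫ v in Set.Ioc w z, ‖resSum f v b‖ / v := by
    rw [← hint, ← integral_const_mul]
    exact setIntegral_mono_on (hi1.const_mul _) hi2 measurableSet_Ioc h1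
  have h5 : T * ((‖resSum f z b‖ - G) * (1 / T)) ≤ T * ∫ v in Set.Ioc w z, ‖resSum f v b‖ / v :=
    mul_le_mul_of_nonneg_left h4 hT.le
  have h6 : T * ((‖resSum f z b‖ - G) * (1 / T)) = ‖resSum f z b‖ - G := by field_simp
  linarith

theorem sum_vonMangoldt_mul_norm_resSum_le : ∃ C : ℝ, 0 < C ∧ ∀ (f : ℕ → ℂ) (q : ℕ) [NeZero q]
    (a : (ZMod q)ˣ) (T y u : ℝ) (D : ℕ), 1 ≤ T → Real.exp 1 * ((q : ℝ) * T) ^ 4 ≤ y → 1 ≤ u →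
    ∑ d ∈ (Finset.Ioc ⌊y⌋₊ D).filter (fun d : ℕ => IsUnit (d : ZMod q)),
      ArithmeticFunction.vonMangoldt d * ‖resSum f (u / d) ((a : ZMod q) * (d : ZMod q)⁻¹)‖ ≤
    C * (u / q.totient) * ((∫ v in Set.Ioc 0 u, unitSum f q v / v ^ 2) +
      1 / T * ∑ n ∈ Finset.Icc 1 ⌊u⌋₊, ‖f n‖ / n) := by
  obtain ⟨C, hC, hS⟩ := sum_vonMangoldt_short_le
  refine ⟨C, hC, fun f q _ a T y u D hT hy hu => ?_⟩
  have hT0 : 0 < T := by linarith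
  have hu0 : 0 < u := by linarith
  have hq : 1 ≤ q := Nat.one_le_iff_ne_zero.2 (NeZero.ne q)
  have hφ : 0 < (q.totient : ℝ) := by exact_mod_cast Nat.totient_pos.2 hq
  set s := (Finset.Ioc ⌊y⌋₊ D).filter (fun d : ℕ => IsUnit (d : ZMod q)) with hs
  have hs1 : ∀ d ∈ s, (1 : ℝ) ≤ d := fun d hd => by
    have := (Finset.mem_Ioc.1 (Finset.mem_filter.1 hd).1).1
    exact_mod_cast (by omega : 1 ≤ d)
  have hsu : ∀ d ∈ s, IsUnit (d : ZMod q) := fun d hd => (Finset.mem_filter.1 hd).2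
  set P : ℕ → ℝ → Prop := fun d v => u * Real.exp (-(1 / T)) / v < d ∧ d ≤ u / v with hP
  set h : ℕ → ℝ → ℝ := fun d v =>
    if P d v then ‖resSum f v ((a : ZMod q) * (d : ZMod q)⁻¹)‖ / v else 0 with hh
  set G : ℕ → ℝ := fun d => ∑ n ∈ Finset.Icc 1 ⌊u⌋₊,
    if (n : ZMod q) = (a : ZMod q) * (d : ZMod q)⁻¹ ∧ P d n then ‖f n‖ else 0 with hG
  have hPiff : ∀ d ∈ s, ∀ v : ℝ, 0 < v →
      (P d v ↔ v ∈ Set.Ioc (u / d * Real.exp (-(1 / T))) (u / d)) := by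
    intro d hd v hv
    have hd0 : (0 : ℝ) < d := by linarith [hs1 d hd]
    rw [Set.mem_Ioc, hP]
    simp only
    rw [div_lt_iff₀ hv, le_div_iff₀ hv, le_div_iff₀ hd0, div_mul_eq_mul_div, div_lt_iff₀ hd0,
      mul_comm v]
  have hhInt : ∀ d ∈ s, IntegrableOn (h d) (Set.Ioc 0 u) ∧
      ∫ v in Set.Ioc (u / d * Real.exp (-(1 / T))) (u / d),
        ‖resSum f v ((a : ZMod q) * (d : ZMod q)⁻¹)‖ / v = ∫ v in Set.Ioc 0 u, h d v := by
    intro d hd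
    have hd0 : (0 : ℝ) < d := by linarith [hs1 d hd]
    have hsub : Set.Ioc (u / d * Real.exp (-(1 / T))) (u / d) ⊆ Set.Ioc 0 u :=
      Set.Ioc_subset_Ioc (by positivity) (div_le_self hu0.le (hs1 d hd))
    have heq : Set.EqOn ((Set.Ioc (u / d * Real.exp (-(1 / T))) (u / d)).indicator
        (fun v => ‖resSum f v ((a : ZMod q) * (d : ZMod q)⁻¹)‖ / v)) (h d) (Set.Ioc 0 u) := by
      intro v hv
      simp only [hh, Set.indicator, hPiff d hd v hv.1]
    have hi : IntegrableOn (fun v => ‖resSum f v ((a : ZMod q) * (d : ZMod q)⁻¹)‖ / v)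
        (Set.Ioc 0 u) := by
      simpa only [pow_one] using integrableOn_norm_resSum_div_pow f ((a : ZMod q) * (d : ZMod q)⁻¹) u 1
    refine ⟨(hi.indicator measurableSet_Ioc).congr_fun heq measurableSet_Ioc, ?_⟩
    rw [← setIntegral_congr_fun measurableSet_Ioc heq, setIntegral_indicator measurableSet_Ioc,
      Set.inter_eq_right.2 hsub]
  have hstep : ∀ d ∈ s, ‖resSum f (u / d) ((a : ZMod q) * (d : ZMod q)⁻¹)‖ ≤
      T * (∫ v in Set.Ioc 0 u, h d v) + G d := by
    intro d hd
    have hd0 : (0 : ℝ) < d := by linarith [hs1 d hd]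
    have h1 := norm_resSum_le_integral_add f ((a : ZMod q) * (d : ZMod q)⁻¹) hT0
      (show 0 < u / d by positivity)
    rw [(hhInt d hd).2] at h1
    refine h1.trans (add_le_add le_rfl ?_)
    simp only [hG]
    rw [← Finset.sum_filter]
    refine Finset.sum_le_sum_of_subset_of_nonneg (fun n hn => ?_) fun _ _ _ => norm_nonneg _
    rw [Finset.mem_filter, Finset.mem_Ioc] at hn
    obtain ⟨⟨h2, h3⟩, h4⟩ := hn
    have hn0 : 0 < n := by omega
    have hn0' : (0 : ℝ) < n := by exact_mod_cast hn0
    have h5 : (n : ℝ) ≤ u / d := (Nat.le_floor_iff (by positivity)).1 h3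
    rw [Finset.mem_filter, Finset.mem_Icc]
    refine ⟨⟨hn0, Nat.le_floor (h5.trans (div_le_self hu0.le (hs1 d hd)))⟩, h4, ?_⟩
    rw [hPiff d hd n hn0']
    exact ⟨(Nat.floor_lt (by positivity)).1 h2, h5⟩
  have hV : ∀ d, 0 ≤ ArithmeticFunction.vonMangoldt d := fun d =>
    ArithmeticFunction.vonMangoldt_nonneg
  have hpt : ∀ v ∈ Set.Ioc 0 u, ∑ d ∈ s, ArithmeticFunction.vonMangoldt d * h d v ≤
      C * (u / (T * q.totient)) * (unitSum f q v / v ^ 2) := by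
    intro v hv
    have hv0 : 0 < v := hv.1
    calc ∑ d ∈ s, ArithmeticFunction.vonMangoldt d * h d v
        ≤ ∑ d ∈ s, ∑ b : (ZMod q)ˣ, ‖resSum f v (b : ZMod q)‖ / v *
          (if (d : ZMod q) = a * (b : ZMod q)⁻¹ ∧ P d v then
            ArithmeticFunction.vonMangoldt d else 0) := by
          refine Finset.sum_le_sum fun d hd => ?_
          obtain ⟨e, he⟩ := hsu d hd
          have hb := Finset.single_le_sum (f := fun b : (ZMod q)ˣ => ‖resSum f v (b : ZMod q)‖ / v *
            (if (d : ZMod q) = a * (b : ZMod q)⁻¹ ∧ P d v then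
              ArithmeticFunction.vonMangoldt d else 0)) (s := Finset.univ) (fun b _ => by
                have := hV d
                split_ifs <;> positivity) (Finset.mem_univ (a * e⁻¹))
          refine le_trans (le_of_eq ?_) hb
          have h1 : (d : ZMod q) = a * ((a * e⁻¹ : (ZMod q)ˣ) : ZMod q)⁻¹ := by
            rw [ZMod.inv_coe_unit, ← he, ← Units.val_mul]
            simp
          have h2 : ((a * e⁻¹ : (ZMod q)ˣ) : ZMod q) = a * (d : ZMod q)⁻¹ := by
            rw [← he, ZMod.inv_coe_unit, Units.val_mul]
          simp only [hh, ← h1, true_and]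
          rw [h2]
          split_ifs <;> ring
      _ = ∑ b : (ZMod q)ˣ, ‖resSum f v (b : ZMod q)‖ / v * ∑ d ∈ s,
          (if (d : ZMod q) = a * (b : ZMod q)⁻¹ ∧ P d v then
            ArithmeticFunction.vonMangoldt d else 0) := by
          rw [Finset.sum_comm]
          simp only [Finset.mul_sum]
      _ ≤ ∑ b : (ZMod q)ˣ, ‖resSum f v (b : ZMod q)‖ / v * (C * (u / (v * (T * q.totient)))) := by
          refine Finset.sum_le_sum fun b _ => mul_le_mul_of_nonneg_left ?_ (by positivity)
          refine le_trans ?_ (hS q (a * (b : ZMod q)⁻¹) T y u v D hT hy hu0 hv0)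
          rw [← Finset.sum_filter]
          exact Finset.sum_le_sum_of_subset_of_nonneg
            (Finset.filter_subset_filter _ (Finset.filter_subset _ _)) fun d _ _ => hV d
      _ = _ := by
          rw [← Finset.sum_mul, ← Finset.sum_div, unitSum]
          field_simp
  have hG2 : ∑ d ∈ s, ArithmeticFunction.vonMangoldt d * G d ≤
      C * (u / (T * q.totient)) * ∑ n ∈ Finset.Icc 1 ⌊u⌋₊, ‖f n‖ / n := by
    simp only [hG, Finset.mul_sum]
    rw [Finset.sum_comm]
    refine Finset.sum_le_sum fun n hn => ?_
    have hn0 : (0 : ℝ) < n := by exact_mod_cast (Finset.mem_Icc.1 hn).1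
    calc ∑ d ∈ s, ArithmeticFunction.vonMangoldt d *
          (if (n : ZMod q) = (a : ZMod q) * (d : ZMod q)⁻¹ ∧ P d n then ‖f n‖ else 0)
        ≤ ∑ d ∈ s, ‖f n‖ * (if (d : ZMod q) = (a : ZMod q) * (n : ZMod q)⁻¹ ∧ P d n then
          ArithmeticFunction.vonMangoldt d else 0) := by
          refine Finset.sum_le_sum fun d hd => ?_
          by_cases hc : (n : ZMod q) = (a : ZMod q) * (d : ZMod q)⁻¹ ∧ P d n
          · have h1 := (ZMod.eq_mul_inv_iff_of_isUnit (hsu d hd) _ _).1 hc.1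
            have hnu : IsUnit (n : ZMod q) := isUnit_of_mul_isUnit_right (h1 ▸ a.isUnit)
            have h2 : (d : ZMod q) = (a : ZMod q) * (n : ZMod q)⁻¹ :=
              (ZMod.eq_mul_inv_iff_of_isUnit hnu _ _).2 (by rw [mul_comm]; exact h1)
            rw [if_pos hc, if_pos ⟨h2, hc.2⟩, mul_comm]
          · rw [if_neg hc, mul_zero]
            have := hV d
            split_ifs <;> positivity
      _ = ‖f n‖ * ∑ d ∈ s, (if (d : ZMod q) = (a : ZMod q) * (n : ZMod q)⁻¹ ∧ P d n then
          ArithmeticFunction.vonMangoldt d else 0) := by rw [Finset.mul_sum]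
      _ ≤ ‖f n‖ * (C * (u / (n * (T * q.totient)))) := by
          refine mul_le_mul_of_nonneg_left ?_ (norm_nonneg _)
          refine le_trans ?_ (hS q (a * (n : ZMod q)⁻¹) T y u n D hT hy hu0 hn0)
          rw [← Finset.sum_filter]
          exact Finset.sum_le_sum_of_subset_of_nonneg
            (Finset.filter_subset_filter _ (Finset.filter_subset _ _)) fun d _ _ => hV d
      _ = _ := by field_simp
  have hJint := integrableOn_unitSum_div_pow f q u 2
  have hI : ∑ d ∈ s, ArithmeticFunction.vonMangoldt d * ∫ v in Set.Ioc 0 u, h d v ≤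
      C * (u / (T * q.totient)) * ∫ v in Set.Ioc 0 u, unitSum f q v / v ^ 2 := by
    simp_rw [← integral_const_mul]
    rw [← integral_finsetSum _ fun d hd => (hhInt d hd).1.const_mul _]
    exact setIntegral_mono_on (integrable_finsetSum _ fun d hd => (hhInt d hd).1.const_mul _)
      (hJint.const_mul _) measurableSet_Ioc hpt
  calc _ ≤ ∑ d ∈ s, ArithmeticFunction.vonMangoldt d * (T * (∫ v in Set.Ioc 0 u, h d v) + G d) :=
        Finset.sum_le_sum fun d hd => mul_le_mul_of_nonneg_left (hstep d hd) (hV d)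
    _ = T * ∑ d ∈ s, ArithmeticFunction.vonMangoldt d * (∫ v in Set.Ioc 0 u, h d v) +
        ∑ d ∈ s, ArithmeticFunction.vonMangoldt d * G d := by
        rw [Finset.mul_sum, ← Finset.sum_add_distrib]
        exact Finset.sum_congr rfl fun d _ => by ring
    _ ≤ T * (C * (u / (T * q.totient)) * ∫ v in Set.Ioc 0 u, unitSum f q v / v ^ 2) +
        C * (u / (T * q.totient)) * ∑ n ∈ Finset.Icc 1 ⌊u⌋₊, ‖f n‖ / n :=
        add_le_add (mul_le_mul_of_nonneg_left hI hT0.le) hG2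
    _ = _ := by field_simp

/-- The part of the convolution of `Λf` and `f` in which the first variable lies in `(y, D]`. -/
def convSum {q : ℕ} (f Λf : ℕ → ℂ) (y : ℝ) (D : ℕ) (u : ℝ) (a : ZMod q) : ℂ :=
  ∑ d ∈ (Finset.Ioc ⌊y⌋₊ D).filter (fun d : ℕ => IsUnit (d : ZMod q)),
    Λf d * resSum f (u / d) (a * (d : ZMod q)⁻¹)

theorem measurable_convSum {q : ℕ} (f Λf : ℕ → ℂ) (y : ℝ) (D : ℕ) (a : ZMod q) :
    Measurable fun u : ℝ => convSum f Λf y D u a :=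
  Finset.measurable_sum _ fun d _ =>
    ((measurable_resSum f _).comp (measurable_id.div_const (d : ℝ))).const_mul _

theorem sum_mul_log_div_eq_integral {q : ℕ} (f : ℕ → ℂ) (a : ZMod q) {u : ℝ} (hu : 0 < u) :
    ∑ n ∈ (Finset.Icc 1 ⌊u⌋₊).filter (fun n : ℕ => (n : ZMod q) = a), f n * (Real.log (u / n) : ℝ) =
      ∫ v in Set.Ioc 0 u, resSum f v a * ((v⁻¹ : ℝ) : ℂ) := by
  set s := (Finset.Icc 1 ⌊u⌋₊).filter (fun n : ℕ => (n : ZMod q) = a) with hs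
  have hmem : ∀ n ∈ s, (0 : ℝ) < n ∧ (n : ℝ) ≤ u := by
    intro n hn
    rw [hs, Finset.mem_filter, Finset.mem_Icc] at hn
    exact ⟨by exact_mod_cast hn.1.1, (Nat.le_floor_iff hu.le).1 hn.1.2⟩
  have h1 : Set.EqOn (fun v => resSum f v a * ((v⁻¹ : ℝ) : ℂ))
      (fun v => ∑ n ∈ s, f n * ((Set.Ici (n : ℝ)).indicator (fun v : ℝ => v⁻¹) v : ℝ)) (Set.Ioc 0 u) := by
    intro v hv
    have hsub : (Finset.Icc 1 ⌊v⌋₊).filter (fun n : ℕ => (n : ZMod q) = a) =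
        s.filter (fun n : ℕ => (n : ℝ) ≤ v) := by
      ext n
      have h3 : n ≤ ⌊v⌋₊ ↔ (n : ℝ) ≤ v := Nat.le_floor_iff hv.1.le
      have h4 := Nat.floor_le_floor hv.2
      simp only [hs, Finset.mem_filter, Finset.mem_Icc]
      rw [← h3]
      constructor
      · rintro ⟨⟨h5, h6⟩, h7⟩
        exact ⟨⟨⟨h5, h6.trans h4⟩, h7⟩, h6⟩
      · rintro ⟨⟨⟨h5, h6⟩, h7⟩, h8⟩
        exact ⟨⟨h5, h8⟩, h7⟩
    simp only [resSum, hsub, Finset.sum_mul, Finset.sum_filter, Set.indicator, Set.mem_Ici]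
    refine Finset.sum_congr rfl fun n _ => ?_
    split_ifs <;> simp
  have h2 : ∀ n ∈ s, IntegrableOn ((Set.Ici (n : ℝ)).indicator (fun v : ℝ => v⁻¹)) (Set.Ioc 0 u) ∧
      ∫ v in Set.Ioc 0 u, (Set.Ici (n : ℝ)).indicator (fun v : ℝ => v⁻¹) v = Real.log (u / n) := by
    intro n hn
    obtain ⟨h3, h4⟩ := hmem n hn
    have hset : Set.Ioc 0 u ∩ Set.Ici (n : ℝ) = Set.Icc (n : ℝ) u := by
      ext v
      simp only [Set.mem_inter_iff, Set.mem_Ioc, Set.mem_Ici, Set.mem_Icc]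
      constructor
      · rintro ⟨⟨_, h⟩, h'⟩; exact ⟨h', h⟩
      · rintro ⟨h, h'⟩; exact ⟨⟨h3.trans_le h, h'⟩, h⟩
    have hi : IntegrableOn (fun v : ℝ => v⁻¹) (Set.Icc (n : ℝ) u) := by
      rw [integrableOn_Icc_iff_integrableOn_Ioc, ← intervalIntegrable_iff_integrableOn_Ioc_of_le h4]
      refine intervalIntegrable_inv_iff.2 (Or.inr ?_)
      rw [Set.uIcc_of_le h4]
      exact fun h => absurd h.1 (not_le.2 h3)
    constructor
    · rw [IntegrableOn, integrable_indicator_iff measurableSet_Ici, IntegrableOn,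
        Measure.restrict_restrict measurableSet_Ici, Set.inter_comm, hset]
      exact hi
    · rw [setIntegral_indicator measurableSet_Ici, hset, integral_Icc_eq_integral_Ioc,
        ← intervalIntegral.integral_of_le h4, integral_inv_of_pos h3 hu]
  rw [setIntegral_congr_fun measurableSet_Ioc h1,
    integral_finsetSum _ fun n hn => ((h2 n hn).1.ofReal).const_mul _]
  refine Finset.sum_congr rfl fun n hn => ?_
  rw [integral_const_mul, integral_complex_ofReal, (h2 n hn).2]

theorem IsHalaszClass.sum_mul_log_eq {κ : ℝ} {f Λf : ℕ → ℂ} (h : IsHalaszClass κ f Λf) {q : ℕ}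
    {a : ZMod q} (ha : IsUnit a) {u : ℝ} (hu : 0 < u) {E : Finset ℕ} (hE0 : 0 ∉ E)
    (hE : Finset.Icc 1 ⌊u⌋₊ ⊆ E) :
    ∑ n ∈ (Finset.Icc 1 ⌊u⌋₊).filter (fun n : ℕ => (n : ZMod q) = a), f n * (Real.log n : ℂ) =
      ∑ d ∈ E.filter (fun d : ℕ => IsUnit (d : ZMod q)),
        Λf d * resSum f (u / d) (a * (d : ZMod q)⁻¹) := by
  have h1 : ∑ n ∈ (Finset.Icc 1 ⌊u⌋₊).filter (fun n : ℕ => (n : ZMod q) = a),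
      f n * (Real.log n : ℂ) = ∑ n ∈ (Finset.Icc 1 ⌊u⌋₊).filter (fun n : ℕ => (n : ZMod q) = a),
      ∑ p ∈ n.divisorsAntidiagonal, Λf p.1 * f p.2 := by
    refine Finset.sum_congr rfl fun n hn => ?_
    rw [h.conv n (Finset.mem_Icc.1 (Finset.mem_filter.1 hn).1).1,
      Nat.sum_divisorsAntidiagonal fun i j => Λf i * f j]
  rw [h1]
  simp only [resSum, Finset.mul_sum]
  rw [Finset.sum_sigma', Finset.sum_sigma']
  refine Finset.sum_nbij' (fun p => ⟨p.2.1, p.2.2⟩) (fun p => ⟨p.1 * p.2, (p.1, p.2)⟩) ?_ ?_ ?_ ?_ ?_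
  · rintro ⟨n, d, m⟩ hp
    simp only [Finset.mem_sigma, Finset.mem_filter, Finset.mem_Icc,
      Nat.mem_divisorsAntidiagonal] at hp ⊢
    obtain ⟨⟨⟨h1, h2⟩, h3⟩, h4, h5⟩ := hp
    have hd : 0 < d := Nat.pos_of_ne_zero fun h => h5 (by rw [← h4, h, zero_mul])
    have hm : 0 < m := Nat.pos_of_ne_zero fun h => h5 (by rw [← h4, h, mul_zero])
    have h6 : (d : ZMod q) * m = a := by rw [← h3, ← h4]; push_cast; rfl
    have hdu : IsUnit (d : ZMod q) := isUnit_of_mul_isUnit_left (h6 ▸ ha)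
    have hdn : d ≤ n := h4 ▸ Nat.le_mul_of_pos_right d hm
    refine ⟨⟨hE (Finset.mem_Icc.2 ⟨hd, hdn.trans h2⟩), hdu⟩, ⟨hm, Nat.le_floor ?_⟩,
      (ZMod.eq_mul_inv_iff_of_isUnit hdu _ _).2 h6⟩
    rw [le_div_iff₀ (by exact_mod_cast hd)]
    have : (n : ℝ) ≤ u := (Nat.le_floor_iff hu.le).1 h2
    rw [← h4] at this
    push_cast at this
    linarith
  · rintro ⟨d, m⟩ hp
    simp only [Finset.mem_sigma, Finset.mem_filter, Finset.mem_Icc,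
      Nat.mem_divisorsAntidiagonal] at hp ⊢
    obtain ⟨⟨h1, h2⟩, ⟨h3, h4⟩, h5⟩ := hp
    have hd : 0 < d := Nat.pos_of_ne_zero fun h => hE0 (h ▸ h1)
    have hdm : 0 < d * m := Nat.mul_pos hd h3
    have h6 := (ZMod.eq_mul_inv_iff_of_isUnit h2 _ _).1 h5
    have h7 : (m : ℝ) ≤ u / d := (Nat.le_floor_iff (by positivity)).1 h4
    rw [le_div_iff₀ (by exact_mod_cast hd)] at h7
    refine ⟨⟨⟨hdm, Nat.le_floor ?_⟩, ?_⟩, ?_, hdm.ne'⟩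
    · push_cast; linarith
    · push_cast; exact h6
    · trivial
  · rintro ⟨n, d, m⟩ hp
    simp only [Finset.mem_sigma, Nat.mem_divisorsAntidiagonal] at hp
    obtain ⟨-, h4, -⟩ := hp
    subst h4
    rfl
  · rintro ⟨d, m⟩ _
    rfl
  · rintro ⟨n, d, m⟩ _
    rfl

theorem IsHalaszClass.log_mul_norm_resSum_le {κ : ℝ} {f Λf : ℕ → ℂ} (h : IsHalaszClass κ f Λf)
    {q : ℕ} {a : ZMod q} (ha : IsUnit a) {u : ℝ} (hu : 1 ≤ u) (y : ℝ) {D : ℕ} (hD : ⌊u⌋₊ ≤ D) :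
    Real.log u * ‖resSum f u a‖ ≤ ‖convSum f Λf y D u a‖ +
      κ * ∑ d ∈ (Finset.Icc 1 ⌊y⌋₊).filter (fun d : ℕ => IsUnit (d : ZMod q)),
        ArithmeticFunction.vonMangoldt d * ‖resSum f (u / d) (a * (d : ZMod q)⁻¹)‖ +
      ∫ v in Set.Ioc 0 u, ‖resSum f v a‖ / v := by
  have hu0 : 0 < u := by linarith
  have hdis : Disjoint (Finset.Icc 1 ⌊y⌋₊) (Finset.Ioc ⌊y⌋₊ D) := by
    rw [Finset.disjoint_left]
    intro n
    simp only [Finset.mem_Icc, Finset.mem_Ioc]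
    omega
  have hsum := h.sum_mul_log_eq ha hu0 (E := Finset.Icc 1 ⌊y⌋₊ ∪ Finset.Ioc ⌊y⌋₊ D) (by simp) (by
    intro n
    simp only [Finset.mem_union, Finset.mem_Icc, Finset.mem_Ioc]
    omega)
  rw [Finset.filter_union, Finset.sum_union (Finset.disjoint_filter_filter hdis)] at hsum
  have hW := sum_mul_log_div_eq_integral f a hu0
  have hkey : (Real.log u : ℂ) * resSum f u a =
      ∑ n ∈ (Finset.Icc 1 ⌊u⌋₊).filter (fun n : ℕ => (n : ZMod q) = a), f n * (Real.log n : ℂ) +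
      ∑ n ∈ (Finset.Icc 1 ⌊u⌋₊).filter (fun n : ℕ => (n : ZMod q) = a),
        f n * (Real.log (u / n) : ℝ) := by
    rw [← Finset.sum_add_distrib, resSum, Finset.mul_sum]
    refine Finset.sum_congr rfl fun n hn => ?_
    have hn0 : (n : ℝ) ≠ 0 := by
      have := (Finset.mem_Icc.1 (Finset.mem_filter.1 hn).1).1
      exact_mod_cast (by omega : n ≠ 0)
    rw [Real.log_div hu0.ne' hn0]
    push_cast
    ring
  have hnorm : Real.log u * ‖resSum f u a‖ = ‖(Real.log u : ℂ) * resSum f u a‖ := by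
    rw [norm_mul, Complex.norm_real, Real.norm_of_nonneg (Real.log_nonneg hu)]
  rw [hnorm, hkey, hsum, hW]
  refine (norm_add_le _ _).trans (add_le_add ((norm_add_le _ _).trans ?_) ?_)
  · rw [add_comm]
    refine add_le_add le_rfl ((norm_sum_le _ _).trans ?_)
    rw [Finset.mul_sum]
    refine Finset.sum_le_sum fun d hd => ?_
    rw [norm_mul, ← mul_assoc]
    exact mul_le_mul_of_nonneg_right
      (h.bound d (Finset.mem_Icc.1 (Finset.mem_filter.1 hd).1).1) (norm_nonneg _)
  · refine (norm_integral_le_integral_norm _).trans (le_of_eq ?_)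
    refine setIntegral_congr_fun measurableSet_Ioc fun v hv => ?_
    rw [norm_mul, Complex.norm_real, Real.norm_of_nonneg (inv_nonneg.2 hv.1.le), div_eq_mul_inv]

theorem sq_sum_norm_le_sum_norm_sq_character (q : ℕ) [NeZero q] (N : (ZMod q)ˣ → ℂ) :
    (∑ a, ‖N a‖) ^ 2 ≤
      ∑ χ : DirichletCharacter ℂ q, ‖∑ a : (ZMod q)ˣ, χ (a : ZMod q) * N a‖ ^ 2 := by
  have hch : ∀ a b : (ZMod q)ˣ, ∑ χ : DirichletCharacter ℂ q,
      χ (a : ZMod q) * (starRingEnd ℂ) (χ (b : ZMod q)) = if b = a then (q.totient : ℂ) else 0 := by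
    intro a b
    have h := DirichletCharacter.sum_char_inv_mul_char_eq ℂ b.isUnit (a : ZMod q)
    simp only [Units.val_inj] at h
    rw [← h]
    refine Finset.sum_congr rfl fun χ _ => ?_
    have : (starRingEnd ℂ) (χ (b : ZMod q)) = χ⁻¹ (b : ZMod q) := MulChar.star_apply' χ _
    rw [this, MulChar.inv_apply, mul_comm, Ring.inverse_unit, ZMod.inv_coe_unit]
  have heq : ∑ χ : DirichletCharacter ℂ q, ‖∑ a : (ZMod q)ˣ, χ (a : ZMod q) * N a‖ ^ 2 =
      q.totient * ∑ a, ‖N a‖ ^ 2 := by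
    apply Complex.ofReal_injective
    rw [Complex.ofReal_sum]
    simp_rw [ofReal_norm_sq_sum]
    rw [Finset.sum_comm, Complex.ofReal_mul, Complex.ofReal_sum, Finset.mul_sum]
    refine Finset.sum_congr rfl fun a _ => ?_
    rw [Finset.sum_comm]
    have : ∀ b : (ZMod q)ˣ, ∑ χ : DirichletCharacter ℂ q, χ (a : ZMod q) * N a *
        (starRingEnd ℂ) (χ (b : ZMod q) * N b) =
        if b = a then (q.totient : ℂ) * (N a * (starRingEnd ℂ) (N b)) else 0 := by
      intro b
      rw [← mul_one (N a * (starRingEnd ℂ) (N b)), ← ite_zero_mul, ← hch a b, Finset.sum_mul]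
      refine Finset.sum_congr rfl fun χ _ => ?_
      rw [map_mul]
      ring
    simp only [this, Finset.sum_ite_eq', Finset.mem_univ, if_true]
    rw [Complex.mul_conj, Complex.normSq_eq_norm_sq]
    push_cast
    rfl
  rw [heq, ← ZMod.card_units_eq_totient q, ← Finset.card_univ]
  exact sq_sum_le_card_mul_sum_sq

theorem sum_character_mul_convSum {q : ℕ} [NeZero q] (f Λf : ℕ → ℂ) (χ : DirichletCharacter ℂ q)
    (y : ℝ) (D : ℕ) {u : ℝ} (hu : 0 < u) {K : ℕ} (hK : ⌊u⌋₊ ≤ K) :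
    ∑ p ∈ Finset.Icc 1 K ×ˢ Finset.Ioc ⌊y⌋₊ D with ((p.1 * p.2 : ℕ) : ℝ) ≤ u,
      f p.1 * χ (p.1 : ZMod q) * (Λf p.2 * χ (p.2 : ZMod q)) =
    ∑ a : (ZMod q)ˣ, χ (a : ZMod q) * convSum f Λf y D u (a : ZMod q) := by
  have hR : ∑ a : (ZMod q)ˣ, χ (a : ZMod q) * convSum f Λf y D u (a : ZMod q) =
      ∑ d ∈ (Finset.Ioc ⌊y⌋₊ D).filter (fun d : ℕ => IsUnit (d : ZMod q)),
        ∑ m ∈ Finset.Icc 1 ⌊u / d⌋₊, ∑ a : (ZMod q)ˣ,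
          if (m : ZMod q) = a * (d : ZMod q)⁻¹ then χ (a : ZMod q) * (Λf d * f m) else 0 := by
    simp only [convSum, resSum, Finset.sum_filter, Finset.mul_sum]
    rw [Finset.sum_comm]
    refine Finset.sum_congr rfl fun d _ => ?_
    by_cases hd : IsUnit (d : ZMod q)
    · simp only [if_pos hd, Finset.mul_sum]
      rw [Finset.sum_comm]
      refine Finset.sum_congr rfl fun m _ => Finset.sum_congr rfl fun a _ => ?_
      split_ifs <;> simp
    · simp [hd]
  rw [hR, Finset.sum_filter, Finset.sum_product_right, Finset.sum_filter]
  refine Finset.sum_congr rfl fun d hd => ?_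
  have hd1 : 0 < d := by
    have := (Finset.mem_Ioc.1 hd).1
    omega
  have hd0 : (0 : ℝ) < d := by exact_mod_cast hd1
  by_cases hdu : IsUnit (d : ZMod q)
  · rw [if_pos hdu, ← Finset.sum_filter]
    have hset : (Finset.Icc 1 K).filter (fun m : ℕ => ((m * d : ℕ) : ℝ) ≤ u) =
        Finset.Icc 1 ⌊u / d⌋₊ := by
      ext m
      rw [Finset.mem_filter, Finset.mem_Icc, Finset.mem_Icc, Nat.le_floor_iff (by positivity),
        le_div_iff₀ hd0]
      push_cast
      constructor
      · rintro ⟨⟨h1, _⟩, h2⟩; exact ⟨h1, h2⟩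
      · rintro ⟨h1, h2⟩
        refine ⟨⟨h1, le_trans (Nat.le_floor ?_) hK⟩, h2⟩
        have : (1 : ℝ) ≤ d := by exact_mod_cast hd1
        exact (le_mul_of_one_le_right (by positivity) this).trans h2
    rw [hset]
    refine Finset.sum_congr rfl fun m _ => ?_
    by_cases hmu : IsUnit (m : ZMod q)
    · obtain ⟨e, he⟩ := hdu
      obtain ⟨m', hm'⟩ := hmu
      have : ∀ a : (ZMod q)ˣ, (m : ZMod q) = a * (d : ZMod q)⁻¹ ↔ a = e * m' := by
        intro a
        rw [ZMod.eq_mul_inv_iff_of_isUnit (he ▸ e.isUnit), ← he, ← hm', ← Units.val_mul, Units.val_inj,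
          eq_comm]
      simp only [this, Finset.sum_ite_eq', Finset.mem_univ, if_true, Units.val_mul, map_mul, he, hm']
      ring
    · have h1 : ∀ a : (ZMod q)ˣ, (m : ZMod q) ≠ a * (d : ZMod q)⁻¹ := by
        intro a ha
        have := (ZMod.eq_mul_inv_iff_of_isUnit hdu _ _).1 ha
        exact hmu (isUnit_of_mul_isUnit_right (this ▸ a.isUnit))
      simp [h1, χ.map_nonunit hmu]
  · rw [if_neg hdu]
    simp [χ.map_nonunit hdu]

theorem convSum_congr_of_floor_le {q : ℕ} (f Λf : ℕ → ℂ) (y : ℝ) {D D' : ℕ} {u : ℝ}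
    (hD : ⌊u⌋₊ ≤ D) (hD' : D ≤ D') (a : ZMod q) :
    convSum f Λf y D' u a = convSum f Λf y D u a := by
  symm
  refine Finset.sum_subset (Finset.filter_subset_filter _ (Finset.Ioc_subset_Ioc_right hD'))
    fun d hd hd' => ?_
  rw [Finset.mem_filter, Finset.mem_Ioc] at hd hd'
  have h1 : D < d := by
    by_contra h
    exact hd' ⟨⟨hd.1.1, not_lt.1 h⟩, hd.2⟩
  have hd0 : (0 : ℝ) < d := by exact_mod_cast (by omega : 0 < d)
  rw [resSum_of_lt_one, mul_zero]
  rw [div_lt_one hd0]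
  exact (Nat.floor_lt' (by omega)).1 (by omega)

theorem convSum_of_lt_one {q : ℕ} (f Λf : ℕ → ℂ) (y : ℝ) (D : ℕ) {u : ℝ} (hu : u < 1) (a : ZMod q) :
    convSum f Λf y D u a = 0 := by
  refine Finset.sum_eq_zero fun d hd => ?_
  have hd1 : (1 : ℝ) ≤ d := by
    have := (Finset.mem_Ioc.1 (Finset.mem_filter.1 hd).1).1
    exact_mod_cast (by omega : 1 ≤ d)
  rw [resSum_of_lt_one, mul_zero]
  rw [div_lt_one (by linarith)]
  linarith

theorem norm_convSum_le {q : ℕ} (f Λf : ℕ → ℂ) (y : ℝ) (D : ℕ) {u x : ℝ} (hu : u ≤ x) (a : ZMod q) :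
    ‖convSum f Λf y D u a‖ ≤
      ∑ d ∈ Finset.Ioc ⌊y⌋₊ D, ‖Λf d‖ * ∑ n ∈ Finset.Icc 1 ⌊x⌋₊, ‖f n‖ := by
  rcases lt_or_ge u 1 with h | h
  · rw [convSum_of_lt_one f Λf y D h, norm_zero]
    positivity
  refine (norm_sum_le _ _).trans ((Finset.sum_le_sum fun d hd => ?_).trans
    (Finset.sum_le_sum_of_subset_of_nonneg (Finset.filter_subset _ _) fun _ _ _ => by positivity))
  have hd1 : (1 : ℝ) ≤ d := by
    have := (Finset.mem_Ioc.1 (Finset.mem_filter.1 hd).1).1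
    exact_mod_cast (by omega : 1 ≤ d)
  rw [norm_mul]
  exact mul_le_mul_of_nonneg_left (norm_resSum_le f
    ((div_le_self (by linarith) hd1).trans hu) _) (norm_nonneg _)

/-- The sum over reduced residue classes of the absolute values of `convSum`. -/
def unitConvSum (f Λf : ℕ → ℂ) (q : ℕ) [NeZero q] (y : ℝ) (D : ℕ) (u : ℝ) : ℝ :=
  ∑ a : (ZMod q)ˣ, ‖convSum f Λf y D u (a : ZMod q)‖

theorem measurable_unitConvSum (f Λf : ℕ → ℂ) (q : ℕ) [NeZero q] (y : ℝ) (D : ℕ) :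
    Measurable (unitConvSum f Λf q y D) :=
  Finset.measurable_sum _ fun a _ => (measurable_convSum f Λf y D (a : ZMod q)).norm

theorem unitConvSum_nonneg (f Λf : ℕ → ℂ) (q : ℕ) [NeZero q] (y : ℝ) (D : ℕ) (u : ℝ) :
    0 ≤ unitConvSum f Λf q y D u := Finset.sum_nonneg fun _ _ => norm_nonneg _

theorem integrableOn_unitConvSum_div_sq (f Λf : ℕ → ℂ) (q : ℕ) [NeZero q] (y : ℝ) (D : ℕ) (x : ℝ) :
    IntegrableOn (fun u => unitConvSum f Λf q y D u / u ^ 2) (Set.Ioc 0 x) := by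
  refine integrableOn_div_pow_of_bounded (measurable_unitConvSum f Λf q y D)
    (fun v hv => by simp [unitConvSum, convSum_of_lt_one f Λf y D hv])
    (K := ∑ _a : (ZMod q)ˣ, ∑ d ∈ Finset.Ioc ⌊y⌋₊ D, ‖Λf d‖ * ∑ n ∈ Finset.Icc 1 ⌊x⌋₊, ‖f n‖)
    (fun v hv => ?_) 2
  rw [abs_of_nonneg (unitConvSum_nonneg f Λf q y D v)]
  exact Finset.sum_le_sum fun a _ => norm_convSum_le f Λf y D hv _

theorem integrableOn_unitConvSum_div_sq_mul_log (f Λf : ℕ → ℂ) (q : ℕ) [NeZero q] (y : ℝ) (D : ℕ)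
    {Y : ℝ} (hY : Real.exp 1 ≤ Y) (x : ℝ) :
    IntegrableOn (fun u => unitConvSum f Λf q y D u / (u ^ 2 * Real.log u)) (Set.Ioc Y x) := by
  have hY0 : 0 < Y := (Real.exp_pos 1).trans_le hY
  refine Integrable.mono' ((integrableOn_unitConvSum_div_sq f Λf q y D x).mono_set
    (Set.Ioc_subset_Ioc_left hY0.le)) (((measurable_unitConvSum f Λf q y D).div
      ((measurable_id.pow_const 2).mul Real.measurable_log)).aestronglyMeasurable) ?_
  filter_upwards [ae_restrict_mem measurableSet_Ioc] with u hu
  have hu0 : 0 < u := hY0.trans hu.1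
  have hl : 1 ≤ Real.log u := by
    rw [Real.le_log_iff_exp_le hu0]
    exact hY.trans hu.1.le
  have h0 := unitConvSum_nonneg f Λf q y D u
  rw [Real.norm_of_nonneg (by positivity)]
  exact div_le_div_of_nonneg_left h0 (by positivity) (le_mul_of_one_le_right (by positivity) hl)

theorem exists_integral_norm_sq_character_convSum_le {κ : ℝ} (hκ : 0 < κ) : ∃ C L₀ : ℝ, 1 ≤ C ∧
    1 ≤ L₀ ∧ ∀ f Λf, IsHalaszClass κ f Λf → ∀ (q : ℕ) [NeZero q] (L Q y α : ℝ) (D : ℕ), L₀ ≤ L →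
    (∀ (χ : DirichletCharacter ℂ q) (t : ℝ), |t| ≤ L ^ κ →
      ‖FserChi f χ ((1 + 1 / L : ℝ) + t * I) / ((1 + 1 / L : ℝ) + t * I)‖ ≤ Q) →
    Real.exp 1 * ((q : ℝ) * L ^ κ) ^ 4 ≤ y → 1 / L ≤ α → α ≤ 1 → 0 < Q ∧
    ∃ B : ℝ → ℝ, IntegrableOn (fun u => B u * u ^ (-2 * (1 + α) - 1)) (Set.Ioi 1) ∧
      (∀ u, 0 ≤ B u) ∧
      (∀ u, 0 < u → ⌊u⌋₊ ≤ D → unitConvSum f Λf q y D u ^ 2 ≤ B u) ∧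
      ∫ u in Set.Ioi 1, B u * u ^ (-2 * (1 + α) - 1) ≤ C * (min Q ((1 / α) ^ κ)) ^ 2 *
        ∑ d ∈ Finset.Ioc ⌊y⌋₊ D, ArithmeticFunction.vonMangoldt d / d := by
  obtain ⟨C₁, L₁, hC₁, hL₁, hF⟩ := exists_partial_FserChi_le hκ
  obtain ⟨C₂, hC₂, hA⟩ := sum_integral_norm_sq_character_sum_le
  refine ⟨C₁ * C₂ * κ ^ 2 + 1, max L₁ (2 ^ (1 / κ)), ?_, le_max_of_le_left hL₁,
    fun f Λf h q _ L Q y α D hL hQ hy hα hα1 => ?_⟩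
  · have : 0 ≤ C₁ * C₂ * κ ^ 2 := by positivity
    linarith
  have hLL₁ : L₁ ≤ L := (le_max_left _ _).trans hL
  have hL0 : 0 < L := by linarith
  obtain ⟨hCQ, hF⟩ := hF f Λf h q L Q hLL₁ hQ
  obtain ⟨K₀, hK₀⟩ := hF α hα hα1
  have hα0 : 0 < α := lt_of_lt_of_le (by positivity) hα
  have hQ0 : 0 < Q := by
    by_contra hneg
    have : C₁ * Q ≤ 0 := mul_nonpos_of_nonneg_of_nonpos (by linarith) (not_lt.1 hneg)
    linarith
  set T := L ^ κ with hT
  have hT2 : 2 ≤ T := by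
    have h1 : (2 : ℝ) ^ (1 / κ) ≤ L := (le_max_right _ _).trans hL
    have h2 := Real.rpow_le_rpow (by positivity) h1 hκ.le
    rwa [← Real.rpow_mul (by norm_num), one_div, inv_mul_cancel₀ hκ.ne', Real.rpow_one] at h2
  set K := max K₀ D with hK
  have hK' := hK₀ K (le_max_left _ _)
  obtain ⟨hAint, hAle⟩ := hA κ Λf hκ.le h.bound q T y (1 + α) D hT2 hy (by linarith)
  set s := Finset.Icc 1 K ×ˢ Finset.Ioc ⌊y⌋₊ D with hs
  set c : DirichletCharacter ℂ q → ℕ × ℕ → ℂ := fun χ p =>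
    f p.1 * χ (p.1 : ZMod q) * (Λf p.2 * χ (p.2 : ZMod q)) with hc
  have hP := fun χ : DirichletCharacter ℂ q => integral_norm_sq_sum_le_le s (c χ)
    (fun p => p.1 * p.2) (σ := 1 + α) (fun p hp => by
      rw [hs, Finset.mem_product, Finset.mem_Icc, Finset.mem_Ioc] at hp
      exact Nat.mul_pos hp.1.1 (by omega)) (by linarith)
  set m := min Q ((1 / α) ^ κ) with hm
  have hfac : ∀ (χ : DirichletCharacter ℂ q) (t : ℝ),
      ∑ p ∈ s, c χ p * ((p.1 * p.2 : ℕ) : ℂ) ^ (-((1 + α : ℝ) + t * I)) =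
      (∑ n ∈ Finset.Icc 1 K, f n * χ (n : ZMod q) / (n : ℂ) ^ (((1 + α : ℝ) : ℂ) + t * I)) *
      ∑ d ∈ Finset.Ioc ⌊y⌋₊ D, Λf d * χ (d : ZMod q) * (d : ℂ) ^ (-((1 + α : ℝ) + t * I)) := by
    intro χ t
    rw [Finset.sum_mul_sum, hs, Finset.sum_product]
    refine Finset.sum_congr rfl fun n _ => Finset.sum_congr rfl fun d _ => ?_
    simp only [hc]
    rw [Nat.cast_mul, Complex.natCast_mul_natCast_cpow, div_eq_mul_inv, ← Complex.cpow_neg]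
    ring
  have hpt : ∀ (χ : DirichletCharacter ℂ q) (t : ℝ),
      ‖∑ p ∈ s, c χ p * ((p.1 * p.2 : ℕ) : ℂ) ^ (-((1 + α : ℝ) + t * I))‖ ^ 2 *
        ((1 + α) ^ 2 + t ^ 2)⁻¹ ≤ C₁ * m ^ 2 * T ^ 2 *
      (‖∑ d ∈ Finset.Ioc ⌊y⌋₊ D, Λf d * χ (d : ZMod q) * (d : ℂ) ^ (-((1 + α : ℝ) + t * I))‖ ^ 2 *
        (T ^ 2 + t ^ 2)⁻¹) := by
    intro χ t
    rw [hfac, norm_mul, mul_pow]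
    have h1 := hK' χ t
    set X := ‖∑ n ∈ Finset.Icc 1 K, f n * χ (n : ZMod q) / (n : ℂ) ^ (((1 + α : ℝ) : ℂ) + t * I)‖ ^ 2
    set Y := ‖∑ d ∈ Finset.Ioc ⌊y⌋₊ D, Λf d * χ (d : ZMod q) *
      (d : ℂ) ^ (-((1 + α : ℝ) + t * I))‖ ^ 2
    have hT0 : 0 < T := by linarith
    have h2 : X * ((1 + α) ^ 2 + t ^ 2)⁻¹ ≤ C₁ * m ^ 2 * T ^ 2 * (T ^ 2 + t ^ 2)⁻¹ := by
      rw [← div_eq_mul_inv, ← div_eq_mul_inv, div_le_div_iff₀ (by positivity) (by positivity)]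
      have h3 : X * (T ^ 2 + t ^ 2) = T ^ 2 * (X * (1 + t ^ 2 / T ^ 2)) := by field_simp
      rw [h3]
      calc _ ≤ T ^ 2 * (C₁ * m ^ 2 * ((1 + α) ^ 2 + t ^ 2)) :=
            mul_le_mul_of_nonneg_left h1 (by positivity)
        _ = _ := by ring
    calc X * Y * ((1 + α) ^ 2 + t ^ 2)⁻¹ = X * ((1 + α) ^ 2 + t ^ 2)⁻¹ * Y := by ring
      _ ≤ C₁ * m ^ 2 * T ^ 2 * (T ^ 2 + t ^ 2)⁻¹ * Y :=
        mul_le_mul_of_nonneg_right h2 (by positivity)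
      _ = _ := by ring
  refine ⟨hQ0, fun u => ∑ χ : DirichletCharacter ℂ q,
    ‖∑ p ∈ s with ((p.1 * p.2 : ℕ) : ℝ) ≤ u, c χ p‖ ^ 2, ?_, fun u => by positivity, ?_, ?_⟩
  · simp only [Finset.sum_mul]
    exact integrable_finsetSum _ fun χ _ => (hP χ).2.1
  · intro u hu hD
    have hKu : ⌊u⌋₊ ≤ K := hD.trans (le_max_right _ _)
    refine (sq_sum_norm_le_sum_norm_sq_character q fun a => convSum f Λf y D u (a : ZMod q)).trans
      (le_of_eq ?_)
    refine Finset.sum_congr rfl fun χ _ => ?_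
    rw [← sum_character_mul_convSum f Λf χ y D hu hKu]
  · simp only [Finset.sum_mul]
    rw [integral_finsetSum _ fun χ _ => (hP χ).2.1]
    calc _ ≤ ∑ χ : DirichletCharacter ℂ q, 1 * (C₁ * m ^ 2 * T ^ 2 * ∫ t : ℝ,
          (‖∑ d ∈ Finset.Ioc ⌊y⌋₊ D, Λf d * χ (d : ZMod q) *
            (d : ℂ) ^ (-((1 + α : ℝ) + t * I))‖ ^ 2 * (T ^ 2 + t ^ 2)⁻¹)) := by
          refine Finset.sum_le_sum fun χ _ => ?_
          rw [(hP χ).2.2]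
          refine mul_le_mul ?_ ?_ (integral_nonneg fun t => by positivity) zero_le_one
          · rw [div_le_one (by positivity)]
            linarith [Real.pi_gt_three]
          · rw [← integral_const_mul]
            exact integral_mono (hP χ).1 ((hAint χ).const_mul _) fun t => hpt χ t
      _ = C₁ * m ^ 2 * T ^ 2 * ∑ χ : DirichletCharacter ℂ q, ∫ t : ℝ,
          (‖∑ d ∈ Finset.Ioc ⌊y⌋₊ D, Λf d * χ (d : ZMod q) *
            (d : ℂ) ^ (-((1 + α : ℝ) + t * I))‖ ^ 2 * (T ^ 2 + t ^ 2)⁻¹) := by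
          rw [Finset.mul_sum]
          simp only [one_mul]
      _ ≤ C₁ * m ^ 2 * T ^ 2 * (C₂ * κ ^ 2 / T ^ 2 *
          ∑ d ∈ Finset.Ioc ⌊y⌋₊ D, ArithmeticFunction.vonMangoldt d / d) :=
          mul_le_mul_of_nonneg_left hAle (by positivity)
      _ = C₁ * C₂ * κ ^ 2 * m ^ 2 *
          ∑ d ∈ Finset.Ioc ⌊y⌋₊ D, ArithmeticFunction.vonMangoldt d / d := by
          have : T ≠ 0 := by linarith
          field_simp
      _ ≤ _ := by
          have h0 : 0 ≤ ∑ d ∈ Finset.Ioc ⌊y⌋₊ D, ArithmeticFunction.vonMangoldt d / d :=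
            Finset.sum_nonneg fun d _ => div_nonneg ArithmeticFunction.vonMangoldt_nonneg (by positivity)
          gcongr
          linarith

theorem exists_integral_block_unitConvSum_le {κ : ℝ} (hκ : 0 < κ) : ∃ C L₀ : ℝ, 1 ≤ C ∧
    1 ≤ L₀ ∧ ∀ f Λf, IsHalaszClass κ f Λf → ∀ (q : ℕ) [NeZero q] (L Q y : ℝ), L₀ ≤ L →
    (∀ (χ : DirichletCharacter ℂ q) (t : ℝ), |t| ≤ L ^ κ →
      ‖FserChi f χ ((1 + 1 / L : ℝ) + t * I) / ((1 + 1 / L : ℝ) + t * I)‖ ≤ Q) →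
    Real.exp 1 * ((q : ℝ) * L ^ κ) ^ 4 ≤ y → ∀ (l : ℝ) (D : ℕ), 2 ≤ l → l ≤ L → ⌊Real.exp l⌋₊ ≤ D →
    ∫ u in Set.Ioc (Real.exp (l / 2)) (Real.exp l),
      unitConvSum f Λf q y D u / (u ^ 2 * Real.log u) ≤ C * min Q (l ^ κ) := by
  obtain ⟨C₁, L₀, hC₁, hL₀, H⟩ := exists_integral_norm_sq_character_convSum_le hκ
  obtain ⟨C₂, hC₂, hM⟩ := sum_vonMangoldt_div_le
  refine ⟨C₁ * (1 + C₂) + Real.exp 2, L₀, ?_, hL₀,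
    fun f Λf h q _ L Q y hL hQ hy l D hl hlL hD => ?_⟩
  · have := Real.add_one_le_exp (2 : ℝ)
    have : 0 ≤ C₁ * (1 + C₂) := by positivity
    linarith
  have hl0 : 0 < l := by linarith
  obtain ⟨hQ0, B, hBi, hB0, hB, hBle⟩ := H f Λf h q L Q y (1 / l) ⌊Real.exp l⌋₊ hL hQ hy
    (one_div_le_one_div_of_le hl0 hlL) (by rw [div_le_one hl0]; linarith)
  rw [one_div_one_div] at hBle
  set m := min Q (l ^ κ) with hm
  have hm0 : 0 < m := lt_min hQ0 (by positivity)
  have hX1 : 1 ≤ Real.exp (l / 2) := Real.one_le_exp (by linarith)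
  have hsub : Set.Ioc (Real.exp (l / 2)) (Real.exp l) ⊆ Set.Ioi 1 :=
    fun u hu => lt_of_le_of_lt hX1 hu.1
  have hle : Real.exp (l / 2) ≤ Real.exp l := Real.exp_le_exp.2 (by linarith)
  have hpt : ∀ u ∈ Set.Ioc (Real.exp (l / 2)) (Real.exp l),
      unitConvSum f Λf q y D u / (u ^ 2 * Real.log u) ≤
        1 / (2 * l * m) * (B u * u ^ (-2 * (1 + 1 / l) - 1)) + 2 * Real.exp 2 * m / l * u⁻¹ := by
    intro u hu
    have hu0 : 0 < u := (Real.exp_pos _).trans hu.1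
    have hu1 : 1 ≤ u := hX1.trans hu.1.le
    have hfl : ⌊u⌋₊ ≤ ⌊Real.exp l⌋₊ := Nat.floor_le_floor hu.2
    have hcong : unitConvSum f Λf q y D u = unitConvSum f Λf q y ⌊Real.exp l⌋₊ u :=
      Finset.sum_congr rfl fun a _ => by rw [convSum_congr_of_floor_le f Λf y hfl hD]
    have h1 := hB u hu0 hfl
    rw [← hcong] at h1
    set A := unitConvSum f Λf q y D u with hA
    have hA0 : 0 ≤ A := unitConvSum_nonneg f Λf q y D u
    have hlog : l / 2 ≤ Real.log u := by
      rw [Real.le_log_iff_exp_le hu0]; exact hu.1.le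
    have hlog' : Real.log u ≤ l := by
      rw [Real.log_le_iff_le_exp hu0]; exact hu.2
    set w := u ^ (-(1 / l)) with hw
    have hw0 : 0 < w := by positivity
    have hwe : Real.exp (-1) ≤ w := by
      rw [hw, Real.rpow_def_of_pos hu0, Real.exp_le_exp]
      have : Real.log u * (1 / l) ≤ 1 := by
        rw [mul_one_div, div_le_one hl0]; exact hlog'
      linarith
    have hpow : u ^ (-2 * (1 + 1 / l) - 1) = w ^ 2 * (u⁻¹ ^ 2 * u⁻¹) := by
      rw [hw, ← Real.rpow_natCast, ← Real.rpow_mul hu0.le, show -2 * (1 + 1 / l) - 1 =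
        -(1 / l) * (2 : ℕ) + (-3 : ℝ) by push_cast; ring, Real.rpow_add hu0]
      congr 1
      rw [show (-3 : ℝ) = ((-3 : ℤ) : ℝ) by norm_num, Real.rpow_intCast]
      rw [show (-3 : ℤ) = -(3 : ℕ) by norm_num, zpow_neg, zpow_natCast, ← inv_pow]
      ring
    have hl1 : (Real.log u)⁻¹ ≤ 2 / l := by
      rw [inv_le_comm₀ (by linarith) (by positivity), inv_div]; exact hlog
    have hli : 0 ≤ (Real.log u)⁻¹ := inv_nonneg.2 (by linarith)
    have hAw : A ≤ A * w * Real.exp 1 := by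
      rw [mul_assoc]
      refine le_mul_of_one_le_right hA0 ?_
      calc 1 = Real.exp (-1) * Real.exp 1 := by rw [← Real.exp_add]; simp
        _ ≤ w * Real.exp 1 := mul_le_mul_of_nonneg_right hwe (Real.exp_pos _).le
    rw [hpow]
    set r := u⁻¹ with hr
    have hr0 : 0 < r := by positivity
    calc A / (u ^ 2 * Real.log u) = A * r ^ 2 * (Real.log u)⁻¹ := by
          rw [hr]; field_simp
      _ ≤ (A * w * Real.exp 1) * r ^ 2 * (2 / l) := by gcongr
      _ ≤ 1 / (2 * l * m) * (A ^ 2 * (w ^ 2 * (r ^ 2 * r))) + 2 * Real.exp 2 * m / l * r := by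
          have he : Real.exp 2 = Real.exp 1 ^ 2 := by rw [← Real.exp_nat_mul]; norm_num
          rw [he]
          have h3 : 1 / (2 * l * m) * (A ^ 2 * (w ^ 2 * (r ^ 2 * r))) +
              2 * Real.exp 1 ^ 2 * m / l * r - (A * w * Real.exp 1) * r ^ 2 * (2 / l) =
              r / (2 * l * m) * (A * w * r - 2 * Real.exp 1 * m) ^ 2 := by
            field_simp
            ring
          have h4 : 0 ≤ r / (2 * l * m) * (A * w * r - 2 * Real.exp 1 * m) ^ 2 := by positivity
          linarith
      _ ≤ _ := by gcongr
  have hinv : IntegrableOn (fun u : ℝ => u⁻¹) (Set.Ioc (Real.exp (l / 2)) (Real.exp l)) := by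
    rw [← intervalIntegrable_iff_integrableOn_Ioc_of_le hle]
    refine intervalIntegrable_inv_iff.2 (Or.inr ?_)
    rw [Set.uIcc_of_le hle]
    exact fun h => absurd h.1 (not_le.2 (Real.exp_pos _))
  have hinvval : ∫ u in Set.Ioc (Real.exp (l / 2)) (Real.exp l), u⁻¹ = l / 2 := by
    rw [← intervalIntegral.integral_of_le hle, integral_inv_of_pos (Real.exp_pos _) (Real.exp_pos _),
      ← Real.exp_sub, Real.log_exp]
    ring
  have hBi' := hBi.mono_set hsub
  have hsum : ∑ d ∈ Finset.Ioc ⌊y⌋₊ ⌊Real.exp l⌋₊, ArithmeticFunction.vonMangoldt d / d ≤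
      (1 + C₂) * l := by
    have h1 : 1 ≤ ⌊Real.exp l⌋₊ := Nat.le_floor (by simpa using Real.one_le_exp hl0.le)
    have h2 : Real.log (⌊Real.exp l⌋₊ : ℕ) ≤ l := by
      rw [Real.log_le_iff_le_exp (by exact_mod_cast h1)]
      exact Nat.floor_le (Real.exp_pos _).le
    calc _ ≤ ∑ d ∈ Finset.Icc 1 ⌊Real.exp l⌋₊, ArithmeticFunction.vonMangoldt d / d := by
          refine Finset.sum_le_sum_of_subset_of_nonneg (fun d => ?_) fun d _ _ =>
            div_nonneg ArithmeticFunction.vonMangoldt_nonneg (by positivity)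
          simp only [Finset.mem_Ioc, Finset.mem_Icc]
          omega
      _ ≤ Real.log (⌊Real.exp l⌋₊ : ℕ) + C₂ := hM _ h1
      _ ≤ (1 + C₂) * l := by nlinarith
  calc _ ≤ ∫ u in Set.Ioc (Real.exp (l / 2)) (Real.exp l),
        (1 / (2 * l * m) * (B u * u ^ (-2 * (1 + 1 / l) - 1)) + 2 * Real.exp 2 * m / l * u⁻¹) := by
        refine setIntegral_mono_on ?_ ((hBi'.const_mul _).add (hinv.const_mul _)) measurableSet_Ioc hpt
        exact integrableOn_unitConvSum_div_sq_mul_log f Λf q y D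
          (Real.exp_le_exp.2 (by linarith)) _
    _ = 1 / (2 * l * m) * (∫ u in Set.Ioc (Real.exp (l / 2)) (Real.exp l),
          B u * u ^ (-2 * (1 + 1 / l) - 1)) + 2 * Real.exp 2 * m / l * (l / 2) := by
        rw [integral_add (hBi'.const_mul _) (hinv.const_mul _), integral_const_mul,
          integral_const_mul, hinvval]
    _ ≤ 1 / (2 * l * m) * (C₁ * m ^ 2 * ((1 + C₂) * l)) + 2 * Real.exp 2 * m / l * (l / 2) := by
        refine add_le_add (mul_le_mul_of_nonneg_left ?_ (by positivity)) le_rfl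
        refine le_trans (setIntegral_mono_set hBi ?_ (Filter.Eventually.of_forall hsub)) (hBle.trans ?_)
        · filter_upwards [ae_restrict_mem measurableSet_Ioi] with u hu
          have : (0 : ℝ) < u := lt_trans one_pos hu
          exact mul_nonneg (hB0 u) (by positivity)
        · exact mul_le_mul_of_nonneg_left hsum (by positivity)
    _ = (C₁ * (1 + C₂) / 2 + Real.exp 2) * m := by field_simp
    _ ≤ _ := by
        have : 0 ≤ C₁ * (1 + C₂) := by positivity
        gcongr
        linarith

theorem sum_range_min_exp_rpow_le {κ : ℝ} (hκ : 0 < κ) : ∃ C : ℝ, 1 ≤ C ∧ ∀ M L : ℝ,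
    -(1 / 2) ≤ M → 0 < L → ∀ I : ℕ,
    ∑ i ∈ Finset.range I, min (Real.exp (-M) * L ^ κ) ((L / 2 ^ i) ^ κ) ≤
      C * ((1 + M) * Real.exp (-M) * L ^ κ) := by
  set c := κ * Real.log 2 with hc
  have hc0 : 0 < c := mul_pos hκ (Real.log_pos (by norm_num))
  set ρ := Real.exp (-c) with hρ
  have hρ0 : 0 < ρ := Real.exp_pos _
  have hρ1 : ρ < 1 := by rw [hρ, Real.exp_lt_one_iff]; linarith
  have hρi : 0 < 1 - ρ := by linarith
  refine ⟨1 / c + 2 + 2 / (1 - ρ), ?_, fun M L hM hL I => ?_⟩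
  · have : 0 < 1 / c := by positivity
    have : 0 < 2 / (1 - ρ) := by positivity
    linarith
  have hpow : ∀ i : ℕ, (L / 2 ^ i) ^ κ = ρ ^ i * L ^ κ := by
    intro i
    rw [Real.div_rpow hL.le (by positivity), hρ, ← Real.exp_nat_mul, div_eq_inv_mul]
    congr 1
    rw [Real.rpow_def_of_pos (by positivity), ← Real.exp_neg, Real.log_pow, hc]
    congr 1
    ring
  have hLκ : 0 < L ^ κ := by positivity
  have hE := Real.exp_pos (-M)
  set i₀ := ⌈(M + 1) / c⌉₊ with hi₀
  have hi₀le : (i₀ : ℝ) ≤ (M + 1) / c + 1 := (Nat.ceil_lt_add_one (by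
    exact div_nonneg (by linarith) hc0.le)).le
  have hρi₀ : ρ ^ i₀ ≤ Real.exp (-M) := by
    rw [hρ, ← Real.exp_nat_mul, Real.exp_le_exp]
    have : (M + 1) / c ≤ i₀ := Nat.le_ceil _
    rw [div_le_iff₀ hc0] at this
    linarith
  have hgeom : ∑ j ∈ Finset.range I, ρ ^ j ≤ 1 / (1 - ρ) := by
    rw [one_div, ← tsum_geometric_of_lt_one hρ0.le hρ1]
    exact (summable_geometric_of_lt_one hρ0.le hρ1).sum_le_tsum _ fun _ _ => by positivity
  calc ∑ i ∈ Finset.range I, min (Real.exp (-M) * L ^ κ) ((L / 2 ^ i) ^ κ)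
      ≤ ∑ i ∈ Finset.range (i₀ + I), min (Real.exp (-M) * L ^ κ) ((L / 2 ^ i) ^ κ) :=
        Finset.sum_le_sum_of_subset_of_nonneg (Finset.range_mono (by omega)) fun i _ _ =>
          le_min (by positivity) (by positivity)
    _ ≤ ∑ i ∈ Finset.range i₀, Real.exp (-M) * L ^ κ +
        ∑ j ∈ Finset.range I, Real.exp (-M) * L ^ κ * ρ ^ j := by
        rw [Finset.sum_range_add]
        refine add_le_add (Finset.sum_le_sum fun i _ => min_le_left _ _)
          (Finset.sum_le_sum fun j _ => (min_le_right _ _).trans ?_)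
        rw [hpow, pow_add]
        calc ρ ^ i₀ * ρ ^ j * L ^ κ ≤ Real.exp (-M) * ρ ^ j * L ^ κ := by gcongr
          _ = _ := by ring
    _ ≤ ((M + 1) / c + 1 + 1 / (1 - ρ)) * (Real.exp (-M) * L ^ κ) := by
        rw [Finset.sum_const, Finset.card_range, nsmul_eq_mul, ← Finset.mul_sum]
        have := mul_le_mul_of_nonneg_left hgeom (by positivity : 0 ≤ Real.exp (-M) * L ^ κ)
        have := mul_le_mul_of_nonneg_right hi₀le (by positivity : 0 ≤ Real.exp (-M) * L ^ κ)
        linarith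
    _ ≤ ((1 / c + 2 + 2 / (1 - ρ)) * (1 + M)) * (Real.exp (-M) * L ^ κ) := by
        refine mul_le_mul_of_nonneg_right ?_ (by positivity)
        have h1 : 1 ≤ 2 * (1 + M) := by linarith
        have h2 : 0 < 1 / (1 - ρ) := by positivity
        have h3 : (1 / c + 2 + 2 / (1 - ρ)) * (1 + M) - ((M + 1) / c + 1 + 1 / (1 - ρ)) =
          (1 + 1 / (1 - ρ)) * (2 * (1 + M) - 1) := by ring
        have h4 : 0 ≤ (1 + 1 / (1 - ρ)) * (2 * (1 + M) - 1) := by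
          apply mul_nonneg <;> linarith
        linarith
    _ = _ := by ring

theorem exists_integral_unitConvSum_le {κ : ℝ} (hκ : 0 < κ) : ∃ C L₀ : ℝ, 1 ≤ C ∧
    1 ≤ L₀ ∧ ∀ f Λf, IsHalaszClass κ f Λf → ∀ (q : ℕ) [NeZero q] (L M y Y : ℝ), L₀ ≤ L →
    -(1 / 2) ≤ M →
    (∀ (χ : DirichletCharacter ℂ q) (t : ℝ), |t| ≤ L ^ κ →
      ‖FserChi f χ ((1 + 1 / L : ℝ) + t * I) / ((1 + 1 / L : ℝ) + t * I)‖ ≤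
        Real.exp (-M) * L ^ κ) →
    Real.exp 1 * ((q : ℝ) * L ^ κ) ^ 4 ≤ y → Real.exp 2 ≤ Y →
    ∫ u in Set.Ioc Y (Real.exp L),
      unitConvSum f Λf q y ⌊Real.exp L⌋₊ u / (u ^ 2 * Real.log u) ≤
        C * ((1 + M) * Real.exp (-M) * L ^ κ) := by
  obtain ⟨C₁, L₀, hC₁, hL₀, H⟩ := exists_integral_block_unitConvSum_le hκ
  obtain ⟨C₂, hC₂, H₂⟩ := sum_range_min_exp_rpow_le hκ
  refine ⟨C₁ * C₂, L₀, one_le_mul_of_one_le_of_one_le hC₁ hC₂, hL₀,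
    fun f Λf h q _ L M y Y hL hM hQ hy hY => ?_⟩
  have hLpos : 0 < L := by linarith
  set g : ℝ → ℝ := fun u => unitConvSum f Λf q y ⌊Real.exp L⌋₊ u / (u ^ 2 * Real.log u) with hg
  set Q := Real.exp (-M) * L ^ κ with hQdef
  have hY0 : 0 < Y := (Real.exp_pos 2).trans_le hY
  have hlY : 2 ≤ Real.log Y := by rwa [Real.le_log_iff_exp_le hY0]
  have hint : ∀ Z, Real.exp 1 ≤ Z → IntegrableOn g (Set.Ioc Z (Real.exp L)) := fun Z hZ =>
    integrableOn_unitConvSum_div_sq_mul_log f Λf q y _ hZ _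
  have hg0 : ∀ u, Real.exp 1 ≤ u → 0 ≤ g u := fun u hu => by
    refine div_nonneg (unitConvSum_nonneg f Λf q y _ u) (mul_nonneg (sq_nonneg _) ?_)
    refine Real.log_nonneg (le_trans ?_ hu)
    exact Real.one_le_exp zero_le_one
  have key : ∀ I : ℕ, ∫ u in Set.Ioc (max Y (Real.exp (L / 2 ^ I))) (Real.exp L), g u ≤
      C₁ * ∑ i ∈ Finset.range I, min Q ((L / 2 ^ i) ^ κ) := by
    intro I
    induction I with
    | zero => simp
    | succ I ih =>
      rw [Finset.sum_range_succ, mul_add]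
      set l := L / 2 ^ I with hl
      have hlpos : 0 < l := by positivity
      have hhalf : L / 2 ^ (I + 1) = l / 2 := by rw [hl, pow_succ]; field_simp
      rw [hhalf]
      rcases le_or_gt l (Real.log Y) with h1 | h1
      · have h2 : Real.exp l ≤ Y := (Real.le_log_iff_exp_le hY0).1 h1
        have h3 : Real.exp (l / 2) ≤ Y := (Real.exp_le_exp.2 (by linarith)).trans h2
        rw [max_eq_left h2] at ih
        rw [max_eq_left h3]
        have : 0 ≤ C₁ * min Q (l ^ κ) :=
          mul_nonneg (by linarith) (le_min (by positivity) (by positivity))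
        linarith
      · have h2 : Y < Real.exp l := (Real.log_lt_iff_lt_exp hY0).1 h1
        have hlL : l ≤ L := div_le_self hLpos.le (one_le_pow₀ (by norm_num))
        have h3 := H f Λf h q L Q y hL hQ hy l ⌊Real.exp L⌋₊ (by linarith) hlL
          (Nat.floor_le_floor (Real.exp_le_exp.2 hlL))
        rw [max_eq_right h2.le] at ih
        have h4 : Real.exp 1 ≤ Real.exp (l / 2) := Real.exp_le_exp.2 (by linarith)
        have h5 : Real.exp (l / 2) ≤ Real.exp l := Real.exp_le_exp.2 (by linarith)
        have h6 : Real.exp l ≤ Real.exp L := Real.exp_le_exp.2 hlL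
        have h7 : ∫ u in Set.Ioc (max Y (Real.exp (l / 2))) (Real.exp L), g u ≤
            ∫ u in Set.Ioc (Real.exp (l / 2)) (Real.exp L), g u := by
          refine setIntegral_mono_set (hint _ h4) ?_
            (Filter.Eventually.of_forall (Set.Ioc_subset_Ioc_left (le_max_right _ _)))
          filter_upwards [ae_restrict_mem measurableSet_Ioc] with u hu
          exact hg0 u (h4.trans hu.1.le)
        rw [← Set.Ioc_union_Ioc_eq_Ioc h5 h6, setIntegral_union (Set.Ioc_disjoint_Ioc_of_le le_rfl)
          measurableSet_Ioc ((hint _ h4).mono_set (Set.Ioc_subset_Ioc_right h6))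
          (hint _ (h4.trans h5))] at h7
        linarith
  obtain ⟨I, hI⟩ : ∃ I : ℕ, Real.exp (L / 2 ^ I) ≤ Y := by
    obtain ⟨I, hI⟩ := pow_unbounded_of_one_lt (L / 2) (by norm_num : (1 : ℝ) < 2)
    refine ⟨I, (Real.exp_le_exp.2 ?_).trans hY⟩
    rw [div_le_iff₀ (by positivity)]
    linarith
  have h1 := key I
  rw [max_eq_left hI] at h1
  refine h1.trans ?_
  rw [mul_assoc]
  exact mul_le_mul_of_nonneg_left (H₂ M L hM hLpos I) (by linarith)

theorem integrableOn_Ioi_inv_sq {c : ℝ} (hc : 0 < c) :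
    IntegrableOn (fun v : ℝ => 1 / v ^ 2) (Set.Ioi c) ∧ ∫ v in Set.Ioi c, 1 / v ^ 2 = 1 / c := by
  have hcong : Set.EqOn (fun v : ℝ => v ^ (-2 : ℝ)) (fun v : ℝ => 1 / v ^ 2) (Set.Ioi c) := by
    intro v hv
    have hv0 : 0 < v := hc.trans hv
    simp only
    rw [Real.rpow_neg hv0.le, one_div]
    norm_num
  constructor
  · exact (integrableOn_congr_fun hcong measurableSet_Ioi).1
      (integrableOn_Ioi_rpow_of_lt (by norm_num) hc)
  · rw [← setIntegral_congr_fun measurableSet_Ioi hcong,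
      integral_Ioi_rpow_of_lt (by norm_num) hc]
    norm_num
    rw [Real.rpow_neg hc.le, Real.rpow_one]

theorem integral_unitSum_div_sq_le (f : ℕ → ℂ) (q : ℕ) [NeZero q] (Y : ℝ) :
    ∫ v in Set.Ioc 0 Y, unitSum f q v / v ^ 2 ≤ ∑ n ∈ Finset.Icc 1 ⌊Y⌋₊, ‖f n‖ / n := by
  have hint : ∀ n ∈ Finset.Icc 1 ⌊Y⌋₊, IntegrableOn
      (fun v : ℝ => ‖f n‖ * (Set.Ici (n : ℝ)).indicator (fun v : ℝ => 1 / v ^ 2) v) (Set.Ioc 0 Y) ∧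
      ∫ v in Set.Ioc 0 Y, ‖f n‖ * (Set.Ici (n : ℝ)).indicator (fun v : ℝ => 1 / v ^ 2) v ≤
        ‖f n‖ / n := by
    intro n hn
    have hn0 : (0 : ℝ) < n := by exact_mod_cast (Finset.mem_Icc.1 hn).1
    obtain ⟨h1, h2⟩ := integrableOn_Ioi_inv_sq hn0
    rw [← integrableOn_Ici_iff_integrableOn_Ioi] at h1
    have h3 : Integrable ((Set.Ici (n : ℝ)).indicator (fun v : ℝ => 1 / v ^ 2)) :=
      (integrable_indicator_iff measurableSet_Ici).2 h1
    refine ⟨(h3.const_mul _).integrableOn, ?_⟩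
    rw [integral_const_mul, div_eq_mul_one_div]
    refine mul_le_mul_of_nonneg_left ?_ (norm_nonneg _)
    refine (setIntegral_le_integral h3 (Filter.Eventually.of_forall fun v =>
      Set.indicator_nonneg (fun v _ => by positivity) v)).trans ?_
    rw [integral_indicator measurableSet_Ici, integral_Ici_eq_integral_Ioi, h2]
  calc ∫ v in Set.Ioc 0 Y, unitSum f q v / v ^ 2
      ≤ ∫ v in Set.Ioc 0 Y, ∑ n ∈ Finset.Icc 1 ⌊Y⌋₊,
          ‖f n‖ * (Set.Ici (n : ℝ)).indicator (fun v : ℝ => 1 / v ^ 2) v := by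
        refine setIntegral_mono_on (integrableOn_unitSum_div_pow f q Y 2)
          (integrable_finsetSum _ fun n hn => (hint n hn).1) measurableSet_Ioc fun v hv => ?_
        rw [div_le_iff₀ (pow_pos hv.1 2)]
        refine (unitSum_le_sum f q le_rfl).trans ?_
        rw [Finset.sum_mul]
        refine le_trans ?_ (Finset.sum_le_sum_of_subset_of_nonneg
          (Finset.Icc_subset_Icc_right (Nat.floor_le_floor hv.2)) fun n _ _ => ?_)
        · refine Finset.sum_le_sum fun n hn => ?_
          have h1 : (n : ℝ) ≤ v := (Nat.le_floor_iff hv.1.le).1 (Finset.mem_Icc.1 hn).2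
          rw [Set.indicator_of_mem (show v ∈ Set.Ici (n : ℝ) from h1)]
          have := hv.1
          refine le_of_eq ?_
          field_simp
        · exact mul_nonneg (mul_nonneg (norm_nonneg _) (Set.indicator_nonneg
            (fun v _ => by positivity) v)) (sq_nonneg _)
    _ ≤ _ := by
        rw [integral_finsetSum _ fun n hn => (hint n hn).1]
        exact Finset.sum_le_sum fun n hn => (hint n hn).2

theorem integral_integral_div_le {g : ℝ → ℝ} (hg : Measurable g) (hg0 : ∀ v, 0 ≤ g v)
    (h0 : ∀ v < 1, g v = 0) {x K : ℝ} (hK : ∀ v ≤ x, g v ≤ K) :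
    IntegrableOn (fun u => (∫ v in Set.Ioc 0 u, g v / v) / u ^ 2) (Set.Ioc 0 x) ∧
      ∫ u in Set.Ioc 0 x, (∫ v in Set.Ioc 0 u, g v / v) / u ^ 2 ≤
        ∫ v in Set.Ioc 0 x, g v / v ^ 2 := by
  rcases le_or_gt x 0 with hx | hx
  · simp [Set.Ioc_eq_empty (not_lt.2 hx)]
  set μ := (volume : Measure ℝ).restrict (Set.Ioc 0 x) with hμ
  have hK0 : 0 ≤ K := (hg0 x).trans (hK x le_rfl)
  set F : ℝ × ℝ → ℝ := {p : ℝ × ℝ | p.2 ≤ p.1}.indicator fun p => g p.2 / p.2 / p.1 ^ 2 with hF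
  have hmset : MeasurableSet {p : ℝ × ℝ | p.2 ≤ p.1} := measurableSet_le measurable_snd measurable_fst
  have hFm : Measurable F :=
    (((hg.comp measurable_snd).div measurable_snd).div (measurable_fst.pow_const 2)).indicator hmset
  have hFb : ∀ᵐ p ∂(μ.prod μ), ‖F p‖ ≤ K := by
    rw [hμ, Measure.prod_restrict]
    filter_upwards [ae_restrict_mem (measurableSet_Ioc.prod measurableSet_Ioc)] with p hp
    obtain ⟨hp1, hp2⟩ := hp
    rw [hF, Set.indicator_apply]
    split_ifs with h
    · rcases lt_or_ge p.2 1 with h1 | h1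
      · simp [h0 _ h1, hK0]
      · have h2 : 1 ≤ p.1 := h1.trans h
        have := hg0 p.2
        rw [Real.norm_of_nonneg (by positivity)]
        calc g p.2 / p.2 / p.1 ^ 2 ≤ g p.2 / p.2 :=
              div_le_self (by positivity) (one_le_pow₀ h2)
          _ ≤ g p.2 := div_le_self (by positivity) h1
          _ ≤ K := hK _ hp2.2
    · simpa using hK0
  have hFi : Integrable F (μ.prod μ) := Integrable.of_bound hFm.aestronglyMeasurable K hFb
  have hleft : ∀ u ∈ Set.Ioc 0 x, ∫ v, F (u, v) ∂μ = (∫ v in Set.Ioc 0 u, g v / v) / u ^ 2 := by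
    intro u hu
    have h1 : (fun v => F (u, v)) = (Set.Iic u).indicator fun v => g v / v / u ^ 2 := by
      ext v
      simp only [hF, Set.indicator_apply, Set.mem_ofPred_eq, Set.mem_Iic]
    rw [h1, integral_indicator measurableSet_Iic, hμ, Measure.restrict_restrict measurableSet_Iic,
      integral_div]
    have h2 : Set.Iic u ∩ Set.Ioc 0 x = Set.Ioc 0 u := by
      ext v
      simp only [Set.mem_inter_iff, Set.mem_Iic, Set.mem_Ioc]
      exact ⟨fun h => ⟨h.2.1, h.1⟩, fun h => ⟨h.2, h.1, h.2.trans hu.2⟩⟩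
    rw [h2]
  have hright : ∀ v ∈ Set.Ioc 0 x, ∫ u, F (u, v) ∂μ ≤ g v / v ^ 2 := by
    intro v hv
    have h1 : (fun u => F (u, v)) = (Set.Ici v).indicator fun u => g v / v * (1 / u ^ 2) := by
      ext u
      simp only [hF, Set.indicator_apply, Set.mem_ofPred_eq, Set.mem_Ici]
      split_ifs
      · ring
      · rfl
    obtain ⟨h3, h4⟩ := integrableOn_Ioi_inv_sq hv.1
    rw [← integrableOn_Ici_iff_integrableOn_Ioi] at h3
    have hgv : 0 ≤ g v / v := div_nonneg (hg0 v) hv.1.le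
    have h5 : Integrable ((Set.Ici v).indicator fun u => g v / v * (1 / u ^ 2)) :=
      (integrable_indicator_iff measurableSet_Ici).2 (h3.const_mul _)
    rw [h1, hμ]
    refine (setIntegral_le_integral h5 (Filter.Eventually.of_forall fun u =>
      Set.indicator_nonneg (fun u _ => by positivity) u)).trans ?_
    rw [integral_indicator measurableSet_Ici, integral_Ici_eq_integral_Ioi, integral_const_mul, h4]
    refine le_of_eq ?_
    have := hv.1
    field_simp
  have hl := hFi.integral_prod_left
  have hr := hFi.integral_prod_right
  constructor
  · exact (integrableOn_congr_fun (fun u hu => hleft u hu) measurableSet_Ioc).1 hl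
  · rw [← setIntegral_congr_fun measurableSet_Ioc hleft]
    calc ∫ u in Set.Ioc 0 x, ∫ v, F (u, v) ∂μ = ∫ v, ∫ u, F (u, v) ∂μ ∂μ :=
          integral_integral_swap hFi
      _ ≤ _ := by
          refine setIntegral_mono_on hr ?_ measurableSet_Ioc hright
          refine integrableOn_div_pow_of_bounded hg h0 (K := K) (fun v hv => ?_) 2
          rw [abs_of_nonneg (hg0 v)]
          exact hK v hv

theorem sum_units_norm_resSum_mul_inv {q : ℕ} [NeZero q] (f : ℕ → ℂ) {d : ZMod q} (hd : IsUnit d)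
    (v : ℝ) : ∑ a : (ZMod q)ˣ, ‖resSum f v ((a : ZMod q) * d⁻¹)‖ = unitSum f q v := by
  obtain ⟨w, rfl⟩ := hd
  rw [unitSum, ← Equiv.sum_comp (Equiv.mulRight w⁻¹) fun a : (ZMod q)ˣ => ‖resSum f v (a : ZMod q)‖]
  refine Finset.sum_congr rfl fun a _ => ?_
  rw [Equiv.coe_mulRight, Units.val_mul, ZMod.inv_coe_unit]

theorem IsHalaszClass.log_mul_unitSum_le {κ : ℝ} {f Λf : ℕ → ℂ} (h : IsHalaszClass κ f Λf)
    (q : ℕ) [NeZero q] {u : ℝ} (hu : 1 ≤ u) (y : ℝ) {D : ℕ} (hD : ⌊u⌋₊ ≤ D) :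
    Real.log u * unitSum f q u ≤ unitConvSum f Λf q y D u +
      κ * ∑ d ∈ (Finset.Icc 1 ⌊y⌋₊).filter (fun d : ℕ => IsUnit (d : ZMod q)),
        ArithmeticFunction.vonMangoldt d * unitSum f q (u / d) +
      ∫ v in Set.Ioc 0 u, unitSum f q v / v := by
  have hi : ∀ a : (ZMod q)ˣ, IntegrableOn (fun v => ‖resSum f v (a : ZMod q)‖ / v) (Set.Ioc 0 u) :=
    fun a => by simpa using integrableOn_norm_resSum_div_pow f (a : ZMod q) u 1
  have h1 : ∫ v in Set.Ioc 0 u, unitSum f q v / v =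
      ∑ a : (ZMod q)ˣ, ∫ v in Set.Ioc 0 u, ‖resSum f v (a : ZMod q)‖ / v := by
    rw [← integral_finsetSum _ fun a _ => hi a]
    simp only [unitSum, Finset.sum_div]
  have h2 : κ * ∑ d ∈ (Finset.Icc 1 ⌊y⌋₊).filter (fun d : ℕ => IsUnit (d : ZMod q)),
        ArithmeticFunction.vonMangoldt d * unitSum f q (u / d) =
      ∑ a : (ZMod q)ˣ, κ * ∑ d ∈ (Finset.Icc 1 ⌊y⌋₊).filter (fun d : ℕ => IsUnit (d : ZMod q)),
        ArithmeticFunction.vonMangoldt d * ‖resSum f (u / d) ((a : ZMod q) * (d : ZMod q)⁻¹)‖ := by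
    rw [← Finset.mul_sum, Finset.sum_comm]
    congr 1
    refine Finset.sum_congr rfl fun d hd => ?_
    rw [← Finset.mul_sum]
    congr 1
    exact (sum_units_norm_resSum_mul_inv f (Finset.mem_filter.1 hd).2 _).symm
  have h3 : Real.log u * unitSum f q u = ∑ a : (ZMod q)ˣ, Real.log u * ‖resSum f u (a : ZMod q)‖ :=
    Finset.mul_sum _ _ _
  rw [h1, h2, h3, unitConvSum, ← Finset.sum_add_distrib, ← Finset.sum_add_distrib]
  refine Finset.sum_le_sum fun a _ => ?_
  refine (h.log_mul_norm_resSum_le a.isUnit hu y hD).trans (le_of_eq ?_)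
  congr!

theorem integral_unitSum_div_natCast_div_sq_le (f : ℕ → ℂ) (q : ℕ) [NeZero q] (x : ℝ) {d : ℕ}
    (hd : 1 ≤ d) : IntegrableOn (fun u => unitSum f q (u / d) / u ^ 2) (Set.Ioc 0 x) ∧
    ∫ u in Set.Ioc 0 x, unitSum f q (u / d) / u ^ 2 ≤
      (∫ v in Set.Ioc 0 x, unitSum f q v / v ^ 2) / d := by
  have hd1 : (1 : ℝ) ≤ d := by exact_mod_cast hd
  have hd0 : (0 : ℝ) < d := by linarith
  constructor
  · refine integrableOn_div_pow_of_bounded ((measurable_unitSum f q).comp (measurable_id.div_const _))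
      (fun v hv => unitSum_of_lt_one f q ?_) (K := ∑ n ∈ Finset.Icc 1 ⌊x⌋₊, ‖f n‖) (fun v hv => ?_) 2
    · simp only [id]
      rw [div_lt_one hd0]
      linarith
    · simp only [Function.comp, id]
      rw [abs_of_nonneg (unitSum_nonneg f q _)]
      rcases lt_or_ge v 0 with h | h
      · rw [unitSum_of_lt_one f q ((div_nonpos_of_nonpos_of_nonneg h.le hd0.le).trans_lt one_pos)]
        positivity
      · exact unitSum_le_sum f q ((div_le_self h hd1).trans hv)
  · rcases le_or_gt x 0 with hx | hx
    · simp [Set.Ioc_eq_empty (not_lt.2 hx)]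
    have h1 : ∫ u in Set.Ioc 0 x, unitSum f q (u / d) / u ^ 2 =
        (∫ v in Set.Ioc 0 (x / d), unitSum f q v / v ^ 2) / d := by
      rw [← intervalIntegral.integral_of_le hx.le, ← intervalIntegral.integral_of_le (by positivity)]
      have := intervalIntegral.integral_comp_div (a := 0) (b := x)
        (fun v => unitSum f q v / v ^ 2 / d ^ 2) hd0.ne'
      rw [zero_div] at this
      rw [smul_eq_mul] at this
      have h2 : (fun u : ℝ => unitSum f q (u / d) / u ^ 2) =
          fun u : ℝ => unitSum f q (u / d) / (u / d) ^ 2 / d ^ 2 := by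
        ext u
        rw [div_pow, div_div, div_mul_cancel₀ _ (by positivity)]
      rw [h2, this, intervalIntegral.integral_div]
      field_simp
    rw [h1]
    refine div_le_div_of_nonneg_right (setIntegral_mono_set (integrableOn_unitSum_div_pow f q x 2)
      (Filter.Eventually.of_forall fun v => div_nonneg (unitSum_nonneg f q v) (sq_nonneg v))
      (Filter.Eventually.of_forall (Set.Ioc_subset_Ioc_right (div_le_self hx.le hd1)))) hd0.le

theorem IsHalaszClass.integral_unitSum_div_sq_le_two_mul {κ : ℝ} (hκ : 0 ≤ κ) {f Λf : ℕ → ℂ}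
    (h : IsHalaszClass κ f Λf) (q : ℕ) [NeZero q] {x y Y : ℝ} (hY : 4 ≤ Real.log Y) (hY1 : 1 < Y)
    (hy : 4 * κ * ∑ d ∈ Finset.Icc 1 ⌊y⌋₊, ArithmeticFunction.vonMangoldt d / d ≤ Real.log Y) :
    ∫ u in Set.Ioc 0 x, unitSum f q u / u ^ 2 ≤
      2 * (∫ u in Set.Ioc 0 Y, unitSum f q u / u ^ 2) +
        2 * ∫ u in Set.Ioc Y x, unitConvSum f Λf q y ⌊x⌋₊ u / (u ^ 2 * Real.log u) := by
  have hY0 : 0 < Y := by linarith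
  have hnn : ∀ u : ℝ, 0 ≤ unitSum f q u / u ^ 2 := fun u =>
    div_nonneg (unitSum_nonneg f q u) (sq_nonneg u)
  have hJY : 0 ≤ ∫ u in Set.Ioc 0 Y, unitSum f q u / u ^ 2 :=
    setIntegral_nonneg measurableSet_Ioc fun u _ => hnn u
  rcases lt_or_ge x Y with hx | hx
  · rw [Set.Ioc_eq_empty (not_lt.2 hx.le)]
    simp only [Measure.restrict_empty, integral_zero_measure, mul_zero, add_zero]
    have : ∫ u in Set.Ioc 0 x, unitSum f q u / u ^ 2 ≤ ∫ u in Set.Ioc 0 Y, unitSum f q u / u ^ 2 :=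
      setIntegral_mono_set (integrableOn_unitSum_div_pow f q Y 2)
        (Filter.Eventually.of_forall hnn)
        (Filter.Eventually.of_forall (Set.Ioc_subset_Ioc_right hx.le))
    linarith
  have heY : Real.exp 1 ≤ Y := by
    rw [← Real.le_log_iff_exp_le hY0]; linarith
  set J := ∫ u in Set.Ioc 0 x, unitSum f q u / u ^ 2 with hJ
  have hJ0 : 0 ≤ J := setIntegral_nonneg measurableSet_Ioc fun u _ => hnn u
  set s := (Finset.Icc 1 ⌊y⌋₊).filter (fun d : ℕ => IsUnit (d : ZMod q)) with hs
  set ℓ := Real.log Y with hℓ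
  have hℓ0 : 0 < ℓ := by linarith
  have hsub : Set.Ioc Y x ⊆ Set.Ioc 0 x := Set.Ioc_subset_Ioc_left hY0.le
  obtain ⟨hHi, hH⟩ := integral_integral_div_le (measurable_unitSum f q) (unitSum_nonneg f q)
    (fun v hv => unitSum_of_lt_one f q hv) (x := x) (K := ∑ n ∈ Finset.Icc 1 ⌊x⌋₊, ‖f n‖)
    (fun v hv => unitSum_le_sum f q hv)
  have hmem : ∀ d ∈ s, 1 ≤ d := fun d hd => (Finset.mem_Icc.1 (Finset.mem_filter.1 hd).1).1
  have hSi : ∀ d ∈ s, IntegrableOn (fun u => ArithmeticFunction.vonMangoldt d *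
      (unitSum f q (u / d) / u ^ 2)) (Set.Ioc 0 x) := fun d hd =>
    ((integral_unitSum_div_natCast_div_sq_le f q x (hmem d hd)).1).const_mul _
  have hpt : ∀ u ∈ Set.Ioc Y x, unitSum f q u / u ^ 2 ≤
      unitConvSum f Λf q y ⌊x⌋₊ u / (u ^ 2 * Real.log u) +
        (κ / ℓ * (∑ d ∈ s, ArithmeticFunction.vonMangoldt d * (unitSum f q (u / d) / u ^ 2)) +
        1 / ℓ * ((∫ v in Set.Ioc 0 u, unitSum f q v / v) / u ^ 2)) := by
    intro u hu
    have hu0 : 0 < u := hY0.trans hu.1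
    have hlu : ℓ ≤ Real.log u := Real.log_le_log hY0 hu.1.le
    have h1 := h.log_mul_unitSum_le q (hY1.le.trans hu.1.le) y (Nat.floor_le_floor hu.2)
    set P := ∑ d ∈ s, ArithmeticFunction.vonMangoldt d * unitSum f q (u / d) with hP
    have hP0 : 0 ≤ P := Finset.sum_nonneg fun d _ =>
      mul_nonneg ArithmeticFunction.vonMangoldt_nonneg (unitSum_nonneg f q _)
    have hP' : ∑ d ∈ s, ArithmeticFunction.vonMangoldt d * (unitSum f q (u / d) / u ^ 2) =
        P / u ^ 2 := by
      rw [hP, Finset.sum_div]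
      exact Finset.sum_congr rfl fun d _ => by ring
    rw [hP']
    set W := ∫ v in Set.Ioc 0 u, unitSum f q v / v with hW
    have hW0 : 0 ≤ W := setIntegral_nonneg measurableSet_Ioc fun v hv =>
      div_nonneg (unitSum_nonneg f q v) hv.1.le
    have hlu0 : 0 < Real.log u := by linarith
    calc unitSum f q u / u ^ 2 = Real.log u * unitSum f q u / (u ^ 2 * Real.log u) := by
          field_simp
      _ ≤ (unitConvSum f Λf q y ⌊x⌋₊ u + κ * P + W) / (u ^ 2 * Real.log u) := by gcongr
      _ = unitConvSum f Λf q y ⌊x⌋₊ u / (u ^ 2 * Real.log u) +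
          ((κ * (P / u ^ 2)) / Real.log u + (W / u ^ 2) / Real.log u) := by
          field_simp
          ring
      _ ≤ unitConvSum f Λf q y ⌊x⌋₊ u / (u ^ 2 * Real.log u) +
          ((κ * (P / u ^ 2)) / ℓ + (W / u ^ 2) / ℓ) := by gcongr
      _ = _ := by ring
  have hCi := integrableOn_unitConvSum_div_sq_mul_log f Λf q y ⌊x⌋₊ heY x
  have hSi' := integrable_finsetSum s fun d hd => (hSi d hd).mono_set hsub
  have hHi' := hHi.mono_set hsub
  have hJs : J = (∫ u in Set.Ioc 0 Y, unitSum f q u / u ^ 2) +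
      ∫ u in Set.Ioc Y x, unitSum f q u / u ^ 2 := by
    rw [hJ, ← Set.Ioc_union_Ioc_eq_Ioc hY0.le hx]
    exact setIntegral_union (Set.Ioc_disjoint_Ioc_of_le le_rfl) measurableSet_Ioc
      (integrableOn_unitSum_div_pow f q Y 2)
      ((integrableOn_unitSum_div_pow f q x 2).mono_set hsub)
  have hmain : ∫ u in Set.Ioc Y x, unitSum f q u / u ^ 2 ≤
      (∫ u in Set.Ioc Y x, unitConvSum f Λf q y ⌊x⌋₊ u / (u ^ 2 * Real.log u)) +
        (κ / ℓ * (∑ d ∈ s, ArithmeticFunction.vonMangoldt d * (J / d)) + 1 / ℓ * J) := by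
    have hadd : IntegrableOn (fun u => κ / ℓ * (∑ d ∈ s, ArithmeticFunction.vonMangoldt d *
        (unitSum f q (u / d) / u ^ 2)) + 1 / ℓ * ((∫ v in Set.Ioc 0 u, unitSum f q v / v) / u ^ 2))
        (Set.Ioc Y x) := (hSi'.const_mul _).add (hHi'.const_mul _)
    refine (setIntegral_mono_on ((integrableOn_unitSum_div_pow f q x 2).mono_set hsub)
      (hCi.add hadd) measurableSet_Ioc hpt).trans ?_
    refine (integral_add hCi hadd).le.trans ?_
    rw [
      integral_add (hSi'.const_mul _) (hHi'.const_mul _), integral_const_mul, integral_const_mul,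
      integral_finsetSum s fun d hd => (hSi d hd).mono_set hsub]
    refine add_le_add le_rfl (add_le_add (mul_le_mul_of_nonneg_left (Finset.sum_le_sum
      fun d hd => ?_) (by positivity)) (mul_le_mul_of_nonneg_left ?_ (by positivity)))
    · rw [integral_const_mul]
      refine mul_le_mul_of_nonneg_left ?_ ArithmeticFunction.vonMangoldt_nonneg
      obtain ⟨h1, h2⟩ := integral_unitSum_div_natCast_div_sq_le f q x (hmem d hd)
      exact (setIntegral_mono_set h1 (Filter.Eventually.of_forall fun u =>
        div_nonneg (unitSum_nonneg f q _) (sq_nonneg u)) (Filter.Eventually.of_forall hsub)).trans h2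
    · refine (setIntegral_mono_set hHi ?_ (Filter.Eventually.of_forall hsub)).trans hH
      exact Filter.Eventually.of_forall fun u => div_nonneg (setIntegral_nonneg measurableSet_Ioc
        fun v hv => div_nonneg (unitSum_nonneg f q v) hv.1.le) (sq_nonneg u)
  have hsum : ∑ d ∈ s, ArithmeticFunction.vonMangoldt d * (J / d) ≤
      J * ∑ d ∈ Finset.Icc 1 ⌊y⌋₊, ArithmeticFunction.vonMangoldt d / d := by
    rw [Finset.mul_sum]
    refine (Finset.sum_le_sum fun d _ => le_of_eq ?_).trans (Finset.sum_le_sum_of_subset_of_nonneg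
      (Finset.filter_subset _ _) fun d _ _ => mul_nonneg hJ0 (div_nonneg
        ArithmeticFunction.vonMangoldt_nonneg (by positivity)))
    ring
  have h1 : κ / ℓ * (∑ d ∈ s, ArithmeticFunction.vonMangoldt d * (J / d)) ≤ J / 4 := by
    calc _ ≤ κ / ℓ * (J * ∑ d ∈ Finset.Icc 1 ⌊y⌋₊, ArithmeticFunction.vonMangoldt d / d) :=
          mul_le_mul_of_nonneg_left hsum (by positivity)
      _ = J / (4 * ℓ) * (4 * κ * ∑ d ∈ Finset.Icc 1 ⌊y⌋₊, ArithmeticFunction.vonMangoldt d / d) := by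
          field_simp
      _ ≤ J / (4 * ℓ) * ℓ := mul_le_mul_of_nonneg_left hy (by positivity)
      _ = J / 4 := by field_simp
  have h2 : 1 / ℓ * J ≤ J / 4 := by
    rw [one_div_mul_eq_div]
    exact div_le_div_of_nonneg_left hJ0 (by norm_num) hY
  linarith

theorem exists_log_mul_norm_resSum_le {κ : ℝ} (hκ : 0 < κ) : ∃ C U₀ : ℝ, 0 < C ∧ 1 < U₀ ∧
    ∀ f Λf, IsHalaszClass κ f Λf → ∀ (q : ℕ) [NeZero q] (b : (ZMod q)ˣ) (u : ℝ), U₀ ≤ u →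
    (q : ℝ) ^ 4 ≤ u →
    Real.log u * ‖resSum f u (b : ZMod q)‖ ≤ C * (u / q.totient) * Real.log u ^ κ := by
  obtain ⟨C, X₀, hC, hX₀, H⟩ := sum_genDivisor_modEq_le hκ
  refine ⟨2 * C, X₀ + 4, by positivity, by linarith, fun f Λf h q _ b u hu hq => ?_⟩
  have hu4 : 4 ≤ u := by linarith
  have hu0 : 0 < u := by linarith
  set X := ⌊u⌋₊ with hX
  have hXu : (X : ℝ) ≤ u := Nat.floor_le hu0.le
  have hXu' : u - 1 < X := by have := Nat.lt_floor_add_one u; linarith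
  have hq0 : 0 < q := Nat.pos_of_ne_zero (NeZero.ne q)
  have hqX : q ^ 4 ≤ X := Nat.le_floor (by exact_mod_cast hq)
  set a := (b : ZMod q).val with ha
  have hab : ((a : ℕ) : ZMod q) = (b : ZMod q) := ZMod.natCast_zmod_val _
  have hacop : a.Coprime q := ZMod.val_coe_unit_coprime b
  have h1 := H q a X hq0 hacop hqX (by linarith)
  have h2 : ‖resSum f u (b : ZMod q)‖ ≤
      ∑ n ∈ (Finset.Icc 1 X).filter (fun n => n ≡ a [MOD q]), genDivisor κ n := by
    have hset : (Finset.Icc 1 X).filter (fun n : ℕ => (n : ZMod q) = (b : ZMod q)) =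
        (Finset.Icc 1 X).filter (fun n => n ≡ a [MOD q]) := by
      refine Finset.filter_congr fun n _ => ?_
      rw [← hab, ZMod.natCast_eq_natCast_iff]
    rw [resSum, hset]
    refine (norm_sum_le _ _).trans (Finset.sum_le_sum fun n hn => ?_)
    exact h.norm_le_genDivisor hκ (Finset.mem_Icc.1 (Finset.mem_filter.1 hn).1).1
  have hlu : 1 ≤ Real.log u := by
    rw [Real.le_log_iff_exp_le hu0]
    have := Real.exp_one_lt_d9
    linarith
  have hlX : Real.log u / 2 ≤ Real.log X := by
    have hs : Real.sqrt u ≤ X := by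
      rw [Real.sqrt_le_left (by positivity)]
      nlinarith
    calc Real.log u / 2 = Real.log (Real.sqrt u) := (Real.log_sqrt hu0.le).symm
      _ ≤ _ := Real.log_le_log (Real.sqrt_pos.2 hu0) hs
  have hlX' : Real.log X ≤ Real.log u := Real.log_le_log (by linarith) hXu
  have hpow : Real.log X ^ (κ - 1) ≤ 2 * Real.log u ^ (κ - 1) := by
    have h3 : 0 < Real.log u ^ (κ - 1) := by positivity
    rcases le_or_gt 1 κ with hk | hk
    · have := Real.rpow_le_rpow (by linarith) hlX' (by linarith : 0 ≤ κ - 1)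
      linarith
    · have h4 := Real.rpow_le_rpow_of_nonpos (by positivity) hlX (by linarith : κ - 1 ≤ 0)
      rw [Real.div_rpow (by linarith) (by norm_num), div_eq_mul_inv, ← Real.rpow_neg (by norm_num)]
        at h4
      have h5 : (2 : ℝ) ^ (-(κ - 1)) ≤ 2 := by
        calc (2 : ℝ) ^ (-(κ - 1)) ≤ 2 ^ (1 : ℝ) :=
              Real.rpow_le_rpow_of_exponent_le (by norm_num) (by linarith)
          _ = 2 := Real.rpow_one 2
      have := mul_le_mul_of_nonneg_left h5 h3.le
      linarith
  calc Real.log u * ‖resSum f u (b : ZMod q)‖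
      ≤ Real.log u * (C * (X / q.totient) * Real.log X ^ (κ - 1)) :=
        mul_le_mul_of_nonneg_left (h2.trans h1) (by linarith)
    _ ≤ Real.log u * (C * (u / q.totient) * (2 * Real.log u ^ (κ - 1))) := by
        have : 0 ≤ Real.log u := by linarith
        gcongr
    _ = 2 * C * (u / q.totient) * (Real.log u ^ (κ - 1) * Real.log u) := by ring
    _ = _ := by
        rw [← Real.rpow_add_one (by linarith)]
        congr 2
        ring

theorem exists_sum_norm_div_le {κ : ℝ} (hκ : 0 < κ) : ∃ C : ℝ, 0 < C ∧
    ∀ f Λf, IsHalaszClass κ f Λf → ∀ u : ℝ, 2 ≤ u →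
    ∑ n ∈ Finset.Icc 1 ⌊u⌋₊, ‖f n‖ / n ≤ C * Real.log u ^ κ := by
  obtain ⟨C, hC, H⟩ := sum_genDivisor_div_le hκ
  refine ⟨C, hC, fun f Λf h u hu => ?_⟩
  have h2 : 2 ≤ ⌊u⌋₊ := Nat.le_floor (by exact_mod_cast hu)
  calc ∑ n ∈ Finset.Icc 1 ⌊u⌋₊, ‖f n‖ / n ≤ ∑ n ∈ Finset.Icc 1 ⌊u⌋₊, genDivisor κ n / n := by
        refine Finset.sum_le_sum fun n hn => ?_
        have := h.norm_le_genDivisor hκ (Finset.mem_Icc.1 hn).1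
        gcongr
    _ ≤ C * Real.log (⌊u⌋₊ : ℕ) ^ κ := H _ h2
    _ ≤ _ := by
        have h3 : (1 : ℝ) ≤ (⌊u⌋₊ : ℕ) := by exact_mod_cast (by omega : 1 ≤ ⌊u⌋₊)
        have h4 : Real.log (⌊u⌋₊ : ℕ) ≤ Real.log u :=
          Real.log_le_log (by linarith) (Nat.floor_le (by linarith))
        have := Real.log_nonneg h3
        gcongr

theorem exists_norm_resSum_le_mul_sqrt {κ : ℝ} (hκ : 0 < κ) : ∃ C : ℝ, 0 < C ∧
    ∀ f Λf, IsHalaszClass κ f Λf → ∀ (q : ℕ) (b : ZMod q) (v : ℝ), 0 ≤ v →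
    ‖resSum f v b‖ ≤ C * (v * Real.sqrt v) := by
  obtain ⟨C, hC, H⟩ := genDivisor_le_rpow hκ (by norm_num : (0 : ℝ) < 1 / 2)
  refine ⟨C, hC, fun f Λf h q b v hv => ?_⟩
  calc ‖resSum f v b‖ ≤ ∑ n ∈ Finset.Icc 1 ⌊v⌋₊, ‖f n‖ := norm_resSum_le f le_rfl b
    _ ≤ ∑ n ∈ Finset.Icc 1 ⌊v⌋₊, C * Real.sqrt v := by
        refine Finset.sum_le_sum fun n hn => ?_
        have hn' := Finset.mem_Icc.1 hn
        refine (h.norm_le_genDivisor hκ hn'.1).trans ((H n hn'.1).trans ?_)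
        rw [← Real.sqrt_eq_rpow]
        exact mul_le_mul_of_nonneg_left (Real.sqrt_le_sqrt
          ((Nat.le_floor_iff hv).1 hn'.2)) hC.le
    _ = ⌊v⌋₊ * (C * Real.sqrt v) := by simp
    _ ≤ v * (C * Real.sqrt v) :=
        mul_le_mul_of_nonneg_right (Nat.floor_le hv) (by positivity)
    _ = _ := by ring

theorem le_two_mul_of_forall_le_add_half {ι : Type*} {F : ι → ℝ} {s : Set ι} {C R₀ : ℝ}
    (hC : 0 ≤ C) (hR₀ : ∀ i ∈ s, F i ≤ R₀)
    (hstep : ∀ R, 0 ≤ R → (∀ i ∈ s, F i ≤ R) → ∀ i ∈ s, F i ≤ C + R / 2) :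
    ∀ i ∈ s, F i ≤ 2 * C := by
  intro i hi
  set R := max 0 (sSup (F '' s)) with hR
  have hbdd : BddAbove (F '' s) := ⟨R₀, by rintro _ ⟨j, hj, rfl⟩; exact hR₀ j hj⟩
  have hle : ∀ j ∈ s, F j ≤ R := fun j hj =>
    (le_csSup hbdd (Set.mem_image_of_mem F hj)).trans (le_max_right _ _)
  have h1 := hstep R (le_max_left _ _) hle
  have h2 : sSup (F '' s) ≤ C + R / 2 := csSup_le ⟨_, Set.mem_image_of_mem F hi⟩ (by
    rintro _ ⟨j, hj, rfl⟩
    exact h1 j hj)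
  have h3 : R ≤ C + R / 2 := max_le (by positivity) h2
  have := hle i hi
  linarith

theorem sum_vonMangoldt_mul_norm_resSum_le_of_forall_le {q : ℕ} (f : ℕ → ℂ) {u y V H : ℝ}
    (hy : 0 < y) (hu : 0 < u) (hH0 : 0 ≤ H) (hV : V * y ≤ u)
    (hH : ∀ v, V ≤ v → v ≤ u → ∀ b : (ZMod q)ˣ, ‖resSum f v (b : ZMod q)‖ ≤ H * v) (b : (ZMod q)ˣ) :
    ∑ d ∈ (Finset.Icc 1 ⌊y⌋₊).filter (fun d : ℕ => IsUnit (d : ZMod q)),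
      ArithmeticFunction.vonMangoldt d * ‖resSum f (u / d) ((b : ZMod q) * (d : ZMod q)⁻¹)‖ ≤
      H * u * ∑ d ∈ Finset.Icc 1 ⌊y⌋₊, ArithmeticFunction.vonMangoldt d / d := by
  rw [Finset.mul_sum]
  refine le_trans (Finset.sum_le_sum fun d hd => ?_) (Finset.sum_le_sum_of_subset_of_nonneg
    (Finset.filter_subset _ _) fun d _ _ => mul_nonneg (by positivity)
      (div_nonneg ArithmeticFunction.vonMangoldt_nonneg (by positivity)))
  obtain ⟨hd1, w, hw⟩ := Finset.mem_filter.1 hd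
  rw [Finset.mem_Icc] at hd1
  have hd0 : (1 : ℝ) ≤ d := by exact_mod_cast hd1.1
  have hdy : (d : ℝ) ≤ y := (Nat.le_floor_iff hy.le).1 hd1.2
  have h1 := hH (u / d) ?_ (div_le_self hu.le hd0) (b * w⁻¹)
  · rw [← hw, ZMod.inv_coe_unit, ← Units.val_mul]
    have := mul_le_mul_of_nonneg_left h1
      (ArithmeticFunction.vonMangoldt_nonneg : 0 ≤ ArithmeticFunction.vonMangoldt d)
    refine this.trans (le_of_eq ?_)
    ring
  · rw [le_div_iff₀ (by linarith)]
    rcases le_or_gt 0 V with h | h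
    · exact (mul_le_mul_of_nonneg_left hdy h).trans hV
    · exact (mul_nonpos_of_nonpos_of_nonneg h.le (by linarith)).trans hu.le

theorem integral_norm_resSum_div_le_of_forall_le {q : ℕ} (f : ℕ → ℂ) {u H A : ℝ} (hu : 1 ≤ u)
    (b : ZMod q) (hA : ∀ v, 0 ≤ v → ‖resSum f v b‖ ≤ A * (v * Real.sqrt v)) (hA0 : 0 ≤ A)
    (hH : ∀ v, Real.sqrt u ≤ v → v ≤ u → ‖resSum f v b‖ ≤ H * v) :
    ∫ v in Set.Ioc 0 u, ‖resSum f v b‖ / v ≤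
      A * (Real.sqrt u * Real.sqrt (Real.sqrt u)) + H * u := by
  have hs1 : 1 ≤ Real.sqrt u := Real.one_le_sqrt.2 hu
  have hsu : Real.sqrt u ≤ u := by
    rw [Real.sqrt_le_left (by linarith)]
    nlinarith
  have hi : IntegrableOn (fun v => ‖resSum f v b‖ / v) (Set.Ioc 0 u) := by
    simpa using integrableOn_norm_resSum_div_pow f b u 1
  have hH0 : 0 ≤ H := by
    have := (norm_nonneg _).trans (hH u hsu le_rfl)
    exact nonneg_of_mul_nonneg_left this (by linarith)
  rw [← Set.Ioc_union_Ioc_eq_Ioc (by linarith : 0 ≤ Real.sqrt u) hsu,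
    setIntegral_union (Set.Ioc_disjoint_Ioc_of_le le_rfl) measurableSet_Ioc
      (hi.mono_set (Set.Ioc_subset_Ioc_right hsu))
      (hi.mono_set (Set.Ioc_subset_Ioc_left (by linarith)))]
  refine add_le_add ?_ ?_
  · have h1 := norm_setIntegral_le_of_norm_le_const (μ := volume)
      (f := fun v => ‖resSum f v b‖ / v) (s := Set.Ioc 0 (Real.sqrt u))
      (C := A * Real.sqrt (Real.sqrt u)) (by simp) (fun v hv => by
        have hv0 := hv.1
        rw [Real.norm_of_nonneg (by positivity), div_le_iff₀ hv0]
        refine (hA v hv0.le).trans ?_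
        rw [mul_assoc, mul_comm v]
        have := Real.sqrt_le_sqrt hv.2
        gcongr)
    rw [Real.volume_real_Ioc_of_le (by linarith), sub_zero] at h1
    refine (le_abs_self _).trans (h1.trans (le_of_eq ?_))
    ring
  · have h1 := norm_setIntegral_le_of_norm_le_const (μ := volume)
      (f := fun v => ‖resSum f v b‖ / v) (s := Set.Ioc (Real.sqrt u) u)
      (C := H) (by simp) (fun v hv => by
        have hv0 : 0 < v := by linarith [hv.1]
        rw [Real.norm_of_nonneg (by positivity), div_le_iff₀ hv0]
        exact hH v hv.1.le hv.2)
    rw [Real.volume_real_Ioc_of_le hsu] at h1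
    refine (le_abs_self _).trans (h1.trans ?_)
    exact mul_le_mul_of_nonneg_left (by linarith) hH0

theorem exists_norm_convSum_le {κ : ℝ} (hκ : 0 < κ) : ∃ C : ℝ, 0 < C ∧ ∀ f Λf,
    IsHalaszClass κ f Λf → ∀ (q : ℕ) [NeZero q] (b : (ZMod q)ˣ) (L y u : ℝ) (D : ℕ), 1 ≤ L →
    Real.exp 1 * ((q : ℝ) * L ^ κ) ^ 4 ≤ y → 2 ≤ u → u ≤ Real.exp L →
    ‖convSum f Λf y D u (b : ZMod q)‖ ≤
      C * (u / q.totient) * ((∫ v in Set.Ioc 0 (Real.exp L), unitSum f q v / v ^ 2) + 1) := by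
  obtain ⟨C₁, hC₁, H₁⟩ := sum_vonMangoldt_mul_norm_resSum_le
  obtain ⟨C₂, hC₂, H₂⟩ := exists_sum_norm_div_le hκ
  refine ⟨κ * C₁ * (1 + C₂), by positivity, fun f Λf h q _ b L y u D hL hy hu huL => ?_⟩
  have hu0 : 0 < u := by linarith
  have hT : 1 ≤ L ^ κ := Real.one_le_rpow hL hκ.le
  have h1 := H₁ f q b (L ^ κ) y u D hT hy (by linarith)
  have h2 := H₂ f Λf h u hu
  set J := ∫ v in Set.Ioc 0 (Real.exp L), unitSum f q v / v ^ 2 with hJ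
  have h3 : ∫ v in Set.Ioc 0 u, unitSum f q v / v ^ 2 ≤ J :=
    setIntegral_mono_set (integrableOn_unitSum_div_pow f q _ 2)
      (Filter.Eventually.of_forall fun v => div_nonneg (unitSum_nonneg f q v) (sq_nonneg v))
      (Filter.Eventually.of_forall (Set.Ioc_subset_Ioc_right huL))
  have hJ0 : 0 ≤ J := setIntegral_nonneg measurableSet_Ioc fun v _ =>
    div_nonneg (unitSum_nonneg f q v) (sq_nonneg v)
  have h4 : 1 / L ^ κ * ∑ n ∈ Finset.Icc 1 ⌊u⌋₊, ‖f n‖ / n ≤ C₂ := by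
    rw [one_div_mul_eq_div, div_le_iff₀ (by positivity)]
    refine h2.trans (mul_le_mul_of_nonneg_left ?_ hC₂.le)
    have : Real.log u ≤ L := by rwa [Real.log_le_iff_le_exp hu0]
    exact Real.rpow_le_rpow (Real.log_nonneg (by linarith)) this hκ.le
  calc ‖convSum f Λf y D u (b : ZMod q)‖
      ≤ κ * ∑ d ∈ (Finset.Ioc ⌊y⌋₊ D).filter (fun d : ℕ => IsUnit (d : ZMod q)),
        ArithmeticFunction.vonMangoldt d * ‖resSum f (u / d) ((b : ZMod q) * (d : ZMod q)⁻¹)‖ := by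
        rw [convSum, Finset.mul_sum]
        refine (norm_sum_le _ _).trans ?_
        refine le_trans (le_of_eq ?_) (Finset.sum_le_sum (f := fun d : ℕ =>
          ‖Λf d * resSum f (u / d) ((b : ZMod q) * (d : ZMod q)⁻¹)‖) fun d hd => ?_)
        · congr!
        · have hd1 : 1 ≤ d := by
            have := (Finset.mem_Ioc.1 (Finset.mem_filter.1 hd).1).1
            omega
          rw [norm_mul, ← mul_assoc]
          exact mul_le_mul_of_nonneg_right (h.bound d hd1) (norm_nonneg _)
    _ ≤ κ * (C₁ * (u / q.totient) * (J + C₂)) := by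
        refine mul_le_mul_of_nonneg_left (h1.trans ?_) hκ.le
        exact mul_le_mul_of_nonneg_left (add_le_add h3 h4) (by positivity)
    _ ≤ κ * (C₁ * (u / q.totient) * ((1 + C₂) * (J + 1))) := by
        have : J + C₂ ≤ (1 + C₂) * (J + 1) := by nlinarith
        gcongr
    _ = _ := by ring

theorem exists_log_mul_norm_resSum_step {κ : ℝ} (hκ : 0 < κ) : ∃ C k : ℝ, 0 < C ∧ 4 ≤ k ∧
    ∀ f Λf, IsHalaszClass κ f Λf → ∀ (q : ℕ) [NeZero q] (L l u G : ℝ), 1 ≤ l → 1 ≤ L →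
    Real.exp 1 * ((q : ℝ) * L ^ κ) ^ 4 ≤ Real.exp l → (q : ℝ) ^ 4 ≤ u →
    Real.exp (2 * (k * l)) ≤ u → u ≤ Real.exp L →
    (∀ v, Real.exp (k * l) ≤ v → v ≤ u → ∀ b : (ZMod q)ˣ,
      Real.log v * ‖resSum f v (b : ZMod q)‖ ≤ G * v) → ∀ b : (ZMod q)ˣ,
    Real.log u * ‖resSum f u (b : ZMod q)‖ ≤
      C * (u / q.totient) * ((∫ v in Set.Ioc 0 (Real.exp L), unitSum f q v / v ^ 2) + 1) +
        G * u / 2 := by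
  obtain ⟨C₁, hC₁, H₁⟩ := exists_norm_convSum_le hκ
  obtain ⟨C₂, hC₂, H₂⟩ := exists_norm_resSum_le_mul_sqrt hκ
  obtain ⟨C₀, hC₀, H₀⟩ := sum_vonMangoldt_div_le
  refine ⟨C₁ + C₂, 4 + 4 * κ * (1 + C₀), by positivity, ?_,
    fun f Λf h q _ L l u G hl hL hT hqu hu huL hG b => ?_⟩
  · have : 0 ≤ 4 * κ * (1 + C₀) := by positivity
    linarith
  set k := 4 + 4 * κ * (1 + C₀) with hk
  have hk4 : 4 ≤ k := by
    have : 0 ≤ 4 * κ * (1 + C₀) := by positivity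
    linarith
  have hkl : 4 ≤ k * l := by nlinarith
  have hu0 : 0 < u := (Real.exp_pos _).trans_le hu
  have hu2 : 2 ≤ u := by
    have := Real.add_one_le_exp (2 * (k * l))
    linarith
  have hVu : Real.exp (k * l) ≤ u := (Real.exp_le_exp.2 (by linarith)).trans hu
  have hH : ∀ v, Real.exp (k * l) ≤ v → v ≤ u → ∀ b : (ZMod q)ˣ,
      ‖resSum f v (b : ZMod q)‖ ≤ G / (k * l) * v := by
    intro v hv hvu b
    have hv0 : 0 < v := (Real.exp_pos _).trans_le hv
    have h1 : k * l ≤ Real.log v := by rwa [Real.le_log_iff_exp_le hv0]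
    have h2 := (mul_le_mul_of_nonneg_right h1 (norm_nonneg _)).trans (hG v hv hvu b)
    rw [div_mul_eq_mul_div, le_div_iff₀ (by linarith)]
    linarith
  have hG0 : 0 ≤ G := by
    have h1 := (norm_nonneg _).trans (hH u hVu le_rfl b)
    have h2 := nonneg_of_mul_nonneg_left h1 hu0
    rwa [le_div_iff₀ (by linarith), zero_mul] at h2
  set H := G / (k * l) with hHdef
  have hH0 : 0 ≤ H := by positivity
  have hsq : Real.exp (k * l) ≤ Real.sqrt u := by
    apply Real.le_sqrt_of_sq_le
    rwa [← Real.exp_nat_mul]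
  have hmain := h.log_mul_norm_resSum_le b.isUnit (by linarith : 1 ≤ u) (Real.exp l)
    (le_refl ⌊u⌋₊)
  have hconv := H₁ f Λf h q b L (Real.exp l) u ⌊u⌋₊ hL hT hu2 huL
  have hsmall := sum_vonMangoldt_mul_norm_resSum_le_of_forall_le f (Real.exp_pos l) hu0 hH0
    (V := Real.exp (k * l)) (by
      rw [← Real.exp_add]
      refine (Real.exp_le_exp.2 ?_).trans hu
      nlinarith) hH b
  have hint := integral_norm_resSum_div_le_of_forall_le f (by linarith : 1 ≤ u) (b : ZMod q)
    (fun v hv => H₂ f Λf h q b v hv) hC₂.le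
    (fun v hv hvu => hH v (hsq.trans hv) hvu b)
  have hsum : ∑ d ∈ Finset.Icc 1 ⌊Real.exp l⌋₊, ArithmeticFunction.vonMangoldt d / d ≤ l + C₀ := by
    have h1 : 1 ≤ ⌊Real.exp l⌋₊ := Nat.le_floor (by
      have := Real.add_one_le_exp l
      push_cast
      linarith)
    refine (H₀ _ h1).trans (add_le_add ?_ le_rfl)
    rw [Real.log_le_iff_le_exp (by exact_mod_cast h1)]
    exact Nat.floor_le (Real.exp_pos _).le
  have hκH : κ * (H * u * ∑ d ∈ Finset.Icc 1 ⌊Real.exp l⌋₊, ArithmeticFunction.vonMangoldt d / d) ≤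
      G * u / 4 := by
    have h1 : κ * (l + C₀) ≤ k * l / 4 := by
      have h3 : 0 ≤ κ * C₀ * (l - 1) := mul_nonneg (by positivity) (by linarith)
      rw [hk]
      nlinarith
    calc _ ≤ κ * (H * u * (l + C₀)) := mul_le_mul_of_nonneg_left
          (mul_le_mul_of_nonneg_left hsum (by positivity)) hκ.le
      _ = H * u * (κ * (l + C₀)) := by ring
      _ ≤ H * u * (k * l / 4) := mul_le_mul_of_nonneg_left h1 (by positivity)
      _ = G * u / 4 := by
          rw [hHdef]
          have : k * l ≠ 0 := by positivity
          field_simp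
  have hHu : H * u ≤ G * u / 4 := by
    have : H ≤ G / 4 := div_le_div_of_nonneg_left hG0 (by norm_num) hkl
    nlinarith
  have hq0 : 0 < q := Nat.pos_of_ne_zero (NeZero.ne q)
  have hφ0 : (0 : ℝ) < q.totient := by exact_mod_cast Nat.totient_pos.2 hq0
  have hφq : (q.totient : ℝ) ≤ q := by exact_mod_cast Nat.totient_le q
  have hquart : Real.sqrt u * Real.sqrt (Real.sqrt u) ≤ u / q.totient := by
    have h1 : (q : ℝ) ≤ Real.sqrt (Real.sqrt u) := by
      apply Real.le_sqrt_of_sq_le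
      apply Real.le_sqrt_of_sq_le
      rwa [← pow_mul]
    rw [le_div_iff₀ hφ0]
    calc Real.sqrt u * Real.sqrt (Real.sqrt u) * q.totient
        ≤ Real.sqrt u * Real.sqrt (Real.sqrt u) * Real.sqrt (Real.sqrt u) :=
          mul_le_mul_of_nonneg_left (hφq.trans h1) (by positivity)
      _ = u := by
          rw [mul_assoc, Real.mul_self_sqrt (Real.sqrt_nonneg _), Real.mul_self_sqrt hu0.le]
  set J := ∫ v in Set.Ioc 0 (Real.exp L), unitSum f q v / v ^ 2 with hJ
  have hJ0 : 0 ≤ J := setIntegral_nonneg measurableSet_Ioc fun v _ =>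
    div_nonneg (unitSum_nonneg f q v) (sq_nonneg v)
  have h5 : C₂ * (Real.sqrt u * Real.sqrt (Real.sqrt u)) ≤ C₂ * (u / q.totient) * (J + 1) := by
    have : C₂ * (u / q.totient) ≤ C₂ * (u / q.totient) * (J + 1) :=
      le_mul_of_one_le_right (by positivity) (by linarith)
    exact (mul_le_mul_of_nonneg_left hquart hC₂.le).trans this
  have h6 := hmain.trans (add_le_add (add_le_add hconv
    (mul_le_mul_of_nonneg_left hsmall hκ.le)) hint)
  linarith

theorem exists_mul_norm_resSum_exp_le {κ : ℝ} (hκ : 0 < κ) : ∃ C l₀ : ℝ, 0 < C ∧ 1 ≤ l₀ ∧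
    ∀ f Λf, IsHalaszClass κ f Λf → ∀ (q : ℕ) [NeZero q] (L l : ℝ), l₀ ≤ l → l₀ ≤ L →
    Real.exp 1 * ((q : ℝ) * L ^ κ) ^ 4 ≤ Real.exp l → (q : ℝ) ^ 4 ≤ Real.exp L →
    ∀ b : (ZMod q)ˣ, L * ‖resSum f (Real.exp L) (b : ZMod q)‖ ≤ C * (Real.exp L / q.totient) *
      ((∫ v in Set.Ioc 0 (Real.exp L), unitSum f q v / v ^ 2) + l ^ κ + 1) := by
  obtain ⟨C₁, k, hC₁, hk, H₁⟩ := exists_log_mul_norm_resSum_step hκ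
  obtain ⟨C₂, U₀, hC₂, hU₀, H₂⟩ := exists_log_mul_norm_resSum_le hκ
  set C := C₁ + C₂ * (2 * k) ^ κ with hC
  have hC0 : 0 < C := by positivity
  refine ⟨2 * C, 1 + |Real.log U₀|, by positivity, by linarith [abs_nonneg (Real.log U₀)],
    fun f Λf h q _ L l hl hL hT hqL b => ?_⟩
  have habs := abs_nonneg (Real.log U₀)
  have hlU := le_abs_self (Real.log U₀)
  have hU0 : 0 < U₀ := by linarith
  have hl1 : 1 ≤ l := by linarith
  have hL1 : 1 ≤ L := by linarith
  have hkl : 0 < k * l := by positivity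
  have hq0 : 0 < q := Nat.pos_of_ne_zero (NeZero.ne q)
  have hφ0 : (0 : ℝ) < q.totient := by exact_mod_cast Nat.totient_pos.2 hq0
  have hql : (q : ℝ) ^ 4 ≤ Real.exp l := by
    refine le_trans ?_ hT
    have h1 : (1 : ℝ) ≤ L ^ κ := Real.one_le_rpow hL1 hκ.le
    have h2 : (1 : ℝ) ≤ (L ^ κ) ^ 4 := one_le_pow₀ h1
    have h3 : (1 : ℝ) ≤ Real.exp 1 := Real.one_le_exp zero_le_one
    rw [mul_pow]
    have h4 : (q : ℝ) ^ 4 ≤ (q : ℝ) ^ 4 * (L ^ κ) ^ 4 := le_mul_of_one_le_right (by positivity) h2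
    exact h4.trans (le_mul_of_one_le_left (by positivity) h3)
  set J := ∫ v in Set.Ioc 0 (Real.exp L), unitSum f q v / v ^ 2 with hJ
  have hJ0 : 0 ≤ J := setIntegral_nonneg measurableSet_Ioc fun v _ =>
    div_nonneg (unitSum_nonneg f q v) (sq_nonneg v)
  set E := J + l ^ κ + 1 with hE
  have hlκ : 0 < l ^ κ := by positivity
  have hE1 : 1 ≤ E := by linarith
  have hshiu : ∀ u, U₀ ≤ u → (q : ℝ) ^ 4 ≤ u → u ≤ Real.exp (2 * (k * l)) → ∀ b : (ZMod q)ˣ,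
      Real.log u * ‖resSum f u (b : ZMod q)‖ ≤ C * (u * E / q.totient) := by
    intro u hu hqu hul b
    have hu0 : 0 < u := by linarith
    have h1 : Real.log u ≤ 2 * k * l := by
      rw [Real.log_le_iff_le_exp hu0, mul_assoc]
      exact hul
    have h2 : Real.log u ^ κ ≤ (2 * k) ^ κ * l ^ κ := by
      rw [← Real.mul_rpow (by positivity) (by linarith)]
      exact Real.rpow_le_rpow (Real.log_nonneg (by linarith)) h1 hκ.le
    calc Real.log u * ‖resSum f u (b : ZMod q)‖ ≤ C₂ * (u / q.totient) * Real.log u ^ κ :=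
          H₂ f Λf h q b u hu hqu
      _ ≤ C₂ * (u / q.totient) * ((2 * k) ^ κ * E) := by
          have : l ^ κ ≤ E := by linarith
          refine mul_le_mul_of_nonneg_left (h2.trans ?_) (by positivity)
          gcongr
      _ = (C₂ * (2 * k) ^ κ) * (u * E / q.totient) := by ring
      _ ≤ C * (u * E / q.totient) := by
          refine mul_le_mul_of_nonneg_right ?_ (by positivity)
          linarith
  have hUL : U₀ ≤ Real.exp L := by
    rw [← Real.log_le_iff_le_exp hU0]
    linarith
  rcases lt_or_ge L (k * l) with hLk | hLk
  · have h1 := hshiu (Real.exp L) hUL hqL (Real.exp_le_exp.2 (by linarith)) b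
    rw [Real.log_exp] at h1
    refine h1.trans ?_
    have : 0 ≤ C * (Real.exp L * E / q.totient) := by positivity
    calc _ ≤ 2 * (C * (Real.exp L * E / q.totient)) := by linarith
      _ = _ := by ring
  set s : Set (ℝ × (ZMod q)ˣ) := {p | Real.exp (k * l) ≤ p.1 ∧ p.1 ≤ Real.exp L} with hs
  set F : ℝ × (ZMod q)ˣ → ℝ := fun p =>
    Real.log p.1 * ‖resSum f p.1 (p.2 : ZMod q)‖ / (p.1 * E / q.totient) with hF
  have hpos : ∀ p ∈ s, 0 < p.1 * E / q.totient := fun p hp => by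
    have : 0 < p.1 := (Real.exp_pos _).trans_le hp.1
    positivity
  have hFle : ∀ p ∈ s, ∀ R, F p ≤ R ↔
      Real.log p.1 * ‖resSum f p.1 (p.2 : ZMod q)‖ ≤ R * (p.1 * E / q.totient) := fun p hp R =>
    div_le_iff₀ (hpos p hp)
  have hbase : ∀ p ∈ s, U₀ ≤ p.1 ∧ (q : ℝ) ^ 4 ≤ p.1 := by
    intro p hp
    have h1 : Real.exp l ≤ p.1 := (Real.exp_le_exp.2 (by nlinarith)).trans hp.1
    refine ⟨le_trans ?_ h1, hql.trans h1⟩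
    rw [← Real.log_le_iff_le_exp hU0]
    linarith
  have hbound : ∀ p ∈ s, F p ≤ 2 * C := by
    refine le_two_mul_of_forall_le_add_half (R₀ := L * (∑ n ∈ Finset.Icc 1 ⌊Real.exp L⌋₊, ‖f n‖) *
      q.totient) hC0.le (fun p hp => ?_) (fun R hR hRs p hp => ?_)
    · rw [hFle p hp]
      set K := ∑ n ∈ Finset.Icc 1 ⌊Real.exp L⌋₊, ‖f n‖ with hK
      have hK0 : 0 ≤ K := Finset.sum_nonneg fun _ _ => norm_nonneg _
      have h1 : 1 ≤ p.1 := by linarith [(hbase p hp).1]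
      have h2 : Real.log p.1 ≤ L := by
        rw [Real.log_le_iff_le_exp (by linarith)]
        exact hp.2
      calc Real.log p.1 * ‖resSum f p.1 (p.2 : ZMod q)‖ ≤ L * K :=
            mul_le_mul h2 (norm_resSum_le f hp.2 _) (norm_nonneg _) (by linarith)
        _ ≤ L * K * (p.1 * E) := le_mul_of_one_le_right (by positivity)
            (one_le_mul_of_one_le_of_one_le h1 hE1)
        _ = _ := by field_simp
    · rw [hFle p hp]
      obtain ⟨h1, h2⟩ := hbase p hp
      have hp0 : 0 < p.1 := by linarith
      rcases le_or_gt p.1 (Real.exp (2 * (k * l))) with h3 | h3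
      · refine (hshiu p.1 h1 h2 h3 p.2).trans ?_
        refine mul_le_mul_of_nonneg_right ?_ (hpos p hp).le
        linarith
      · have h4 := H₁ f Λf h q L l p.1 (R * E / q.totient) hl1 hL1 hT h2 h3.le hp.2
          (fun v hv hvp b => by
            have h5 := (hFle (v, b) ⟨hv, hvp.trans hp.2⟩ R).1 (hRs (v, b) ⟨hv, hvp.trans hp.2⟩)
            refine h5.trans (le_of_eq ?_)
            ring) p.2
        refine h4.trans ?_
        have h6 : C₁ * (p.1 / q.totient) * (J + 1) ≤ C * (p.1 * E / q.totient) := by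
          calc C₁ * (p.1 / q.totient) * (J + 1) ≤ C * (p.1 / q.totient) * E := by
                have : C₁ ≤ C := by
                  have : 0 < C₂ * (2 * k) ^ κ := by positivity
                  linarith
                have : J + 1 ≤ E := by linarith
                gcongr
            _ = _ := by ring
        calc _ ≤ C * (p.1 * E / q.totient) + R * E / q.totient * p.1 / 2 := by linarith
          _ = _ := by ring
  have hmem : ((Real.exp L, b) : ℝ × (ZMod q)ˣ) ∈ s := ⟨Real.exp_le_exp.2 hLk, le_rfl⟩
  have h1 := (hFle _ hmem _).1 (hbound _ hmem)
  simp only [Real.log_exp] at h1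
  refine h1.trans (le_of_eq ?_)
  ring

theorem exists_integral_unitSum_exp_le {κ : ℝ} (hκ : 0 < κ) : ∃ C L₀ : ℝ, 0 < C ∧
    1 ≤ L₀ ∧ ∀ f Λf, IsHalaszClass κ f Λf → ∀ (q : ℕ) [NeZero q] (L M l : ℝ), L₀ ≤ L → 1 ≤ l →
    -(1 / 2) ≤ M →
    (∀ (χ : DirichletCharacter ℂ q) (t : ℝ), |t| ≤ L ^ κ →
      ‖FserChi f χ ((1 + 1 / L : ℝ) + t * I) / ((1 + 1 / L : ℝ) + t * I)‖ ≤
        Real.exp (-M) * L ^ κ) →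
    Real.exp 1 * ((q : ℝ) * L ^ κ) ^ 4 ≤ Real.exp l →
    ∫ v in Set.Ioc 0 (Real.exp L), unitSum f q v / v ^ 2 ≤
      C * ((1 + M) * Real.exp (-M) * L ^ κ + l ^ κ) := by
  obtain ⟨C₁, L₀, hC₁, hL₀, H₁⟩ := exists_integral_unitConvSum_le hκ
  obtain ⟨C₂, hC₂, H₂⟩ := exists_sum_norm_div_le hκ
  obtain ⟨C₀, hC₀, H₀⟩ := sum_vonMangoldt_div_le
  set k := 4 + 4 * κ * (1 + C₀) with hk
  have hk4 : 4 ≤ k := by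
    have : 0 ≤ 4 * κ * (1 + C₀) := by positivity
    linarith
  refine ⟨2 * C₁ + 2 * (C₂ * k ^ κ), L₀, by positivity, hL₀,
    fun f Λf h q _ L M l hL hl hM hQ hT => ?_⟩
  have hkl : 4 ≤ k * l := by nlinarith
  set Y := Real.exp (k * l) with hY
  have hY2 : Real.exp 2 ≤ Y := Real.exp_le_exp.2 (by linarith)
  have hlogY : Real.log Y = k * l := Real.log_exp _
  have hsum : 4 * κ * ∑ d ∈ Finset.Icc 1 ⌊Real.exp l⌋₊, ArithmeticFunction.vonMangoldt d / d ≤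
      k * l := by
    have h1 : 1 ≤ ⌊Real.exp l⌋₊ := Nat.le_floor (by
      have := Real.add_one_le_exp l
      push_cast
      linarith)
    have h2 : Real.log (⌊Real.exp l⌋₊ : ℕ) ≤ l := by
      rw [Real.log_le_iff_le_exp (by exact_mod_cast h1)]
      exact Nat.floor_le (Real.exp_pos _).le
    have h3 := H₀ _ h1
    have h4 : 0 ≤ κ * C₀ * (l - 1) := mul_nonneg (by positivity) (by linarith)
    calc _ ≤ 4 * κ * (l + C₀) := mul_le_mul_of_nonneg_left (by linarith) (by positivity)
      _ ≤ k * l := by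
        rw [hk]
        nlinarith
  have h1 := h.integral_unitSum_div_sq_le_two_mul hκ.le q (x := Real.exp L) (y := Real.exp l)
    (Y := Y) (by rw [hlogY]; exact hkl)
    (by rw [hY]; exact Real.one_lt_exp_iff.2 (by linarith)) (by rw [hlogY]; exact hsum)
  have h2 := H₁ f Λf h q L M (Real.exp l) Y hL hM hQ hT hY2
  have h3 := (integral_unitSum_div_sq_le f q Y).trans (H₂ f Λf h Y (by
    have := Real.add_one_le_exp 2
    linarith))
  rw [hlogY, Real.mul_rpow (by linarith) (by linarith)] at h3
  set W := (1 + M) * Real.exp (-M) * L ^ κ with hW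
  have hL0 : 0 < L := by linarith
  have hM1 : 0 ≤ 1 + M := by linarith
  have hW0 : 0 ≤ W := by positivity
  have hlκ : 0 < l ^ κ := by positivity
  have h4 : 0 ≤ C₂ * k ^ κ * W := by positivity
  have h5 : 0 ≤ C₁ * l ^ κ := by positivity
  linarith

theorem norm_FserChi_div_le {κ : ℝ} (hκ : 0 < κ) {f Λf : ℕ → ℂ} (h : IsHalaszClass κ f Λf) {q : ℕ}
    (χ : DirichletCharacter ℂ q) {L : ℝ} (hL : 0 < L) (t : ℝ) :
    ‖FserChi f χ ((1 + 1 / L : ℝ) + t * I) / ((1 + 1 / L : ℝ) + t * I)‖ ≤ (1 + L) ^ κ := by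
  have hre : (((1 + 1 / L : ℝ) : ℂ) + t * I).re = 1 + 1 / L := by simp
  have hL' : 0 < 1 / L := by positivity
  have h1 := norm_FserChi_le hκ h χ (s := ((1 + 1 / L : ℝ) : ℂ) + t * I) (by rw [hre]; linarith)
  rw [hre, add_sub_cancel_left, one_div_one_div] at h1
  have h2 : 1 ≤ ‖((1 + 1 / L : ℝ) : ℂ) + t * I‖ := by
    have := (le_abs_self _).trans (Complex.abs_re_le_norm (((1 + 1 / L : ℝ) : ℂ) + t * I))
    rw [hre] at this
    linarith
  rw [norm_div]
  exact (div_le_self (norm_nonneg _) h2).trans h1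

theorem halasz_arith_progressions_corollary (κ : ℝ) (hκ : 0 < κ) :
    ∃ C : ℝ, 0 < C ∧ ∀ f Λf : ℕ → ℂ, IsHalaszClass κ f Λf →
    ∀ q a : ℕ, 1 ≤ q → Nat.Coprime a q →
    ∀ x : ℝ, (q : ℝ) ^ 4 ≤ x → C ≤ x →
    ∀ M : DirichletCharacter ℂ q → ℝ,
      (∀ χ : DirichletCharacter ℂ q,
        (⨆ t : {t : ℝ // |t| ≤ Real.log x ^ κ},
            ‖FserChi f χ (((1 + 1 / Real.log x : ℝ) : ℂ) + ((t : ℝ) : ℂ) * Complex.I) /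
              (((1 + 1 / Real.log x : ℝ) : ℂ) + ((t : ℝ) : ℂ) * Complex.I)‖)
          = Real.exp (-(M χ)) * Real.log x ^ κ) →
    ∀ Mq : ℝ, (∀ χ : DirichletCharacter ℂ q, Mq ≤ M χ) →
      (∃ χ : DirichletCharacter ℂ q, M χ = Mq) →
    ‖∑ n ∈ (Finset.Icc 1 ⌊x⌋₊).filter (fun n : ℕ => (n : ZMod q) = (a : ZMod q)), f n‖ ≤
      C * (1 / (q.totient : ℝ)) * (x / Real.log x) *
        ((1 + Mq) * Real.exp (-Mq) * Real.log x ^ κ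
          + Real.log ((q : ℝ) * Real.log x) ^ κ) := by
  obtain ⟨C₁, l₀, hC₁, hl₀, H₁⟩ := exists_mul_norm_resSum_exp_le hκ
  obtain ⟨C₂, L₀, hC₂, hL₀, H₂⟩ := exists_integral_unitSum_exp_le hκ
  set B := 5 + 4 * κ with hB
  have hB5 : 5 < B := by linarith
  set L₁ := Real.exp l₀ + L₀ + 2 * κ + 3 with hL₁
  have hel₀ := Real.add_one_le_exp l₀
  set C := C₁ * (C₂ + C₂ * B ^ κ + 2 * B ^ κ) + Real.exp L₁ with hC
  have hC' : 0 < C₁ * (C₂ + C₂ * B ^ κ + 2 * B ^ κ) := by positivity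
  refine ⟨C, by positivity, fun f Λf h q a hq hcop x hqx hCx M hM Mq hMq hex => ?_⟩
  have hLx : Real.exp L₁ ≤ x := by linarith
  have hx0 : 0 < x := (Real.exp_pos _).trans_le hLx
  set L := Real.log x with hL
  have hxL : x = Real.exp L := (Real.exp_log hx0).symm
  have hL₁L : L₁ ≤ L := by rwa [hL, Real.le_log_iff_exp_le hx0]
  have hL3 : 3 ≤ L := by linarith
  have hL0 : 0 < L := by linarith
  have : NeZero q := ⟨by omega⟩
  have hφ0 : (0 : ℝ) < q.totient := by exact_mod_cast Nat.totient_pos.2 hq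
  have hq1 : (1 : ℝ) ≤ q := by exact_mod_cast hq
  have hLκ : 0 < L ^ κ := by positivity
  have hpt : ∀ (χ : DirichletCharacter ℂ q) (t : ℝ), |t| ≤ L ^ κ →
      ‖FserChi f χ ((1 + 1 / L : ℝ) + t * I) / ((1 + 1 / L : ℝ) + t * I)‖ ≤
        Real.exp (-Mq) * L ^ κ := by
    intro χ t ht
    have h1 : ‖FserChi f χ ((1 + 1 / L : ℝ) + t * I) / ((1 + 1 / L : ℝ) + t * I)‖ ≤
        Real.exp (-(M χ)) * L ^ κ := by
      rw [← hM χ]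
      refine le_ciSup (f := fun t : {t : ℝ // |t| ≤ L ^ κ} =>
        ‖FserChi f χ (((1 + 1 / L : ℝ) : ℂ) + ((t : ℝ) : ℂ) * Complex.I) /
          (((1 + 1 / L : ℝ) : ℂ) + ((t : ℝ) : ℂ) * Complex.I)‖) ⟨(1 + L) ^ κ, ?_⟩ ⟨t, ht⟩
      rintro _ ⟨t', rfl⟩
      exact norm_FserChi_div_le hκ h χ hL0 t'
    refine h1.trans (mul_le_mul_of_nonneg_right (Real.exp_le_exp.2 ?_) hLκ.le)
    linarith [hMq χ]
  have hMhalf : -(1 / 2) ≤ Mq := by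
    obtain ⟨χ, hχ⟩ := hex
    have : Nonempty {t : ℝ // |t| ≤ L ^ κ} := ⟨⟨0, by rw [abs_zero]; exact hLκ.le⟩⟩
    have h1 : Real.exp (-Mq) * L ^ κ ≤ (1 + L) ^ κ := by
      rw [← hχ, ← hM χ]
      exact ciSup_le fun t => norm_FserChi_div_le hκ h χ hL0 t
    have h2 : (1 + L) ^ κ ≤ Real.exp (1 / 2) * L ^ κ := by
      have h3 : 1 + L ≤ Real.exp (1 / L) * L := by
        have h4 := mul_le_mul_of_nonneg_right (Real.add_one_le_exp (1 / L)) hL0.le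
        refine le_trans (le_of_eq ?_) h4
        field_simp
      refine (Real.rpow_le_rpow (by linarith) h3 hκ.le).trans ?_
      rw [Real.mul_rpow (Real.exp_pos _).le hL0.le, ← Real.exp_mul]
      refine mul_le_mul_of_nonneg_right (Real.exp_le_exp.2 ?_) hLκ.le
      rw [one_div_mul_eq_div, div_le_iff₀ hL0]
      linarith [Real.exp_pos l₀]
    have h5 := Real.exp_le_exp.1 (le_of_mul_le_mul_right (h1.trans h2) hLκ)
    linarith
  set l' := Real.log ((q : ℝ) * L) with hl'
  have hqL : L ≤ (q : ℝ) * L := le_mul_of_one_le_left hL0.le hq1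
  have hl'₀ : l₀ ≤ l' := by
    rw [hl', Real.le_log_iff_exp_le (by linarith)]
    linarith
  have hl'1 : 1 ≤ l' := hl₀.trans hl'₀
  have hBl : l' ≤ B * l' := le_mul_of_one_le_left (by linarith) (by linarith)
  have hT : Real.exp 1 * ((q : ℝ) * L ^ κ) ^ 4 ≤ Real.exp (B * l') := by
    have h1 : Real.exp (B * l') = ((q : ℝ) * L) ^ (5 : ℕ) * ((q : ℝ) * L) ^ (4 * κ) := by
      rw [hB, add_mul, Real.exp_add, Real.rpow_def_of_pos (by linarith), mul_comm (Real.log _),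
        show (5 : ℝ) * l' = ((5 : ℕ) : ℝ) * l' by norm_num, Real.exp_nat_mul, hl',
        Real.exp_log (by linarith)]
    have h2 : (L ^ κ) ^ 4 = L ^ (4 * κ) := by
      rw [← Real.rpow_natCast, ← Real.rpow_mul hL0.le, mul_comm κ]
      norm_num
    have h3 : L ^ (4 * κ) ≤ ((q : ℝ) * L) ^ (4 * κ) :=
      Real.rpow_le_rpow hL0.le hqL (by linarith)
    have h4 : Real.exp 1 * (q : ℝ) ^ 4 ≤ ((q : ℝ) * L) ^ (5 : ℕ) := by
      have h5 : Real.exp 1 ≤ L := by linarith [Real.exp_one_lt_d9]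
      have h6 : (q : ℝ) ^ 4 ≤ (q : ℝ) ^ 5 := pow_le_pow_right₀ hq1 (by norm_num)
      have h7 : L ≤ L ^ 5 := le_self_pow₀ (by linarith) (by norm_num)
      calc Real.exp 1 * (q : ℝ) ^ 4 ≤ L ^ 5 * (q : ℝ) ^ 5 :=
            mul_le_mul (h5.trans h7) h6 (by positivity) (by positivity)
        _ = _ := by ring
    rw [h1, mul_pow, h2, ← mul_assoc]
    exact mul_le_mul h4 h3 (by positivity) (by positivity)
  obtain ⟨b, hb⟩ : ∃ b : (ZMod q)ˣ, (b : ZMod q) = (a : ZMod q) :=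
    ⟨ZMod.unitOfCoprime a hcop, ZMod.coe_unitOfCoprime a hcop⟩
  have hJ := H₂ f Λf h q L Mq (B * l') (by linarith [Real.exp_pos l₀]) (by linarith) hMhalf hpt hT
  have hN := H₁ f Λf h q L (B * l') (by linarith) (by linarith) hT (hxL ▸ hqx) b
  rw [← hxL, hb] at hN
  rw [← hxL] at hJ
  change ‖resSum f x (a : ZMod q)‖ ≤ _
  rw [Real.mul_rpow (by linarith) (by linarith)] at hJ hN
  set W := (1 + Mq) * Real.exp (-Mq) * L ^ κ with hW
  have hM1 : 0 ≤ 1 + Mq := by linarith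
  have hW0 : 0 ≤ W := by positivity
  have hlκ : 1 ≤ l' ^ κ := Real.one_le_rpow hl'1 hκ.le
  have hBκ : 1 ≤ B ^ κ := Real.one_le_rpow (by linarith) hκ.le
  have hE : (∫ v in Set.Ioc 0 x, unitSum f q v / v ^ 2) + B ^ κ * l' ^ κ + 1 ≤
      (C₂ + C₂ * B ^ κ + 2 * B ^ κ) * (W + l' ^ κ) := by
    have h1 : 1 ≤ B ^ κ * l' ^ κ := one_le_mul_of_one_le_of_one_le hBκ hlκ
    have h2 : 0 ≤ C₂ * B ^ κ * W := by positivity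
    have h3 : 0 ≤ B ^ κ * W := by positivity
    have h4 : 0 ≤ C₂ * l' ^ κ := by positivity
    linarith
  have hle : C₁ * (C₂ + C₂ * B ^ κ + 2 * B ^ κ) ≤ C := by linarith [Real.exp_pos L₁]
  have hfin : L * ‖resSum f x (a : ZMod q)‖ ≤ C * (x / q.totient) * (W + l' ^ κ) := by
    calc _ ≤ C₁ * (x / q.totient) * ((C₂ + C₂ * B ^ κ + 2 * B ^ κ) * (W + l' ^ κ)) :=
          hN.trans (mul_le_mul_of_nonneg_left hE (by positivity))
      _ = C₁ * (C₂ + C₂ * B ^ κ + 2 * B ^ κ) * ((x / q.totient) * (W + l' ^ κ)) := by ring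
      _ ≤ C * ((x / q.totient) * (W + l' ^ κ)) := by gcongr
      _ = _ := by ring
  calc ‖resSum f x (a : ZMod q)‖ = L * ‖resSum f x (a : ZMod q)‖ / L := by field_simp
    _ ≤ C * (x / q.totient) * (W + l' ^ κ) / L := by gcongr
    _ = _ := by ring
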